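/- Under Assumptions A1, A2, A3, as n → ∞ the probability that the branching process in random environment becomes extinct exactly at moment n+1 satisfies P(T = n+1) ∼ c·n^{-3/2} for some constant c ∈ (0, ∞). -/

import Mathlib

open MeasureTheory ProbabilityTheory Filter Set Topology

noncomputable section

namespace BPREpaper

variable {Ω : Type*} [MeasurableSpace Ω]

/-- The random walk `S n = X 1 + ... + X n` (increments indexed from `1`, `S 0 = 0`). -/
def walk (X : ℕ → Ω → ℝ) (n : ℕ) (ω : Ω) : ℝ := ∑ i ∈ Finset.Icc 1 n, X i ω

/-- `Mwalk X n = max (S 1, ..., S n)` for `n ≥ 1` (junk value `0` for `n = 0`). -/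
def Mwalk (X : ℕ → Ω → ℝ) : ℕ → Ω → ℝ
  | 0, _ => 0
  | n + 1, ω =>
      (Finset.Icc 1 (n + 1)).sup' (Finset.nonempty_Icc.mpr (by omega)) fun i => walk X i ω

/-- `Lwalk X n = min (S 1, ..., S n)` for `n ≥ 1` (junk value `0` for `n = 0`). -/
def Lwalk (X : ℕ → Ω → ℝ) : ℕ → Ω → ℝ
  | 0, _ => 0
  | n + 1, ω =>
      (Finset.Icc 1 (n + 1)).inf' (Finset.nonempty_Icc.mpr (by omega)) fun i => walk X i ω

/-- minimum of `S 0, S 1, ..., S n`. -/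
def minWalk (X : ℕ → Ω → ℝ) (n : ℕ) (ω : Ω) : ℝ :=
  (Finset.range (n + 1)).inf' (by simp) fun i => walk X i ω

/-- `τ(n)`: the first moment at which the minimum of `S 0, ..., S n` is attained. -/
def tauWalk (X : ℕ → Ω → ℝ) (n : ℕ) (ω : Ω) : ℕ :=
  sInf {i : ℕ | walk X i ω = minWalk X n ω}

/-- The renewal function `u(x) = 1 + ∑_{k ≥ 1} P(-S_k ≤ x, M_k < 0)` for `x ≥ 0`,
`u(x) = 0` for `x < 0`. -/
def uFun (μ : Measure Ω) (X : ℕ → Ω → ℝ) (x : ℝ) : ℝ :=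
  if 0 ≤ x then
    1 + ∑' k : ℕ, (μ {ω | -walk X (k + 1) ω ≤ x ∧ Mwalk X (k + 1) ω < 0}).toReal
  else 0

/-- The renewal function `v(x) = 1 + ∑_{k ≥ 1} P(-S_k > x, L_k ≥ 0)` for `x ≤ 0`,
`v(x) = 0` for `x > 0`. -/
def vFun (μ : Measure Ω) (X : ℕ → Ω → ℝ) (x : ℝ) : ℝ :=
  if x ≤ 0 then
    1 + ∑' k : ℕ, (μ {ω | x < -walk X (k + 1) ω ∧ 0 ≤ Lwalk X (k + 1) ω}).toReal
  else 0

/-- The event `{∀ 1 ≤ i ≤ n, x + S_i ≥ 0} = {L_n ≥ 0}` for the walk started at `x`. -/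
def posSet (X : ℕ → Ω → ℝ) (x : ℝ) (n : ℕ) : Set Ω :=
  {ω | ∀ i ∈ Finset.Icc 1 n, 0 ≤ x + walk X i ω}

/-- The event `{∀ 1 ≤ i ≤ n, x + S_i < 0} = {M_n < 0}` for the walk started at `x`. -/
def negSet (X : ℕ → Ω → ℝ) (x : ℝ) (n : ℕ) : Set Ω :=
  {ω | ∀ i ∈ Finset.Icc 1 n, x + walk X i ω < 0}

/-- A distribution on `ℝ` is non-lattice: it is not concentrated on any arithmetic
progression `a + hℤ`. -/
def NonLattice (ν : Measure ℝ) : Prop :=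
  ¬ ∃ a h : ℝ, ν {x | ∃ k : ℤ, x = a + k * h} = 1

/-- `ν` is an `α`-stable law on `ℝ`. -/
def IsStableLaw (α : ℝ) (ν : Measure ℝ) : Prop :=
  ∀ a b : ℝ, 0 < a → 0 < b → ∃ c d : ℝ, 0 < c ∧ a ^ α + b ^ α = c ^ α ∧
    ((ν.map (fun x => a * x)).prod (ν.map (fun x => b * x))).map (fun p : ℝ × ℝ => p.1 + p.2)
      = ν.map (fun x => c * x + d)

/-- Weak convergence of a sequence of laws on `ℝ`, tested against bounded continuous
functions. -/
def WeakTendsto (μs : ℕ → Measure ℝ) (ν : Measure ℝ) : Prop :=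
  ∀ g : BoundedContinuousFunction ℝ ℝ,
    Tendsto (fun n => ∫ x, g x ∂(μs n)) atTop (𝓝 (∫ x, g x ∂ν))

/-- Assumption A4: there are norming constants `c n → ∞` such that `S n / c n` converges in
distribution to an `α`-stable law concentrated neither on `[0,∞)` nor on `(-∞,0]`; the
increment distribution is non-lattice. -/
def AssumptionA4 (μ : Measure Ω) (X : ℕ → Ω → ℝ) (c : ℕ → ℝ) : Prop :=
  Tendsto c atTop atTop ∧ NonLattice (μ.map (X 1)) ∧
    ∃ (α : ℝ) (ν : Measure ℝ), IsProbabilityMeasure ν ∧ IsStableLaw α ν ∧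
      0 < ν (Set.Iio 0) ∧ 0 < ν (Set.Ioi 0) ∧
      WeakTendsto (fun n => μ.map fun ω => walk X n ω / c n) ν

/-- A family of random elements indexed by `ι` which is i.i.d. (the common distribution
being that of the element with index `i0`). -/
def IIDfam {ι : Type*} {E : Type*} [MeasurableSpace E] (μ : Measure Ω) (Q : ι → Ω → E)
    (i0 : ι) : Prop :=
  (∀ i, Measurable (Q i)) ∧ iIndepFun Q μ ∧
    ∀ i, IdentDistrib (Q i) (Q i0) μ μ

/-- An i.i.d. sequence indexed by `ℕ` (indices from `1` are the relevant ones). -/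
def IIDseq {E : Type*} [MeasurableSpace E] (μ : Measure Ω) (Q : ℕ → Ω → E) : Prop :=
  IIDfam μ Q 1

/-- `P` is the h-transform measure `P_x⁺`: for every `n` and every bounded
`F n`-measurable `g`, `E_P[g] = u(x)⁻¹ E_x[g · u(S_n); L_n ≥ 0]`. -/
def IsPplus (μ : Measure Ω) (X : ℕ → Ω → ℝ) (F : ℕ → MeasurableSpace Ω) (x : ℝ)
    (P : Measure Ω) : Prop :=
  IsProbabilityMeasure P ∧
    ∀ (n : ℕ) (g : Ω → ℝ), Measurable[F n] g → (∃ C, ∀ ω, |g ω| ≤ C) →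
      ∫ ω, g ω ∂P =
        (uFun μ X x)⁻¹ * ∫ ω in posSet X x n, g ω * uFun μ X (x + walk X n ω) ∂μ

/-- `P` is the h-transform measure `P_x⁻`: for every `n` and every bounded
`F n`-measurable `g`, `E_P[g] = v(x)⁻¹ E_x[g · v(S_n); M_n < 0]`. -/
def IsPminus (μ : Measure Ω) (X : ℕ → Ω → ℝ) (F : ℕ → MeasurableSpace Ω) (x : ℝ)
    (P : Measure Ω) : Prop :=
  IsProbabilityMeasure P ∧
    ∀ (n : ℕ) (g : Ω → ℝ), Measurable[F n] g → (∃ C, ∀ ω, |g ω| ≤ C) →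
      ∫ ω, g ω ∂P =
        (vFun μ X x)⁻¹ * ∫ ω in negSet X x n, g ω * vFun μ X (x + walk X n ω) ∂μ

/-- The filtration generated by the environment `Q 1, ..., Q n`. -/
def envFiltration {E : Type*} [MeasurableSpace E] (Q : ℕ → Ω → E) (n : ℕ) :
    MeasurableSpace Ω :=
  ⨆ i ∈ Finset.Icc 1 n, MeasurableSpace.comap (Q i) inferInstance

/-- The σ-algebra generated by the whole environment `Q 1, Q 2, ...`. -/
def envSigma {E : Type*} [MeasurableSpace E] (Q : ℕ → Ω → E) : MeasurableSpace Ω :=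
  ⨆ i, MeasurableSpace.comap (Q (i + 1)) inferInstance




/-- Probability generating function of the (random) offspring law `Q n`. -/
def pgf (Q : ℕ → Ω → Measure ℕ) (n : ℕ) (ω : Ω) (s : ℝ) : ℝ :=
  ∑' i : ℕ, (Q n ω {i}).toReal * s ^ i

/-- Mean `m(Q_n)` of the offspring law `Q n`. -/
def meanQ (Q : ℕ → Ω → Measure ℕ) (n : ℕ) (ω : Ω) : ℝ :=
  ∑' i : ℕ, (i : ℝ) * (Q n ω {i}).toReal

/-- `X_n = log f_n'(1)`, the increments of the associated random walk. -/
def Xenv (Q : ℕ → Ω → Measure ℕ) (n : ℕ) (ω : Ω) : ℝ := Real.log (meanQ Q n ω)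

/-- `η_n = f_n''(1) / (2 f_n'(1)^2)`. -/
def etaEnv (Q : ℕ → Ω → Measure ℕ) (n : ℕ) (ω : Ω) : ℝ :=
  (∑' i : ℕ, ((i : ℝ) * ((i : ℝ) - 1)) * (Q n ω {i}).toReal) / (2 * meanQ Q n ω ^ 2)

/-- The associated random walk `S_n = X_1 + ... + X_n`. -/
def Senv (Q : ℕ → Ω → Measure ℕ) : ℕ → Ω → ℝ := walk (Xenv Q)

/-- The composition `f_{j,n}(s) = f_{j+1}(f_{j+2}(⋯ f_n(s) ⋯))`, with `f_{j,n} = id` for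
`n ≤ j`. -/
def pgfComp (Q : ℕ → Ω → Measure ℕ) (j : ℕ) : ℕ → Ω → ℝ → ℝ
  | 0, _, s => s
  | n + 1, ω, s => if n + 1 ≤ j then s else pgfComp Q j n ω (pgf Q (n + 1) ω s)

/-- `b_n = ∑_{i=0}^{n-1} η_{i+1} e^{-S_i}`. -/
def bEnv (Q : ℕ → Ω → Measure ℕ) (n : ℕ) (ω : Ω) : ℝ :=
  ∑ i ∈ Finset.range n, etaEnv Q (i + 1) ω * Real.exp (-(Senv Q i ω))

/-- `B⁺ = ∑_{i=0}^∞ η_{i+1} e^{-S_i}`. -/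
def Bplus (Q : ℕ → Ω → Measure ℕ) (ω : Ω) : ℝ :=
  ∑' i : ℕ, etaEnv Q (i + 1) ω * Real.exp (-(Senv Q i ω))

/-- `B⁻ = ∑_{i=1}^∞ η_i e^{S_i}`. -/
def Bminus (Q : ℕ → Ω → Measure ℕ) (ω : Ω) : ℝ :=
  ∑' i : ℕ, etaEnv Q (i + 1) ω * Real.exp (Senv Q (i + 1) ω)

/-- `V_∞(r) = 1 / (B⁻ + (1 - r)⁻¹)`. -/
def Vinf (Q : ℕ → Ω → Measure ℕ) (r : ℝ) (ω : Ω) : ℝ := (Bminus Q ω + (1 - r)⁻¹)⁻¹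

/-- All the offspring generating functions are fractional linear:
`1/(1 - f_n(s)) = e^{-X_n}/(1-s) + η_n`. -/
def FracLinear (Q : ℕ → Ω → Measure ℕ) : Prop :=
  ∀ n, 1 ≤ n → ∀ ω : Ω, ∀ s : ℝ, 0 ≤ s → s < 1 →
    (1 - pgf Q n ω s)⁻¹ = Real.exp (-(Xenv Q n ω)) / (1 - s) + etaEnv Q n ω

/-- Assumption A1 with explicit constant `χ`. -/
def AssumptionA1With (μ : Measure Ω) (Q : ℕ → Ω → Measure ℕ) (χ : ℝ) : Prop :=
  0 < χ ∧ χ < 1 / 2 ∧ ∀ n, 1 ≤ n →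
    ∀ᵐ ω ∂μ, χ ≤ pgf Q n ω 0 ∧ pgf Q n ω 0 ≤ 1 - χ ∧ χ ≤ etaEnv Q n ω

/-- Assumption A1: for some `χ ∈ (0,1/2)`, `χ ≤ f(0) ≤ 1 - χ` and `η ≥ χ` a.s. -/
def AssumptionA1 (μ : Measure Ω) (Q : ℕ → Ω → Measure ℕ) : Prop :=
  ∃ χ : ℝ, AssumptionA1With μ Q χ

/-- Assumption A2: `X` has zero mean, finite positive variance and is non-lattice. -/
def AssumptionA2 (μ : Measure Ω) (Q : ℕ → Ω → Measure ℕ) : Prop :=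
  Integrable (Xenv Q 1) μ ∧ (∫ ω, Xenv Q 1 ω ∂μ) = 0 ∧
    Integrable (fun ω => Xenv Q 1 ω ^ 2) μ ∧ 0 < ∫ ω, Xenv Q 1 ω ^ 2 ∂μ ∧
    NonLattice (μ.map (Xenv Q 1))

/-- `ζ(a) = ∑_{y ≥ a} y² Q({y}) / m(Q)²`. -/
def zetaEnv (Q : ℕ → Ω → Measure ℕ) (a : ℕ) (ω : Ω) : ℝ :=
  (∑' y : ℕ, if a ≤ y then (y : ℝ) ^ 2 * (Q 1 ω {y}).toReal else 0) / meanQ Q 1 ω ^ 2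

/-- Assumption A3: `E[(log⁺ ζ(a))^{2+ε}] < ∞` for some `ε > 0`, `a ∈ ℕ`. -/
def AssumptionA3 (μ : Measure Ω) (Q : ℕ → Ω → Measure ℕ) : Prop :=
  ∃ ε : ℝ, 0 < ε ∧ ∃ a : ℕ, 1 ≤ a ∧
    Integrable (fun ω => Real.log (max (zetaEnv Q a ω) 1) ^ (2 + ε)) μ

/-- The extinction moment `T = min {k ≥ 0 : Z_k = 0}`. -/
def extinctTime (Z : ℕ → Ω → ℕ) (ω : Ω) : ℕ := sInf {k | Z k ω = 0}

/-- The branching property of `Z` in the environment `Q` (started from one particle):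
given the environment and `Z_k`, the conditional generating function of `Z_n` is
`f_{k,n}(s)^{Z_k}`; the state `0` is absorbing. -/
def BranchingProperty (μ : Measure Ω) (Q : ℕ → Ω → Measure ℕ) (Z : ℕ → Ω → ℕ) : Prop :=
  (∀ ω, Z 0 ω = 1) ∧ (∀ n, Measurable (Z n)) ∧ (∀ n ω, Z n ω = 0 → Z (n + 1) ω = 0) ∧
    ∀ k n : ℕ, k ≤ n → ∀ s : ℝ, 0 ≤ s → s ≤ 1 →
      (μ[fun ω => s ^ Z n ω | envSigma Q ⊔ MeasurableSpace.comap (Z k) inferInstance])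
        =ᵐ[μ] fun ω => pgfComp Q k n ω s ^ Z k ω

/-- The polynomial weight `(n + 1) ^ (3 / 2)`. -/
def wt (n : ℕ) : ℝ := (n + 1) * √(n + 1)

lemma wt_pos (n : ℕ) : 0 < wt n := by unfold wt; positivity

lemma wt_eq_rpow (n : ℕ) : wt n = ((n : ℝ) + 1) ^ ((3 : ℝ) / 2) := by
  have h : (0 : ℝ) < n + 1 := by positivity
  rw [wt, Real.sqrt_eq_rpow, show ((3 : ℝ) / 2) = 1 + 1 / 2 by norm_num, Real.rpow_add h,
    Real.rpow_one]

lemma wt_mono {m n : ℕ} (h : m ≤ n) : wt m ≤ wt n := by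
  unfold wt
  have : (m : ℝ) ≤ n := by exact_mod_cast h
  gcongr

/-- Halving the index costs at most a factor `3`. -/
lemma wt_le_three_mul {m n : ℕ} (h : n ≤ 2 * m) : wt n ≤ 3 * wt m := by
  have h1 : (n : ℝ) ≤ 2 * m := by exact_mod_cast h
  have h2 : √((n : ℝ) + 1) ≤ (3 / 2) * √((m : ℝ) + 1) := by
    apply Real.sqrt_le_iff.mpr
    refine ⟨by positivity, ?_⟩
    rw [mul_pow, Real.sq_sqrt (by positivity)]
    nlinarith
  unfold wt
  calc ((n : ℝ) + 1) * √((n : ℝ) + 1) ≤ (2 * (m + 1)) * ((3 / 2) * √((m : ℝ) + 1)) := by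
        gcongr; linarith
    _ = _ := by ring

lemma summable_inv_wt : Summable fun n : ℕ => (wt n)⁻¹ := by
  have h : Summable fun n : ℕ => 1 / ((n : ℝ) ^ ((3 : ℝ) / 2)) :=
    Real.summable_one_div_nat_rpow.mpr (by norm_num)
  refine ((summable_nat_add_iff 1).mpr h).congr fun n => ?_
  rw [wt_eq_rpow]; push_cast; rw [one_div]

lemma inv_wt_mul_inv_wt_le {n i : ℕ} (h : i ≤ n) :
    (wt i)⁻¹ * (wt (n - i))⁻¹ ≤ 3 * (wt n)⁻¹ * ((wt i)⁻¹ + (wt (n - i))⁻¹) := by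
  have hi := inv_pos.mpr (wt_pos i)
  have hj := inv_pos.mpr (wt_pos (n - i))
  have hn := inv_pos.mpr (wt_pos n)
  have key : ∀ m, n ≤ 2 * m → (wt m)⁻¹ ≤ 3 * (wt n)⁻¹ := by
    intro m hm
    have := wt_le_three_mul hm
    rw [← div_eq_mul_inv, inv_eq_one_div, div_le_div_iff₀ (wt_pos _) (wt_pos _)]
    linarith
  rcases le_total (2 * i) n with h1 | h1
  · have := key (n - i) (by omega)
    nlinarith [mul_le_mul_of_nonneg_left this hi.le, mul_pos hn hj]
  · have := key i h1
    nlinarith [mul_le_mul_of_nonneg_right this hj.le, mul_pos hn hi]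

lemma tendsto_sum_range_half {a : ℕ → ℝ} {q : ℕ → ℕ → ℝ} {l C : ℝ} {h : ℕ → ℕ}
    (ha : ∀ j, 0 ≤ a j) (hs : Summable a) (hC : ∀ n, ∀ j < h n, |q n j| ≤ C)
    (hh : Tendsto h atTop atTop) (hq : ∀ j, Tendsto (fun n => q n j) atTop (𝓝 l)) :
    Tendsto (fun n => ∑ j ∈ Finset.range (h n), q n j * a j) atTop (𝓝 (l * ∑' j, a j)) := by
  have key := tendsto_tsum_of_dominated_convergence
    (f := fun n j => if j ∈ Finset.range (h n) then q n j * a j else 0)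
    (g := fun j => l * a j) (bound := fun j => |C| * a j) (𝓕 := atTop)
    (hs.mul_left |C|) (fun j => ?_) (Eventually.of_forall fun n j => ?_)
  · rw [tsum_mul_left] at key
    refine key.congr fun n => ?_
    rw [tsum_eq_sum (s := Finset.range (h n)) fun j hj => by rw [if_neg hj]]
    exact Finset.sum_congr rfl fun j hj => by rw [if_pos hj]
  · refine ((hq j).mul_const (a j)).congr' ?_
    filter_upwards [hh.eventually_gt_atTop j] with n hn
    rw [if_pos (Finset.mem_range.mpr hn)]
  · split_ifs with hj
    · rw [Real.norm_eq_abs, abs_mul, abs_of_nonneg (ha j)]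
      exact mul_le_mul_of_nonneg_right
        ((hC n j (Finset.mem_range.mp hj)).trans (le_abs_self C)) (ha j)
    · rw [norm_zero]; exact mul_nonneg (abs_nonneg _) (ha j)

lemma summable_of_wt_mul_le {a : ℕ → ℝ} {C : ℝ} (ha : ∀ j, 0 ≤ a j)
    (hC : ∀ n, wt n * a n ≤ C) : Summable a := by
  refine Summable.of_nonneg_of_le ha (fun n => ?_) (summable_inv_wt.mul_left C)
  rw [← div_eq_mul_inv, le_div_iff₀ (wt_pos n), mul_comm]
  exact hC n

lemma sum_antidiagonal_split (a b : ℕ → ℝ) (n : ℕ) :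
    ∑ k ∈ Finset.range (n + 1), a k * b (n - k) =
      ∑ k ∈ Finset.range (n / 2 + 1), a k * b (n - k) +
        ∑ k ∈ Finset.range ((n + 1) / 2), b k * a (n - k) := by
  rw [← Finset.sum_range_add_sum_Ico _ (show n / 2 + 1 ≤ n + 1 by omega)]
  congr 1
  refine Finset.sum_bij' (fun k _ => n - k) (fun k _ => n - k) ?_ ?_ ?_ ?_ ?_
  · intro k hk; simp at hk ⊢; omega
  · intro k hk; simp at hk ⊢; omega
  · intro k hk; simp at hk ⊢; omega
  · intro k hk; simp at hk ⊢; omega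
  · intro k hk
    simp at hk
    rw [show n - (n - k) = k by omega, mul_comm]

lemma wt_tendsto_bounded {b : ℕ → ℝ} {β : ℝ}
    (hb : Tendsto (fun n => wt n * b n) atTop (𝓝 β)) : ∃ C, 0 ≤ C ∧ ∀ n, |wt n * b n| ≤ C := by
  obtain ⟨C, hC⟩ := hb.abs.bddAbove_range
  exact ⟨C, (abs_nonneg _).trans (hC ⟨0, rfl⟩), fun n => hC ⟨n, rfl⟩⟩

lemma tendsto_wt_ratio (j : ℕ) : Tendsto (fun n => wt n / wt (n - j)) atTop (𝓝 1) := by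
  rw [← tendsto_add_atTop_iff_nat j]
  have h1 : Tendsto (fun m : ℕ => 1 + (j : ℝ) * ((m : ℝ) + 1)⁻¹) atTop (𝓝 (1 + j * 0)) :=
    (tendsto_const_nhds (x := (j : ℝ)).mul (tendsto_inv_atTop_zero.comp
      (tendsto_atTop_add_const_right _ 1 tendsto_natCast_atTop_atTop))).const_add 1
  have h2 := h1.mul (h1.sqrt)
  simp only [mul_zero, add_zero, Real.sqrt_one, mul_one] at h2
  refine h2.congr fun m => ?_
  have h3 : (0 : ℝ) < m + 1 := by positivity
  have h4 : 1 + (j : ℝ) * ((m : ℝ) + 1)⁻¹ = ((m + j : ℕ) + 1) / (m + 1) := by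
    push_cast; field_simp; ring
  rw [h4, Real.sqrt_div' _ h3.le, Nat.add_sub_cancel, wt, wt, div_mul_div_comm]

lemma conv_half_tendsto {a b : ℕ → ℝ} {β C : ℝ} {h : ℕ → ℕ} (ha : ∀ j, 0 ≤ a j)
    (hs : Summable a) (hh : Tendsto h atTop atTop) (hh2 : ∀ n, ∀ j < h n, 2 * j ≤ n)
    (hC : ∀ n, |wt n * b n| ≤ C)
    (hb : Tendsto (fun n => wt n * b n) atTop (𝓝 β)) :
    Tendsto (fun n => wt n * ∑ k ∈ Finset.range (h n), a k * b (n - k)) atTop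
      (𝓝 (β * ∑' j, a j)) := by
  have := tendsto_sum_range_half (q := fun n j => wt n * b (n - j)) (l := β) (C := 3 * C)
    ha hs (fun n j hj => ?_) hh (fun j => ?_)
  · refine this.congr fun n => ?_
    rw [Finset.mul_sum]
    exact Finset.sum_congr rfl fun j _ => by ring
  · have h1 := wt_le_three_mul (n := n) (m := n - j) (by have := hh2 n j hj; omega)
    have h2 := hC (n - j)
    rw [abs_mul, abs_of_pos (wt_pos _)] at h2 ⊢
    nlinarith [abs_nonneg (b (n - j))]
  · have h1 := (tendsto_wt_ratio j).mul (hb.comp (tendsto_sub_atTop_nat j))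
    rw [one_mul] at h1
    refine h1.congr fun n => ?_
    have := (wt_pos (n - j)).ne'
    simp only [Function.comp]
    field_simp

lemma conv_tendsto {a b : ℕ → ℝ} {α β : ℝ} (ha : ∀ j, 0 ≤ a j) (hb : ∀ j, 0 ≤ b j)
    (hα : Tendsto (fun n => wt n * a n) atTop (𝓝 α))
    (hβ : Tendsto (fun n => wt n * b n) atTop (𝓝 β)) :
    Tendsto (fun n => wt n * ∑ k ∈ Finset.range (n + 1), a k * b (n - k)) atTop
      (𝓝 (β * ∑' j, a j + α * ∑' j, b j)) := by
  obtain ⟨A, hA0, hA⟩ := wt_tendsto_bounded hα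
  obtain ⟨B, hB0, hB⟩ := wt_tendsto_bounded hβ
  have sa := summable_of_wt_mul_le ha fun n => (le_abs_self _).trans (hA n)
  have sb := summable_of_wt_mul_le hb fun n => (le_abs_self _).trans (hB n)
  have h1 := conv_half_tendsto (h := fun n => n / 2 + 1) ha sa
    (tendsto_atTop_mono (fun n => show n / 2 ≤ n / 2 + 1 by omega)
      (Nat.tendsto_div_const_atTop (by norm_num))) (fun n j hj => by omega) hB hβ
  have h2 := conv_half_tendsto (h := fun n => (n + 1) / 2) hb sb
    (tendsto_atTop_mono (fun n => show n / 2 ≤ (n + 1) / 2 by omega)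
      (Nat.tendsto_div_const_atTop (by norm_num))) (fun n j hj => by omega) hA hα
  refine (h1.add h2).congr fun n => ?_
  rw [sum_antidiagonal_split, mul_add]

lemma conv_le {a b : ℕ → ℝ} {A B : ℝ} (ha : ∀ j, 0 ≤ a j) (hb : ∀ j, 0 ≤ b j)
    (hA : ∀ n, wt n * a n ≤ A) (hB : ∀ n, wt n * b n ≤ B) (n : ℕ) :
    wt n * ∑ k ∈ Finset.range (n + 1), a k * b (n - k) ≤
      6 * (∑' j, (wt j)⁻¹) * (A * B) := by
  have hA0 : 0 ≤ A := (mul_nonneg (wt_pos 0).le (ha 0)).trans (hA 0)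
  have hB0 : 0 ≤ B := (mul_nonneg (wt_pos 0).le (hb 0)).trans (hB 0)
  have h1 : ∀ k ∈ Finset.range (n + 1), wt n * (a k * b (n - k)) ≤
      3 * (A * B) * ((wt k)⁻¹ + (wt (n - k))⁻¹) := by
    intro k hk
    have h2 := inv_wt_mul_inv_wt_le (n := n) (i := k) (by simp at hk; omega)
    have h3 : a k ≤ A * (wt k)⁻¹ := by
      rw [← div_eq_mul_inv, le_div_iff₀ (wt_pos _), mul_comm]; exact hA k
    have h4 : b (n - k) ≤ B * (wt (n - k))⁻¹ := by
      rw [← div_eq_mul_inv, le_div_iff₀ (wt_pos _), mul_comm]; exact hB _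
    have h5 := mul_inv_cancel₀ (wt_pos n).ne'
    calc wt n * (a k * b (n - k)) ≤ wt n * ((A * (wt k)⁻¹) * (B * (wt (n - k))⁻¹)) := by
          have := wt_pos n
          have := ha k
          have := hb (n - k)
          have := wt_pos k
          gcongr
      _ = (A * B) * (wt n * ((wt k)⁻¹ * (wt (n - k))⁻¹)) := by ring
      _ ≤ (A * B) * (wt n * (3 * (wt n)⁻¹ * ((wt k)⁻¹ + (wt (n - k))⁻¹))) := by
          have := wt_pos n
          gcongr
      _ = _ := by linear_combination (A * B) * 3 * ((wt k)⁻¹ + (wt (n - k))⁻¹) * h5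
  rw [Finset.mul_sum]
  refine (Finset.sum_le_sum h1).trans ?_
  rw [← Finset.mul_sum, Finset.sum_add_distrib,
    Finset.sum_flip (fun k => (wt k)⁻¹)]
  have h6 : ∑ k ∈ Finset.range (n + 1), (wt k)⁻¹ ≤ ∑' j, (wt j)⁻¹ :=
    summable_inv_wt.sum_le_tsum _ fun j _ => (inv_pos.mpr (wt_pos j)).le
  nlinarith [mul_nonneg hA0 hB0]

lemma sum_inv_sqrt_le (m : ℕ) : ∑ k ∈ Finset.range m, (√((k : ℝ) + 1))⁻¹ ≤ 2 * √m := by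
  induction m with
  | zero => simp
  | succ m ih =>
    rw [Finset.sum_range_succ]
    have h1 : 0 < √((m : ℝ) + 1) := by positivity
    have h2 := Real.sq_sqrt (show (0 : ℝ) ≤ m + 1 by positivity)
    have h3 := Real.sq_sqrt (show (0 : ℝ) ≤ m by positivity)
    have h4 : (√((m : ℝ) + 1))⁻¹ ≤ 2 * √((m : ℝ) + 1) - 2 * √m := by
      rw [inv_le_iff_one_le_mul₀ h1]
      nlinarith [sq_nonneg (√((m : ℝ) + 1) - √m)]
    push_cast
    linarith

lemma renewal_split {a p : ℕ → ℝ} (n : ℕ) :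
    ∑ j ∈ Finset.range n, a j * p (n - j) =
      ∑ j ∈ Finset.range (n / 2), a j * p (n - j) +
        ∑ k ∈ Finset.range (n - n / 2), p (k + 1) * a (n - (k + 1)) := by
  rw [← Finset.sum_range_add_sum_Ico _ (show n / 2 ≤ n by omega)]
  congr 1
  refine Finset.sum_bij' (fun k _ => n - k - 1) (fun k _ => n - (k + 1)) ?_ ?_ ?_ ?_ ?_
  · intro k hk; simp at hk ⊢; omega
  · intro k hk; simp at hk ⊢; omega
  · intro k hk; simp at hk ⊢; omega
  · intro k hk; simp at hk ⊢; omega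
  · intro k hk
    simp at hk
    rw [show n - k - 1 + 1 = n - k by omega, show n - (n - k) = k by omega, mul_comm]

lemma sum_mul_le_of_sqrt_mul_le {a p : ℕ → ℝ} {P D : ℝ} {n : ℕ} (ha : ∀ j, 0 ≤ a j)
    (hp : ∀ k : ℕ, 1 ≤ k → √(k : ℝ) * p k ≤ P) (hP : 0 ≤ P) (m : ℕ)
    (hD : ∀ k < m, a (n - (k + 1)) ≤ D) :
    ∑ k ∈ Finset.range m, p (k + 1) * a (n - (k + 1)) ≤ 2 * P * D * √m := by
  rcases Nat.eq_zero_or_pos m with rfl | hm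
  · simp
  have hD0 : 0 ≤ D := (ha _).trans (hD 0 hm)
  have h1 : ∀ k ∈ Finset.range m, p (k + 1) * a (n - (k + 1)) ≤
      P * D * (√((k : ℝ) + 1))⁻¹ := by
    intro k hk
    have h2 := hp (k + 1) (by omega)
    push_cast at h2
    have h3 : 0 < √((k : ℝ) + 1) := by positivity
    have h4 : p (k + 1) ≤ P * (√((k : ℝ) + 1))⁻¹ := by
      rw [← div_eq_mul_inv, le_div_iff₀ h3, mul_comm]; exact h2
    calc p (k + 1) * a (n - (k + 1)) ≤ (P * (√((k : ℝ) + 1))⁻¹) * a (n - (k + 1)) :=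
          mul_le_mul_of_nonneg_right h4 (ha _)
      _ ≤ (P * (√((k : ℝ) + 1))⁻¹) * D :=
          mul_le_mul_of_nonneg_left (hD k (Finset.mem_range.mp hk)) (by positivity)
      _ = _ := by ring
  refine (Finset.sum_le_sum h1).trans ?_
  rw [← Finset.mul_sum]
  have := sum_inv_sqrt_le m
  nlinarith [mul_nonneg hP hD0]

/-- A nonnegative sequence satisfying a Spitzer-type renewal recursion with weights of order
`n ^ (-1/2)` decays like `n ^ (-3/2)`, with explicit constants. -/
lemma renewal_bound {a p : ℕ → ℝ} {P U : ℝ} (ha : ∀ j, 0 ≤ a j)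
    (hp1 : ∀ k, p k ≤ 1) (hp : ∀ k : ℕ, 1 ≤ k → √(k : ℝ) * p k ≤ P)
    (hP : 1 ≤ P) (hU : ∀ n, ∑ j ∈ Finset.range n, a j ≤ U)
    (hrec : ∀ n : ℕ, (n : ℝ) * a n = ∑ j ∈ Finset.range n, a j * p (n - j)) (n : ℕ) :
    (n : ℝ) * √n * a n ≤ 8 * P * U := by
  have hU0 : 0 ≤ U := by simpa using hU 0
  induction n using Nat.strong_induction_on with
  | _ n ih =>
  rcases Nat.eq_zero_or_pos n with rfl | hn
  · simp; positivity
  have hn' : (0 : ℝ) < n := by exact_mod_cast hn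
  have hsn : 0 < √(n : ℝ) := Real.sqrt_pos.mpr hn'
  have hsq := Real.mul_self_sqrt hn'.le
  rcases le_or_gt (√(n : ℝ)) (8 * P) with h | h
  · have h1 : (n : ℝ) * a n ≤ U := by
      rw [hrec]
      refine (Finset.sum_le_sum fun j _ => ?_).trans (hU n)
      exact mul_le_of_le_one_right (ha j) (hp1 _)
    calc (n : ℝ) * √n * a n = √n * (n * a n) := by ring
      _ ≤ (8 * P) * U := mul_le_mul h h1 (mul_nonneg hn'.le (ha n)) (by positivity)
  · have hbig : 64 < (n : ℝ) := by nlinarith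
    have hfar : ∑ j ∈ Finset.range (n / 2), a j * p (n - j) ≤ 2 * P / √n * U := by
      have h1 : ∀ j ∈ Finset.range (n / 2), a j * p (n - j) ≤ 2 * P / √n * a j := by
        intro j hj
        have hj' := Finset.mem_range.mp hj
        have h2 := hp (n - j) (by omega)
        have h3 : √(n : ℝ) ≤ 2 * √((n - j : ℕ) : ℝ) := by
          apply Real.sqrt_le_iff.mpr ⟨by positivity, ?_⟩
          rw [mul_pow, Real.sq_sqrt (by positivity)]
          have : (n : ℝ) ≤ 2 * ((n - j : ℕ) : ℝ) := by
            have : n ≤ 2 * (n - j) := by omega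
            exact_mod_cast this
          linarith
        have h4 : p (n - j) ≤ 2 * P / √n := by
          rw [le_div_iff₀ hsn]
          nlinarith
        rw [mul_comm]
        exact mul_le_mul_of_nonneg_right h4 (ha j)
      refine (Finset.sum_le_sum h1).trans ?_
      rw [← Finset.mul_sum]
      exact mul_le_mul_of_nonneg_left (hU _) (by positivity)
    have hnear : ∑ k ∈ Finset.range (n - n / 2), p (k + 1) * a (n - (k + 1)) ≤
        2 * P * (24 * P * U / (n * √n)) * √((n - n / 2 : ℕ) : ℝ) := by
      refine sum_mul_le_of_sqrt_mul_le ha hp (by linarith) _ fun k hk => ?_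
      have hk' : n ≤ 2 * (n - (k + 1)) + 1 := by omega
      set m := n - (k + 1) with hm
      have hm1 : (n : ℝ) ≤ 2 * m + 1 := by exact_mod_cast hk'
      have hm2 : 0.49 * (n : ℝ) ≤ m := by linarith
      have hm3 : 0.7 * √(n : ℝ) ≤ √(m : ℝ) := by
        apply Real.le_sqrt_of_sq_le
        rw [mul_pow, Real.sq_sqrt hn'.le]
        linarith
      have hm4 : 0.343 * ((n : ℝ) * √n) ≤ m * √(m : ℝ) := by
        calc 0.343 * ((n : ℝ) * √n) = (0.49 * n) * (0.7 * √n) := by ring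
          _ ≤ _ := by gcongr
      have h1 := ih m (by omega)
      rw [le_div_iff₀ (by positivity)]
      nlinarith [mul_le_mul_of_nonneg_right hm4 (ha m), mul_nonneg (mul_pos hn' hsn).le (ha m)]
    have h1 : √((n - n / 2 : ℕ) : ℝ) ≤ 0.72 * √n := by
      apply Real.sqrt_le_iff.mpr ⟨by positivity, ?_⟩
      rw [mul_pow, Real.sq_sqrt hn'.le]
      have : 2 * ((n - n / 2 : ℕ) : ℝ) ≤ n + 1 := by
        have : 2 * (n - n / 2) ≤ n + 1 := by omega
        exact_mod_cast this
      linarith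
    have h2 : 2 * P * (24 * P * U / (n * √n)) * √((n - n / 2 : ℕ) : ℝ) ≤
        2 * P * (24 * P * U / (n * √n)) * (0.72 * √n) := by gcongr
    have h3 : (n : ℝ) * √n * a n = √n * ∑ j ∈ Finset.range n, a j * p (n - j) := by
      rw [← hrec]; ring
    rw [h3, renewal_split]
    calc _ ≤ √n * (2 * P / √n * U + 2 * P * (24 * P * U / (n * √n)) * (0.72 * √n)) := by
          gcongr; exact hnear.trans h2
      _ = 2 * P * U + 34.56 * P * U * (P / √n) := by
          rw [show (n : ℝ) = √n * √n by rw [hsq]]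
          simp only [Real.sqrt_mul_self hsn.le]
          field_simp
          ring
      _ ≤ 2 * P * U + 34.56 * P * U * (1 / 8) := by
          have : P / √(n : ℝ) ≤ 1 / 8 := by rw [div_le_iff₀ hsn]; linarith
          have h0 : 0 ≤ 34.56 * P * U := by positivity
          linarith [mul_le_mul_of_nonneg_left this h0]
      _ ≤ 8 * P * U := by nlinarith [mul_nonneg (show 0 ≤ P by linarith) hU0]

lemma renewal_wt_bound {a p : ℕ → ℝ} {P U : ℝ} (ha : ∀ j, 0 ≤ a j)
    (hp1 : ∀ k, p k ≤ 1) (hp : ∀ k : ℕ, 1 ≤ k → √(k : ℝ) * p k ≤ P)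
    (hP : 1 ≤ P) (hU : ∀ n, ∑ j ∈ Finset.range n, a j ≤ U)
    (hrec : ∀ n : ℕ, (n : ℝ) * a n = ∑ j ∈ Finset.range n, a j * p (n - j)) (n : ℕ) :
    wt n * a n ≤ 24 * (P * U) := by
  have hU0 : 0 ≤ U := by simpa using hU 0
  rcases Nat.eq_zero_or_pos n with rfl | hn
  · have h1 := hU 1
    simp [wt] at h1 ⊢
    nlinarith
  · have h1 := renewal_bound ha hp1 hp hP hU hrec n
    have hn' : (1 : ℝ) ≤ n := by exact_mod_cast hn
    have h2 : √((n : ℝ) + 1) ≤ (3 / 2) * √(n : ℝ) := by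
      apply Real.sqrt_le_iff.mpr ⟨by positivity, ?_⟩
      rw [mul_pow, Real.sq_sqrt (by positivity)]
      linarith
    have h3 : wt n ≤ 3 * (n * √(n : ℝ)) := by
      calc wt n ≤ (2 * n) * ((3 / 2) * √(n : ℝ)) := by
            unfold wt; gcongr; linarith
        _ = _ := by ring
    nlinarith [mul_le_mul_of_nonneg_right h3 (ha n)]

lemma wt_pred {n : ℕ} (hn : 1 ≤ n) : wt (n - 1) = n * √n := by
  rw [wt]; push_cast [hn]; rw [sub_add_cancel]

lemma renewal_tendsto {a p : ℕ → ℝ} {P U ρ : ℝ} (ha : ∀ j, 0 ≤ a j)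
    (hp0 : ∀ k, 0 ≤ p k) (hp1 : ∀ k, p k ≤ 1) (hp : ∀ k : ℕ, 1 ≤ k → √(k : ℝ) * p k ≤ P)
    (hP : 1 ≤ P) (hU : ∀ n, ∑ j ∈ Finset.range n, a j ≤ U)
    (hrec : ∀ n : ℕ, (n : ℝ) * a n = ∑ j ∈ Finset.range n, a j * p (n - j))
    (hρ : Tendsto (fun k : ℕ => √(k : ℝ) * p k) atTop (𝓝 ρ)) :
    Tendsto (fun n => wt n * a n) atTop (𝓝 (ρ * ∑' j, a j)) := by
  have hU0 : 0 ≤ U := by simpa using hU 0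
  have hw := renewal_wt_bound ha hp1 hp hP hU hrec
  have hs := summable_of_wt_mul_le ha hw
  have hsh : ∀ j, Tendsto (fun n : ℕ => √(n : ℝ) * p (n - j)) atTop (𝓝 ρ) := by
    intro j
    rw [← tendsto_add_atTop_iff_nat (j + 1)]
    have h1 : Tendsto (fun m : ℕ => 1 + (j : ℝ) * ((m : ℝ) + 1)⁻¹) atTop (𝓝 (1 + j * 0)) :=
      (tendsto_const_nhds (x := (j : ℝ)).mul (tendsto_inv_atTop_zero.comp
        (tendsto_atTop_add_const_right _ 1 tendsto_natCast_atTop_atTop))).const_add 1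
    have h2 := h1.sqrt.mul (hρ.comp (tendsto_add_atTop_nat 1))
    simp only [mul_zero, add_zero, Real.sqrt_one, one_mul] at h2
    refine h2.congr fun m => ?_
    have h3 : (0 : ℝ) < m + 1 := by positivity
    have h4 : 1 + (j : ℝ) * ((m : ℝ) + 1)⁻¹ = ((m + (j + 1) : ℕ)) / ((m + 1 : ℕ) : ℝ) := by
      push_cast; field_simp; ring
    have h5 : √((m + 1 : ℕ) : ℝ) ≠ 0 := by positivity
    rw [h4, Real.sqrt_div' _ (by positivity), show m + (j + 1) - j = m + 1 by omega]
    simp only [Function.comp]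
    field_simp
  have hmain := tendsto_sum_range_half (h := fun n => n / 2)
    (q := fun n j => √(n : ℝ) * p (n - j)) (l := ρ) (C := 2 * P) ha hs (fun n j hj => ?_)
    (Nat.tendsto_div_const_atTop (by norm_num)) hsh
  swap
  · have h2 := hp (n - j) (by omega)
    have h3 : √(n : ℝ) ≤ 2 * √((n - j : ℕ) : ℝ) := by
      apply Real.sqrt_le_iff.mpr ⟨by positivity, ?_⟩
      rw [mul_pow, Real.sq_sqrt (by positivity)]
      have : (n : ℝ) ≤ 2 * ((n - j : ℕ) : ℝ) := by
        have : n ≤ 2 * (n - j) := by omega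
        exact_mod_cast this
      linarith
    rw [abs_of_nonneg (mul_nonneg (Real.sqrt_nonneg _) (hp0 _))]
    nlinarith [hp0 (n - j)]
  have hrest : Tendsto (fun n : ℕ => √(n : ℝ) * ∑ k ∈ Finset.range (n - n / 2),
      p (k + 1) * a (n - (k + 1))) atTop (𝓝 0) := by
    set K := 2 * P * (3 * (24 * (P * U)))
    have hlim : Tendsto (fun n : ℕ => K * (√(n : ℝ))⁻¹) atTop (𝓝 (K * 0)) :=
      (tendsto_inv_atTop_zero.comp (Real.tendsto_sqrt_atTop.comp
        tendsto_natCast_atTop_atTop)).const_mul K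
    rw [mul_zero] at hlim
    refine tendsto_of_tendsto_of_tendsto_of_le_of_le' tendsto_const_nhds hlim
      (Eventually.of_forall fun n => mul_nonneg (Real.sqrt_nonneg _)
        (Finset.sum_nonneg fun k _ => mul_nonneg (hp0 _) (ha _))) ?_
    filter_upwards [eventually_ge_atTop 1] with n hn
    have hn' : (0 : ℝ) < n := by exact_mod_cast hn
    have hsn : 0 < √(n : ℝ) := Real.sqrt_pos.mpr hn'
    have h1 := sum_mul_le_of_sqrt_mul_le (n := n) (D := 3 * (24 * (P * U)) / wt (n - 1)) ha hp
      (by linarith) (n - n / 2) fun k hk => by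
        have h2 := wt_le_three_mul (n := n - 1) (m := n - (k + 1)) (by omega)
        rw [le_div_iff₀ (wt_pos _)]
        nlinarith [hw (n - (k + 1)), ha (n - (k + 1))]
    have h2 : √((n - n / 2 : ℕ) : ℝ) ≤ √(n : ℝ) := by
      apply Real.sqrt_le_sqrt
      exact_mod_cast Nat.sub_le n (n / 2)
    rw [wt_pred hn] at h1
    calc _ ≤ √(n : ℝ) * (2 * P * (3 * (24 * (P * U)) / (n * √n)) * √(n : ℝ)) := by
          gcongr
          exact h1.trans (by gcongr)
      _ = K * (√(n : ℝ))⁻¹ * ((√n * √n) / n) := by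
          simp only [K]
          field_simp
      _ = _ := by rw [Real.mul_self_sqrt hn'.le, div_self hn'.ne', mul_one]
  have hfin := (tendsto_wt_ratio 1).mul (hmain.add hrest)
  rw [add_zero, one_mul] at hfin
  refine hfin.congr' ?_
  filter_upwards [eventually_ge_atTop 1] with n hn
  have hn' : (0 : ℝ) < n := by exact_mod_cast hn
  have h1 : ∑ j ∈ Finset.range (n / 2), √(n : ℝ) * p (n - j) * a j +
      √(n : ℝ) * ∑ k ∈ Finset.range (n - n / 2), p (k + 1) * a (n - (k + 1)) =
      √n * (n * a n) := by
    rw [hrec, renewal_split, mul_add]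
    congr 1
    rw [Finset.mul_sum]
    exact Finset.sum_congr rfl fun j _ => by ring
  rw [h1, wt_pred hn]
  have : √(n : ℝ) ≠ 0 := by positivity
  field_simp

/-! ### Convolution sequences of measures and their characteristic functions -/

/-- The Cauchy product of two sequences of measures, for the additive convolution. -/
def convSeq (U V : ℕ → Measure ℝ) (n : ℕ) : Measure ℝ :=
  ∑ p ∈ Finset.HasAntidiagonal.antidiagonal n, U p.1 ∗ V p.2

instance (U V : ℕ → Measure ℝ) [∀ n, IsFiniteMeasure (U n)] [∀ n, IsFiniteMeasure (V n)] (n : ℕ) :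
    IsFiniteMeasure (convSeq U V n) := by
  unfold convSeq; infer_instance

lemma integrable_charFun_integrand (μ : Measure ℝ) [IsFiniteMeasure μ] (t : ℝ) :
    Integrable (fun x : ℝ => Complex.exp (t * x * Complex.I)) μ := by
  refine Integrable.of_bound (C := 1) (by fun_prop) (Eventually.of_forall fun x => ?_)
  rw [← Complex.ofReal_mul, Complex.norm_exp_ofReal_mul_I]

lemma charFun_add_measure (μ ν : Measure ℝ) [IsFiniteMeasure μ] [IsFiniteMeasure ν] (t : ℝ) :
    charFun (μ + ν) t = charFun μ t + charFun ν t := by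
  simp only [charFun_apply_real]
  exact integral_add_measure (integrable_charFun_integrand μ t) (integrable_charFun_integrand ν t)

lemma charFun_finset_sum_measure {ι : Type*} (s : Finset ι) (μ : ι → Measure ℝ)
    [∀ i, IsFiniteMeasure (μ i)] (t : ℝ) :
    charFun (∑ i ∈ s, μ i) t = ∑ i ∈ s, charFun (μ i) t := by
  simp only [charFun_apply_real]
  exact integral_finsetSum_measure fun i _ => integrable_charFun_integrand (μ i) t

/-- The generating series of the characteristic functions at `t` of a sequence of measures. -/
def cfSeries (U : ℕ → Measure ℝ) (t : ℝ) : PowerSeries ℂ :=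
  PowerSeries.mk fun n => charFun (U n) t

lemma cfSeries_convSeq (U V : ℕ → Measure ℝ) [∀ n, IsFiniteMeasure (U n)]
    [∀ n, IsFiniteMeasure (V n)] (t : ℝ) :
    cfSeries (convSeq U V) t = cfSeries U t * cfSeries V t := by
  ext n
  rw [PowerSeries.coeff_mul, cfSeries, PowerSeries.coeff_mk, convSeq,
    charFun_finset_sum_measure (Finset.HasAntidiagonal.antidiagonal n)
      (fun p : ℕ × ℕ => (U p.1).conv (V p.2))]
  refine Finset.sum_congr rfl fun p _ => ?_
  rw [charFun_conv, cfSeries, cfSeries, PowerSeries.coeff_mk, PowerSeries.coeff_mk]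

lemma cfSeries_add (U V : ℕ → Measure ℝ) [∀ n, IsFiniteMeasure (U n)]
    [∀ n, IsFiniteMeasure (V n)] (t : ℝ) :
    cfSeries (U + V) t = cfSeries U t + cfSeries V t := by
  ext n
  simp [cfSeries, charFun_add_measure]

lemma cfSeries_injective {U V : ℕ → Measure ℝ} [∀ n, IsFiniteMeasure (U n)]
    [∀ n, IsFiniteMeasure (V n)] (h : ∀ t, cfSeries U t = cfSeries V t) : U = V := by
  funext n
  refine Measure.ext_of_charFun (funext fun t => ?_)
  have := congrArg (PowerSeries.coeff n) (h t)
  simpa [cfSeries] using this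

lemma ae_conv_of_ae {μ ν : Measure ℝ} [SFinite μ] [SFinite ν] {p q r : ℝ → Prop}
    (hr : MeasurableSet {x | r x}) (hp : ∀ᵐ x ∂μ, p x) (hq : ∀ᵐ x ∂ν, q x)
    (h : ∀ x y, p x → q y → r (x + y)) : ∀ᵐ z ∂(μ ∗ ν), r z := by
  unfold Measure.conv
  rw [ae_map_iff (by fun_prop) hr]
  have h1 : ∀ᵐ z ∂(μ.prod ν), p z.1 := Measure.quasiMeasurePreserving_fst.ae hp
  have h2 : ∀ᵐ z ∂(μ.prod ν), q z.2 := Measure.quasiMeasurePreserving_snd.ae hq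
  filter_upwards [h1, h2] with z hz1 hz2 using h _ _ hz1 hz2

lemma ae_finset_sum_measure {ι : Type*} {s : Finset ι} {μ : ι → Measure ℝ} {p : ℝ → Prop}
    (h : ∀ i ∈ s, ∀ᵐ x ∂(μ i), p x) : ∀ᵐ x ∂(∑ i ∈ s, μ i), p x := by
  classical
  induction s using Finset.induction_on with
  | empty => simp
  | insert i s hi ih =>
    rw [Finset.sum_insert hi, ae_add_measure_iff]
    exact ⟨h i (by simp), ih fun j hj => h j (by simp [hj])⟩

/-- Two measures on `(0, ∞)` agree as soon as their sums with measures on `(-∞, 0]` agree. -/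
lemma eq_of_add_eq_add {U U' V V' : Measure ℝ} (h : U + V = U' + V')
    (hU : ∀ᵐ x ∂U, 0 < x) (hU' : ∀ᵐ x ∂U', 0 < x) (hV : ∀ᵐ x ∂V, x ≤ 0)
    (hV' : ∀ᵐ x ∂V', x ≤ 0) : U = U' ∧ V = V' := by
  have key : ∀ {W W' : Measure ℝ}, (∀ᵐ x ∂W, 0 < x) → (∀ᵐ x ∂W', x ≤ 0) →
      (W + W').restrict (Ioi 0) = W ∧ (W + W').restrict (Iic 0) = W' := by
    intro W W' h1 h2
    have e1 : W.restrict (Ioi 0) = W := Measure.restrict_eq_self_of_ae_mem h1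
    have e2 : W'.restrict (Iic 0) = W' := Measure.restrict_eq_self_of_ae_mem h2
    have e3 : W'.restrict (Ioi 0) = 0 := by
      rw [Measure.restrict_eq_zero, measure_eq_zero_iff_ae_notMem]
      filter_upwards [h2] with x hx using not_lt.mpr hx
    have e4 : W.restrict (Iic 0) = 0 := by
      rw [Measure.restrict_eq_zero, measure_eq_zero_iff_ae_notMem]
      filter_upwards [h1] with x hx using not_le.mpr hx
    rw [Measure.restrict_add, Measure.restrict_add, e1, e2, e3, e4]
    simp
  have k1 := key hU hV
  have k2 := key hU' hV'
  rw [h] at k1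
  exact ⟨k1.1.symm.trans k2.1, k1.2.symm.trans k2.2⟩

/-! ### Wiener–Hopf factorisation -/

/-- Law of `S_n` on the event that `n` is a strict ascending ladder-type epoch of the reversed
walk (all of `S_1, …, S_n` positive). -/
def posLaw (m : Measure ℝ) : ℕ → Measure ℝ
  | 0 => Measure.dirac 0
  | n + 1 => (m ∗ posLaw m n).restrict (Ioi 0)

/-- Law of `S_n` on the event that all of `S_1, …, S_n` are nonpositive. -/
def negLaw (m : Measure ℝ) : ℕ → Measure ℝ
  | 0 => Measure.dirac 0
  | n + 1 => (m ∗ negLaw m n).restrict (Iic 0)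

/-- Law of `S_n` on the event that `n` is the first entrance time to `(-∞, 0]`. -/
def negEntrance (m : Measure ℝ) : ℕ → Measure ℝ
  | 0 => 0
  | n + 1 => (m ∗ posLaw m n).restrict (Iic 0)

/-- Law of `S_n` on the event that `n` is the first entrance time to `(0, ∞)`. -/
def posEntrance (m : Measure ℝ) : ℕ → Measure ℝ
  | 0 => 0
  | n + 1 => (m ∗ negLaw m n).restrict (Ioi 0)

/-- Convolution powers. -/
def convPow (m : Measure ℝ) : ℕ → Measure ℝ
  | 0 => Measure.dirac 0
  | n + 1 => m ∗ convPow m n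

lemma ae_posLaw_succ (m : Measure ℝ) (n : ℕ) : ∀ᵐ x ∂(posLaw m (n + 1)), 0 < x :=
  ae_restrict_mem measurableSet_Ioi

lemma ae_posLaw (m : Measure ℝ) (n : ℕ) : ∀ᵐ x ∂(posLaw m n), 0 ≤ x := by
  cases n with
  | zero => simp [posLaw, ae_dirac_eq]
  | succ n => filter_upwards [ae_posLaw_succ m n] with x hx using hx.le

lemma ae_negLaw (m : Measure ℝ) (n : ℕ) : ∀ᵐ x ∂(negLaw m n), x ≤ 0 := by
  cases n with
  | zero => simp [negLaw, ae_dirac_eq]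
  | succ n => exact ae_restrict_mem measurableSet_Iic

lemma ae_posEntrance (m : Measure ℝ) (n : ℕ) : ∀ᵐ x ∂(posEntrance m n), 0 < x := by
  cases n with
  | zero => simp [posEntrance]
  | succ n => exact ae_restrict_mem measurableSet_Ioi

lemma ae_negEntrance (m : Measure ℝ) (n : ℕ) : ∀ᵐ x ∂(negEntrance m n), x ≤ 0 := by
  cases n with
  | zero => simp [negEntrance]
  | succ n => exact ae_restrict_mem measurableSet_Iic

lemma posLaw_add_negEntrance (m : Measure ℝ) (n : ℕ) :
    posLaw m (n + 1) + negEntrance m (n + 1) = m ∗ posLaw m n := by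
  rw [posLaw, negEntrance, ← compl_Ioi]
  exact Measure.restrict_add_restrict_compl measurableSet_Ioi

lemma negLaw_add_posEntrance (m : Measure ℝ) (n : ℕ) :
    negLaw m (n + 1) + posEntrance m (n + 1) = m ∗ negLaw m n := by
  rw [negLaw, posEntrance, ← compl_Iic]
  exact Measure.restrict_add_restrict_compl measurableSet_Iic

section
variable (m : Measure ℝ) [IsProbabilityMeasure m]

instance (n : ℕ) : IsFiniteMeasure (posLaw m n) := by
  induction n with
  | zero => unfold posLaw; infer_instance
  | succ n ih => unfold posLaw; infer_instance

instance (n : ℕ) : IsFiniteMeasure (negLaw m n) := by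
  induction n with
  | zero => unfold negLaw; infer_instance
  | succ n ih => unfold negLaw; infer_instance

instance (n : ℕ) : IsFiniteMeasure (negEntrance m n) := by
  cases n <;> unfold negEntrance <;> infer_instance

instance (n : ℕ) : IsFiniteMeasure (posEntrance m n) := by
  cases n <;> unfold posEntrance <;> infer_instance

instance (n : ℕ) : IsProbabilityMeasure (convPow m n) := by
  induction n with
  | zero => unfold convPow; infer_instance
  | succ n ih => unfold convPow; infer_instance

open PowerSeries in
lemma cfSeries_posLaw (t : ℝ) :
    cfSeries (posLaw m) t + cfSeries (negEntrance m) t =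
      1 + X * C (charFun m t) * cfSeries (posLaw m) t := by
  ext n
  cases n with
  | zero => simp [cfSeries, posLaw, negEntrance, charFun_apply_real]
  | succ n =>
    have := congrArg (fun μ => charFun μ t) (posLaw_add_negEntrance m n)
    simp only [charFun_add_measure, charFun_conv] at this
    rw [mul_assoc, map_add, map_add, coeff_succ_X_mul, coeff_C_mul]
    simpa [cfSeries, coeff_one] using this

open PowerSeries in
lemma cfSeries_negLaw (t : ℝ) :
    cfSeries (negLaw m) t + cfSeries (posEntrance m) t =
      1 + X * C (charFun m t) * cfSeries (negLaw m) t := by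
  ext n
  cases n with
  | zero => simp [cfSeries, negLaw, posEntrance, charFun_apply_real]
  | succ n =>
    have := congrArg (fun μ => charFun μ t) (negLaw_add_posEntrance m n)
    simp only [charFun_add_measure, charFun_conv] at this
    rw [mul_assoc, map_add, map_add, coeff_succ_X_mul, coeff_C_mul]
    simpa [cfSeries, coeff_one] using this

lemma convSeq_zero (U V : ℕ → Measure ℝ) : convSeq U V 0 = U 0 ∗ V 0 := by
  simp [convSeq]

lemma wienerHopf_aux : negLaw m + convSeq (posLaw m) (posEntrance m) =
    posLaw m + convSeq (negEntrance m) (negLaw m) := by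
  have : ∀ n, IsFiniteMeasure ((negLaw m + convSeq (posLaw m) (posEntrance m)) n) := fun n => by
    rw [Pi.add_apply]; infer_instance
  have : ∀ n, IsFiniteMeasure ((posLaw m + convSeq (negEntrance m) (negLaw m)) n) := fun n => by
    rw [Pi.add_apply]; infer_instance
  refine cfSeries_injective fun t => ?_
  rw [cfSeries_add, cfSeries_add, cfSeries_convSeq, cfSeries_convSeq]
  linear_combination (cfSeries (posLaw m) t) * cfSeries_negLaw m t -
    (cfSeries (negLaw m) t) * cfSeries_posLaw m t

lemma wienerHopf_succ (n : ℕ) :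
    convSeq (posLaw m) (posEntrance m) (n + 1) = posLaw m (n + 1) ∧
      negLaw m (n + 1) = convSeq (negEntrance m) (negLaw m) (n + 1) := by
  have h := congrFun (wienerHopf_aux m) (n + 1)
  rw [Pi.add_apply, Pi.add_apply, add_comm] at h
  refine eq_of_add_eq_add h ?_ (ae_posLaw_succ m n) (ae_negLaw m _) ?_
  · exact ae_finset_sum_measure fun p _ => ae_conv_of_ae measurableSet_Ioi (ae_posLaw m _)
      (ae_posEntrance m _) fun x y hx hy => by linarith
  · exact ae_finset_sum_measure fun p _ => ae_conv_of_ae measurableSet_Iic (ae_negEntrance m _)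
      (ae_negLaw m _) fun x y hx hy => by linarith


lemma cfSeries_posLaw_mul (t : ℝ) :
    cfSeries (posLaw m) t * cfSeries (posEntrance m) t = cfSeries (posLaw m) t - 1 := by
  rw [← cfSeries_convSeq]
  ext n
  cases n with
  | zero =>
    simp [cfSeries, convSeq_zero, posEntrance, posLaw, charFun_apply_real]
  | succ n =>
    simp [cfSeries, (wienerHopf_succ m n).1, PowerSeries.coeff_one]

open PowerSeries in
lemma cfSeries_convPow (t : ℝ) :
    cfSeries (convPow m) t = 1 + X * C (charFun m t) * cfSeries (convPow m) t := by
  ext n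
  cases n with
  | zero => simp [cfSeries, convPow, charFun_apply_real]
  | succ n =>
    rw [mul_assoc, map_add, coeff_succ_X_mul, coeff_C_mul]
    simp [cfSeries, coeff_one, convPow, charFun_conv]

lemma cfSeries_posLaw_mul_negLaw (t : ℝ) :
    cfSeries (posLaw m) t * cfSeries (negLaw m) t = cfSeries (convPow m) t := by
  linear_combination (cfSeries (convPow m) t) * (cfSeries (posLaw m) t) * cfSeries_negLaw m t
    - (cfSeries (convPow m) t) * cfSeries_posLaw_mul m t
    - (cfSeries (posLaw m) t * cfSeries (negLaw m) t) * cfSeries_convPow m t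

/-- Law of `S_n` on `{S_n > 0}` for `n ≥ 1`. -/
def posPart (m : Measure ℝ) : ℕ → Measure ℝ
  | 0 => 0
  | n + 1 => (convPow m (n + 1)).restrict (Ioi 0)

/-- Law of `S_n` on `{S_n ≤ 0}` for `n ≥ 1`. -/
def negPart (m : Measure ℝ) : ℕ → Measure ℝ
  | 0 => 0
  | n + 1 => (convPow m (n + 1)).restrict (Iic 0)

instance (n : ℕ) : IsFiniteMeasure (posPart m n) := by
  cases n <;> unfold posPart <;> infer_instance

instance (n : ℕ) : IsFiniteMeasure (negPart m n) := by
  cases n <;> unfold negPart <;> infer_instance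

lemma cfSeries_posPart_add_negPart (t : ℝ) :
    cfSeries (posPart m) t + cfSeries (negPart m) t = cfSeries (convPow m) t - 1 := by
  rw [← cfSeries_add]
  ext n
  cases n with
  | zero => simp [cfSeries, posPart, negPart, convPow, charFun_apply_real]
  | succ n =>
    have : posPart m (n + 1) + negPart m (n + 1) = convPow m (n + 1) := by
      rw [posPart, negPart, ← compl_Ioi]
      exact Measure.restrict_add_restrict_compl measurableSet_Ioi
    simp [cfSeries, this, PowerSeries.coeff_one]

open PowerSeries in
lemma coeff_mul_add_mul_eq {A B a b : PowerSeries ℂ} {n : ℕ} (hA : coeff 0 A = 1)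
    (hB : coeff 0 B = 1) (ha : ∀ k < n, coeff k a = 0) (hb : ∀ k < n, coeff k b = 0) :
    coeff n (a * B + A * b) = coeff n a + coeff n b := by
  obtain ⟨a', rfl⟩ := X_pow_dvd_iff.mpr ha
  obtain ⟨b', rfl⟩ := X_pow_dvd_iff.mpr hb
  rw [map_add, mul_assoc, mul_left_comm A, coeff_X_pow_mul', coeff_X_pow_mul', coeff_X_pow_mul',
    coeff_X_pow_mul']
  simp only [le_refl, if_true, Nat.sub_self]
  simp only [coeff_zero_eq_constantCoeff, map_mul] at hA hB ⊢
  rw [hA, hB, mul_one, one_mul]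

open PowerSeries in
lemma spitzer_aux (t : ℝ) :
    (X * derivative ℂ (cfSeries (posLaw m) t) - cfSeries (posPart m) t * cfSeries (posLaw m) t)
      * cfSeries (negLaw m) t + cfSeries (posLaw m) t *
    (X * derivative ℂ (cfSeries (negLaw m) t) - cfSeries (negPart m) t * cfSeries (negLaw m) t)
      = 0 := by
  have h1 := congrArg (derivative ℂ) (cfSeries_posLaw_mul_negLaw m t)
  have h2 := cfSeries_convPow m t
  have h3 := congrArg (derivative ℂ) (cfSeries_convPow m t)
  have h4 := cfSeries_posPart_add_negPart m t
  have h5 := cfSeries_posLaw_mul_negLaw m t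
  have hX : derivative ℂ (X * C (charFun m t)) = C (charFun m t) := by
    ext n
    rw [coeff_derivative, coeff_succ_X_mul]
    cases n <;> simp [coeff_C]
  rw [map_add, Derivation.leibniz, hX, Derivation.map_one_eq_zero, zero_add] at h3
  rw [Derivation.leibniz] at h1
  simp only [smul_eq_mul] at h1 h3
  set A := cfSeries (posLaw m) t
  set B := cfSeries (negLaw m) t
  set G := cfSeries (convPow m) t
  set P := cfSeries (posPart m) t
  set N := cfSeries (negPart m) t
  have h6 : X * derivative ℂ G = (G - 1) * G := by
    linear_combination X * G * h3 - X * derivative ℂ G * h2 - G * h2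
  linear_combination X * h1 - (P + N) * h5 - G * h4 + h6

lemma charFun_sum_const (μ : Measure ℝ) [IsFiniteMeasure μ] (n : ℕ) (t : ℝ) :
    charFun (∑ _k ∈ Finset.range n, μ) t = n * charFun μ t := by
  rw [charFun_finset_sum_measure (Finset.range n) (fun _ => μ)]; simp

open PowerSeries in
/-- Spitzer's recursion, at the level of measures. -/
lemma spitzer (n : ℕ) :
    ∑ _k ∈ Finset.range n, posLaw m n = convSeq (posPart m) (posLaw m) n ∧
      ∑ _k ∈ Finset.range n, negLaw m n = convSeq (negPart m) (negLaw m) n := by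
  have hD : ∀ (U V : ℕ → Measure ℝ) [∀ n, IsFiniteMeasure (U n)] [∀ n, IsFiniteMeasure (V n)]
      (t : ℝ) (n : ℕ), coeff n (X * derivative ℂ (cfSeries U t) - cfSeries V t * cfSeries U t)
      = charFun (∑ _k ∈ Finset.range n, U n) t - charFun (convSeq V U n) t := by
    intro U V _ _ t n
    rw [← cfSeries_convSeq, map_sub, charFun_sum_const]
    congr 1
    · cases n with
      | zero => simp
      | succ n =>
        rw [coeff_succ_X_mul, coeff_derivative]
        simp [cfSeries, mul_comm]
    · simp [cfSeries]
  induction n using Nat.strong_induction_on with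
  | _ n ih =>
  cases n with
  | zero => simp [convSeq_zero, posPart, negPart]
  | succ n =>
    refine eq_of_add_eq_add (Measure.ext_of_charFun (funext fun t => ?_)) ?_ ?_ ?_ ?_
    · have h := congrArg (coeff (n + 1)) (spitzer_aux m t)
      rw [coeff_mul_add_mul_eq, hD, hD] at h
      · rw [charFun_add_measure, charFun_add_measure]
        simp only [map_zero] at h
        linear_combination h
      · simp [cfSeries, posLaw, charFun_apply_real]
      · simp [cfSeries, negLaw, charFun_apply_real]
      · intro k hk; rw [hD, (ih k hk).1, sub_self]
      · intro k hk; rw [hD, (ih k hk).2, sub_self]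
    · exact ae_finset_sum_measure fun p _ => ae_posLaw_succ m n
    · refine ae_finset_sum_measure fun p _ => ae_conv_of_ae (p := fun x => 0 < x)
        measurableSet_Ioi ?_ (ae_posLaw m _) fun x y hx hy => by linarith
      cases p.1 with
      | zero => simp [posPart]
      | succ k => exact ae_restrict_mem measurableSet_Ioi
    · exact ae_finset_sum_measure fun p _ => ae_negLaw m _
    · refine ae_finset_sum_measure fun p _ => ae_conv_of_ae (p := fun x => x ≤ 0)
        measurableSet_Iic ?_ (ae_negLaw m _) fun x y hx hy => by linarith
      cases p.1 with
      | zero => simp [negPart]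
      | succ k => exact ae_restrict_mem measurableSet_Iic

end

/-! ### Exponential transforms -/

/-- The exponential transform `∫ e ^ (c x) μ(dx)`, with values in `[0, ∞]`. -/
def lap (c : ℝ) (μ : Measure ℝ) : ENNReal := ∫⁻ x, ENNReal.ofReal (Real.exp (c * x)) ∂μ

lemma lap_conv (c : ℝ) (μ ν : Measure ℝ) [SFinite ν] : lap c (μ ∗ ν) = lap c μ * lap c ν := by
  unfold lap
  rw [Measure.lintegral_conv (by fun_prop)]
  have h : ∀ x y : ℝ, ENNReal.ofReal (Real.exp (c * (x + y))) =
      ENNReal.ofReal (Real.exp (c * x)) * ENNReal.ofReal (Real.exp (c * y)) := fun x y => by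
    rw [mul_add, Real.exp_add, ENNReal.ofReal_mul (Real.exp_pos _).le]
  simp_rw [h]
  rw [← lintegral_mul_const _ (by fun_prop)]
  exact lintegral_congr fun x => lintegral_const_mul _ (by fun_prop)

lemma lap_finset_sum {ι : Type*} (c : ℝ) (s : Finset ι) (μ : ι → Measure ℝ) :
    lap c (∑ i ∈ s, μ i) = ∑ i ∈ s, lap c (μ i) := by
  unfold lap; rw [lintegral_finsetSum_measure]

lemma lap_convSeq (c : ℝ) (U V : ℕ → Measure ℝ) [∀ n, SFinite (V n)] (n : ℕ) :
    lap c (convSeq U V n) =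
      ∑ p ∈ Finset.HasAntidiagonal.antidiagonal n, lap c (U p.1) * lap c (V p.2) := by
  unfold convSeq
  rw [lap_finset_sum]
  exact Finset.sum_congr rfl fun p _ => lap_conv c _ _

lemma lap_dirac_zero (c : ℝ) : lap c (Measure.dirac 0) = 1 := by
  unfold lap; rw [lintegral_dirac' _ (by fun_prop)]; simp

lemma lap_zero_measure (c : ℝ) : lap c 0 = 0 := by simp [lap]

lemma lap_le_univ {c : ℝ} {μ : Measure ℝ} (h : ∀ᵐ x ∂μ, c * x ≤ 0) : lap c μ ≤ μ univ := by
  unfold lap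
  calc _ ≤ ∫⁻ _, 1 ∂μ := by
        refine lintegral_mono_ae ?_
        filter_upwards [h] with x hx
        rw [ENNReal.ofReal_le_one]
        exact Real.exp_le_one_iff.mpr hx
    _ = _ := by simp

lemma renewal_toReal {u p : ℕ → ENNReal} (hu : ∀ n, u n ≠ ⊤) (hp : ∀ n, p n ≠ ⊤)
    (hp0 : p 0 = 0)
    (h : ∀ n, n * u n = ∑ q ∈ Finset.HasAntidiagonal.antidiagonal n, p q.1 * u q.2) (n : ℕ) :
    (n : ℝ) * (u n).toReal = ∑ j ∈ Finset.range n, (u j).toReal * (p (n - j)).toReal := by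
  have h1 := congrArg ENNReal.toReal (h n)
  rw [ENNReal.toReal_mul, ENNReal.toReal_natCast, ENNReal.toReal_sum
    (fun q _ => ENNReal.mul_ne_top (hp _) (hu _))] at h1
  rw [h1, ← Finset.Nat.sum_antidiagonal_swap, Finset.Nat.sum_antidiagonal_eq_sum_range_succ_mk,
    Finset.sum_range_succ]
  simp [hp0, ENNReal.toReal_mul, mul_comm]

lemma renewal_sum_le {a h : ℕ → ℝ} {κ : ℝ} (ha : ∀ n, 0 ≤ a n)
    (ha0 : a 0 = 1) (hκ : 0 < κ) (h1 : ∀ n, ∑ k ∈ Finset.range n, h (k + 1) ≤ 1 - κ)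
    (hrec : ∀ n, a (n + 1) = ∑ j ∈ Finset.range (n + 1), a j * h (n + 1 - j)) (N : ℕ) :
    ∑ k ∈ Finset.range N, a k ≤ 1 / κ := by
  set S := ∑ k ∈ Finset.range N, a k
  have key : ∑ k ∈ Finset.range N, a (k + 1) ≤ S * (1 - κ) := by
    simp_rw [hrec]
    rw [Finset.sum_comm' (s' := fun j => Finset.Ico j N) (t' := Finset.range N)
      (by intro x y; simp; omega), Finset.sum_mul]
    refine Finset.sum_le_sum fun j hj => ?_
    rw [← Finset.mul_sum, Finset.sum_Ico_eq_sum_range]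
    refine mul_le_mul_of_nonneg_left (le_trans (le_of_eq ?_) (h1 (N - j))) (ha j)
    exact Finset.sum_congr rfl fun i _ => by rw [show j + i + 1 - j = i + 1 by omega]
  have h2 : S ≤ ∑ k ∈ Finset.range N, a (k + 1) + a 0 := by
    rw [← Finset.sum_range_succ' (fun k => a k), Finset.sum_range_succ]
    linarith [ha N]
  rw [le_div_iff₀ hκ]
  linarith

section
variable (m : Measure ℝ) [IsProbabilityMeasure m]

lemma sum_univ_le_one {U H : ℕ → Measure ℝ} (h0 : U 0 univ ≤ 1)
    (h : ∀ n, U (n + 1) univ + H (n + 1) univ = U n univ) (n : ℕ) :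
    U n univ + ∑ k ∈ Finset.range n, H (k + 1) univ ≤ 1 := by
  induction n with
  | zero => simpa using h0
  | succ n ih =>
    rw [Finset.sum_range_succ, add_comm (∑ k ∈ _, _), ← add_assoc, h]
    exact ih

lemma conv_univ (μ : Measure ℝ) [SFinite μ] : (m ∗ μ) univ = μ univ := by
  unfold Measure.conv
  rw [Measure.map_apply (by fun_prop) MeasurableSet.univ]
  rw [preimage_univ, ← univ_prod_univ, Measure.prod_prod, measure_univ, one_mul]

lemma posLaw_univ_le (n : ℕ) :
    posLaw m n univ + ∑ k ∈ Finset.range n, negEntrance m (k + 1) univ ≤ 1 := by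
  refine sum_univ_le_one (by simp [posLaw]) (fun n => ?_) n
  rw [← Measure.add_apply, posLaw_add_negEntrance, conv_univ]

lemma negLaw_univ_le (n : ℕ) :
    negLaw m n univ + ∑ k ∈ Finset.range n, posEntrance m (k + 1) univ ≤ 1 := by
  refine sum_univ_le_one (by simp [negLaw]) (fun n => ?_) n
  rw [← Measure.add_apply, negLaw_add_posEntrance, conv_univ]


lemma sum_lap_le {c : ℝ} {H : ℕ → Measure ℝ} [∀ n, IsFiniteMeasure (H n)]
    (hc : ∀ n, ∀ᵐ x ∂(H n), c * x ≤ 0) (hH : ∀ n, ∑ k ∈ Finset.range n, H (k + 1) univ ≤ 1)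
    (n : ℕ) : ∑ k ∈ Finset.range n, (lap c (H (k + 1))).toReal ≤
      1 - ((H 1).real univ - (lap c (H 1)).toReal) := by
  have h1 : ∀ k, (lap c (H k)).toReal ≤ (H k).real univ := fun k =>
    ENNReal.toReal_mono (measure_ne_top _ _) (lap_le_univ (hc k))
  have h2 : ∑ k ∈ Finset.range (n + 1), (H (k + 1)).real univ ≤ 1 := by
    have := ENNReal.toReal_mono ENNReal.one_ne_top (hH (n + 1))
    rwa [ENNReal.toReal_sum fun _ _ => measure_ne_top _ _, ENNReal.toReal_one] at this
  have h3 : ∑ k ∈ Finset.range n, (lap c (H (k + 1))).toReal ≤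
      ∑ k ∈ Finset.range (n + 1), (lap c (H (k + 1))).toReal := by
    rw [Finset.sum_range_succ]; linarith [ENNReal.toReal_nonneg (a := lap c (H (n + 1)))]
  refine h3.trans ?_
  rw [Finset.sum_range_succ'] at h2 ⊢
  have h4 : ∑ k ∈ Finset.range n, (lap c (H (k + 1 + 1))).toReal ≤
      ∑ k ∈ Finset.range n, (H (k + 1 + 1)).real univ := Finset.sum_le_sum fun k _ => h1 _
  simp only [zero_add] at h2 ⊢
  linarith

lemma real_univ_sub_lap {c : ℝ} {μ : Measure ℝ} [IsFiniteMeasure μ]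
    (hc : ∀ᵐ x ∂μ, c * x ≤ 0) :
    Integrable (fun x => 1 - Real.exp (c * x)) μ ∧
    μ.real univ - (lap c μ).toReal = ∫ x, (1 - Real.exp (c * x)) ∂μ := by
  have h1 : Integrable (fun x : ℝ => Real.exp (c * x)) μ := by
    refine Integrable.of_bound (C := 1) (by fun_prop) ?_
    filter_upwards [hc] with x hx
    rw [Real.norm_eq_abs, abs_of_pos (Real.exp_pos _)]
    exact Real.exp_le_one_iff.mpr hx
  refine ⟨(integrable_const 1).sub h1, ?_⟩
  rw [integral_sub (integrable_const 1) h1, integral_const, smul_eq_mul, mul_one, lap,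
    integral_eq_lintegral_of_nonneg_ae (Eventually.of_forall fun x => (Real.exp_pos _).le)
      (by fun_prop)]

lemma integral_one_sub_exp_pos {c : ℝ} {μ : Measure ℝ} [IsFiniteMeasure μ]
    (hc : ∀ᵐ x ∂μ, c * x ≤ 0) (hμ : ∃ s, 0 < μ s ∧ ∀ x ∈ s, c * x < 0) :
    0 < ∫ x, (1 - Real.exp (c * x)) ∂μ := by
  rw [integral_pos_iff_support_of_nonneg_ae _ (real_univ_sub_lap hc).1]
  · obtain ⟨s, hs, h⟩ := hμ
    refine hs.trans_le (measure_mono fun x hx => ?_)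
    have := Real.exp_lt_exp.mpr (h x hx)
    rw [Real.exp_zero] at this
    simp only [Function.mem_support]
    linarith
  · filter_upwards [hc] with x hx
    simpa using hx

lemma posEntrance_one : posEntrance m 1 = m.restrict (Ioi 0) := by
  simp [posEntrance, negLaw]

lemma negEntrance_one : negEntrance m 1 = m.restrict (Iic 0) := by
  simp [negEntrance, posLaw]

lemma lap_posLaw_le (n : ℕ) {α : ℝ} (hα : 0 ≤ α) : lap (-α) (posLaw m n) ≤ 1 := by
  refine (lap_le_univ ?_).trans (le_self_add.trans (posLaw_univ_le m n))
  filter_upwards [ae_posLaw m n] with x hx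
  nlinarith

lemma lap_negLaw_le (n : ℕ) {β : ℝ} (hβ : 0 ≤ β) : lap β (negLaw m n) ≤ 1 := by
  refine (lap_le_univ ?_).trans (le_self_add.trans (negLaw_univ_le m n))
  filter_upwards [ae_negLaw m n] with x hx
  nlinarith

lemma ladder_toReal {u h : ℕ → ENNReal} (hu : ∀ n, u n ≠ ⊤) (hh : ∀ n, h n ≠ ⊤) (h0 : h 0 = 0)
    {n : ℕ} (hrec : u (n + 1) =
      ∑ q ∈ Finset.HasAntidiagonal.antidiagonal (n + 1), u q.1 * h q.2) :
    (u (n + 1)).toReal = ∑ j ∈ Finset.range (n + 1), (u j).toReal * (h (n + 1 - j)).toReal := by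
  rw [hrec, ENNReal.toReal_sum fun q _ => ENNReal.mul_ne_top (hu _) (hh _),
    Finset.Nat.sum_antidiagonal_eq_sum_range_succ_mk, Finset.sum_range_succ]
  simp [h0, ENNReal.toReal_mul]

lemma sum_lap_posLaw_le (hm : 0 < m (Ioi 0)) : ∃ κ : ℝ, 0 < κ ∧ ∀ α : ℝ, 0 < α → α ≤ 1 →
    ∀ N, ∑ k ∈ Finset.range N, (lap (-α) (posLaw m k)).toReal ≤ 1 / (κ * α) := by
  have hpos : ∀ α : ℝ, 0 < α → ∀ᵐ x ∂(m.restrict (Ioi 0)), -α * x ≤ 0 := fun α hα => by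
    filter_upwards [ae_restrict_mem measurableSet_Ioi] with x hx
    have : 0 < x := hx
    nlinarith
  refine ⟨∫ x in Ioi 0, (1 - Real.exp (-1 * x)) ∂m, ?_, fun α hα hα1 N => ?_⟩
  · refine integral_one_sub_exp_pos (hpos 1 one_pos) ⟨Ioi 0, by simpa using hm, fun x hx => ?_⟩
    have : 0 < x := hx
    linarith
  have hκ : 0 < ∫ x in Ioi 0, (1 - Real.exp (-1 * x)) ∂m := by
    refine integral_one_sub_exp_pos (hpos 1 one_pos) ⟨Ioi 0, by simpa using hm, fun x hx => ?_⟩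
    have : 0 < x := hx
    linarith
  have hH : ∀ n, ∀ᵐ x ∂(posEntrance m n), -α * x ≤ 0 := fun n => by
    filter_upwards [ae_posEntrance m n] with x hx
    nlinarith
  have hlapH : ∀ n, lap (-α) (posEntrance m n) ≠ ⊤ := fun n =>
    ne_top_of_le_ne_top (measure_ne_top _ _) (lap_le_univ (hH n))
  refine renewal_sum_le (h := fun n => (lap (-α) (posEntrance m n)).toReal)
    (fun _ => ENNReal.toReal_nonneg)
    (by simp [posLaw, lap_dirac_zero]) (by positivity) (fun n => ?_) (fun n => ?_) N
  · refine (sum_lap_le hH (fun n => le_add_self.trans (negLaw_univ_le m n)) n).trans ?_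
    rw [posEntrance_one, (real_univ_sub_lap (hpos α hα)).2]
    have : (∫ x in Ioi 0, (1 - Real.exp (-1 * x)) ∂m) * α ≤
        ∫ x in Ioi 0, (1 - Real.exp (-α * x)) ∂m := by
      rw [← integral_mul_const]
      refine integral_mono ((real_univ_sub_lap (hpos 1 one_pos)).1.mul_const α)
        (real_univ_sub_lap (hpos α hα)).1 fun x => ?_
      have := convexOn_exp.2 (mem_univ 0) (mem_univ (-x)) (sub_nonneg.mpr hα1) hα.le
        (sub_add_cancel 1 α)
      simp only [smul_eq_mul, mul_zero, zero_add, Real.exp_zero, mul_one] at this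
      simp only [neg_mul, one_mul]
      rw [mul_neg] at this
      linarith
    linarith
  · refine ladder_toReal (u := fun n => lap (-α) (posLaw m n))
      (fun n => ne_top_of_le_ne_top ENNReal.one_ne_top (lap_posLaw_le m n hα.le)) hlapH
      (by simp [posEntrance, lap_zero_measure]) ?_
    rw [← lap_convSeq, (wienerHopf_succ m n).1]

lemma sum_lap_negLaw_le (hm : 0 < m (Iio 0)) {β : ℝ} (hβ : 0 < β) : ∃ U : ℝ,
    ∀ N, ∑ k ∈ Finset.range N, (lap β (negLaw m k)).toReal ≤ U := by
  have hneg : ∀ᵐ x ∂(m.restrict (Iic 0)), β * x ≤ 0 := by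
    filter_upwards [ae_restrict_mem measurableSet_Iic] with x hx
    have : x ≤ 0 := hx
    nlinarith
  have hκ : 0 < ∫ x in Iic 0, (1 - Real.exp (β * x)) ∂m := by
    refine integral_one_sub_exp_pos hneg ⟨Iio 0, ?_, fun x hx => ?_⟩
    · rwa [Measure.restrict_eq_self _ (Iio_subset_Iic_self (a := (0 : ℝ)))]
    · have : x < 0 := hx
      nlinarith
  have hH : ∀ n, ∀ᵐ x ∂(negEntrance m n), β * x ≤ 0 := fun n => by
    filter_upwards [ae_negEntrance m n] with x hx
    nlinarith
  refine ⟨_, fun N => renewal_sum_le (h := fun n => (lap β (negEntrance m n)).toReal)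
    (fun _ => ENNReal.toReal_nonneg)
    (by simp [negLaw, lap_dirac_zero]) hκ (fun n => ?_) (fun n => ?_) N⟩
  · refine (sum_lap_le hH (fun n => le_add_self.trans (posLaw_univ_le m n)) n).trans ?_
    rw [negEntrance_one, (real_univ_sub_lap hneg).2]
  · refine ladder_toReal (u := fun n => lap β (negLaw m n))
      (fun n => ne_top_of_le_ne_top ENNReal.one_ne_top (lap_negLaw_le m n hβ.le))
      (fun n => ne_top_of_le_ne_top (measure_ne_top _ _) (lap_le_univ (hH n)))
      (by simp [negEntrance, lap_zero_measure]) ?_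
    rw [(wienerHopf_succ m n).2, lap_convSeq, ← Finset.Nat.sum_antidiagonal_swap]
    exact Finset.sum_congr rfl fun q _ => mul_comm _ _

lemma convPow_univ (n : ℕ) : convPow m n univ = 1 := measure_univ

lemma posPart_univ_le (n : ℕ) : posPart m n univ ≤ 1 := by
  cases n with
  | zero => simp [posPart]
  | succ n => rw [posPart]; exact (Measure.restrict_apply_le _ _).trans (convPow_univ m _).le

lemma negPart_univ_le (n : ℕ) : negPart m n univ ≤ 1 := by
  cases n with
  | zero => simp [negPart]
  | succ n => rw [negPart]; exact (Measure.restrict_apply_le _ _).trans (convPow_univ m _).le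

lemma lap_posPart_le (n : ℕ) {α : ℝ} (hα : 0 ≤ α) : lap (-α) (posPart m n) ≤ 1 := by
  refine (lap_le_univ ?_).trans (posPart_univ_le m n)
  cases n with
  | zero => simp [posPart]
  | succ n =>
    filter_upwards [ae_restrict_mem measurableSet_Ioi] with x hx
    have : 0 < x := hx
    nlinarith

lemma lap_negPart_le (n : ℕ) {β : ℝ} (hβ : 0 ≤ β) : lap β (negPart m n) ≤ 1 := by
  refine (lap_le_univ ?_).trans (negPart_univ_le m n)
  cases n with
  | zero => simp [negPart]
  | succ n =>
    filter_upwards [ae_restrict_mem measurableSet_Iic] with x hx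
    have : x ≤ 0 := hx
    nlinarith

lemma lap_posLaw_renewal {α : ℝ} (hα : 0 ≤ α) (n : ℕ) :
    (n : ℝ) * (lap (-α) (posLaw m n)).toReal = ∑ j ∈ Finset.range n,
      (lap (-α) (posLaw m j)).toReal * (lap (-α) (posPart m (n - j))).toReal := by
  refine renewal_toReal (u := fun n => lap (-α) (posLaw m n))
    (p := fun n => lap (-α) (posPart m n))
    (fun n => ne_top_of_le_ne_top ENNReal.one_ne_top (lap_posLaw_le m n hα))
    (fun n => ne_top_of_le_ne_top ENNReal.one_ne_top (lap_posPart_le m n hα))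
    (by simp [posPart, lap_zero_measure]) (fun n => ?_) n
  rw [← lap_convSeq, ← (spitzer m n).1, lap_finset_sum]
  simp

lemma lap_negLaw_renewal {β : ℝ} (hβ : 0 ≤ β) (n : ℕ) :
    (n : ℝ) * (lap β (negLaw m n)).toReal = ∑ j ∈ Finset.range n,
      (lap β (negLaw m j)).toReal * (lap β (negPart m (n - j))).toReal := by
  refine renewal_toReal (u := fun n => lap β (negLaw m n))
    (p := fun n => lap β (negPart m n))
    (fun n => ne_top_of_le_ne_top ENNReal.one_ne_top (lap_negLaw_le m n hβ))
    (fun n => ne_top_of_le_ne_top ENNReal.one_ne_top (lap_negPart_le m n hβ))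
    (by simp [negPart, lap_zero_measure]) (fun n => ?_) n
  rw [← lap_convSeq, ← (spitzer m n).2, lap_finset_sum]
  simp

end

lemma charFun_convPow (m : Measure ℝ) [IsProbabilityMeasure m] (n : ℕ) (t : ℝ) :
    charFun (convPow m n) t = charFun m t ^ n := by
  induction n with
  | zero => simp [convPow]
  | succ n ih => rw [convPow, charFun_conv, ih, pow_succ']

/-- A centred law with positive finite variance, in the form used for the local limit theorem. -/
structure CentredWalk (m : Measure ℝ) : Prop where
  mean : ∫ x, x ∂m = 0
  sq : Integrable (fun x : ℝ => x ^ 2) m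
  var : 0 < ∫ x, x ^ 2 ∂m
  nonLattice : NonLattice m

section CharFun

variable {m : Measure ℝ} [IsProbabilityMeasure m]

lemma norm_charFun_lt_one (hN : NonLattice m) {t : ℝ} (ht : t ≠ 0) : ‖charFun m t‖ < 1 := by
  refine lt_of_le_of_ne (norm_charFun_le_one t) fun h => hN ?_
  set θ := (charFun m t).arg with hθ
  have h1 : charFun m t = Complex.exp (θ * Complex.I) := by
    have := Complex.norm_mul_exp_arg_mul_I (charFun m t)
    rw [h] at this
    simpa using this.symm
  have h2 : ∫ x, Complex.exp ((t * x - θ : ℝ) * Complex.I) ∂m = 1 := by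
    have : ∀ x : ℝ, Complex.exp ((t * x - θ : ℝ) * Complex.I) =
        Complex.exp (t * x * Complex.I) * Complex.exp (-(θ * Complex.I)) := fun x => by
      rw [← Complex.exp_add]; congr 1; push_cast; ring
    simp_rw [this]
    rw [integral_mul_const, ← charFun_apply_real, h1, ← Complex.exp_add]
    simp
  have h_integrable : Integrable (fun x : ℝ => Complex.exp ((t * x - θ : ℝ) * Complex.I)) m := by
    refine Integrable.of_bound (C := 1) (by fun_prop) (Eventually.of_forall fun x => ?_)
    rw [Complex.norm_exp_ofReal_mul_I]
  have h3 : ∫ x, (1 - Real.cos (t * x - θ)) ∂m = 0 := by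
    have h4 := congrArg Complex.re h2
    rw [← RCLike.re_eq_complex_re, ← integral_re h_integrable] at h4
    have h5 : ∀ x : ℝ, RCLike.re (Complex.exp ((t * x - θ : ℝ) * Complex.I)) =
        Real.cos (t * x - θ) := fun x => by
      rw [RCLike.re_eq_complex_re, Complex.exp_ofReal_mul_I_re]
    simp_rw [h5] at h4
    rw [integral_sub (integrable_const _), h4]
    · simp
    · refine Integrable.of_bound (C := 1) (by fun_prop) (Eventually.of_forall fun x => ?_)
      exact Real.abs_cos_le_one _
  have h6 : ∀ᵐ x ∂m, 1 - Real.cos (t * x - θ) = 0 := by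
    refine (integral_eq_zero_iff_of_nonneg (fun x => ?_) ?_).mp h3
    · simpa using Real.cos_le_one _
    · refine Integrable.of_bound (C := 2) (by fun_prop) (Eventually.of_forall fun x => ?_)
      rw [Real.norm_eq_abs, abs_le]
      constructor <;> linarith [Real.cos_le_one (t * x - θ), Real.neg_one_le_cos (t * x - θ)]
  refine ⟨θ / t, 2 * Real.pi / t, ?_⟩
  have h7 : ∀ᵐ x ∂m, ∃ k : ℤ, x = θ / t + k * (2 * Real.pi / t) := by
    filter_upwards [h6] with x hx
    obtain ⟨k, hk⟩ := (Real.cos_eq_one_iff (t * x - θ)).mp (by linarith)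
    refine ⟨k, ?_⟩
    field_simp
    linarith
  refine le_antisymm prob_le_one ?_
  rw [← measure_univ (μ := m)]
  exact measure_mono_ae (h7.mono fun x hx _ => hx)

namespace CentredWalk

omit [IsProbabilityMeasure m] in
/-- Rescaling of the characteristic function to unit variance. -/
lemma exists_scale (hm : CentredWalk m) : ∃ s : ℝ, 0 < s ∧
    (∫ x, x / s ∂m = 0) ∧ (∫ x, (x / s) ^ 2 ∂m = 1) ∧
    ∀ t, charFun m t = charFun (m.map fun x => x / s) (s * t) := by
  refine ⟨√(∫ x, x ^ 2 ∂m), Real.sqrt_pos.mpr hm.var, ?_, ?_, fun t => ?_⟩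
  · rw [integral_div, hm.mean, zero_div]
  · simp_rw [div_pow]
    rw [integral_div, Real.sq_sqrt hm.var.le, div_self hm.var.ne']
  · have h := (Real.sqrt_pos.mpr hm.var).ne'
    simp_rw [div_eq_inv_mul]
    rw [charFun_map_mul]
    congr 1
    field_simp

lemma norm_charFun_le_near (hm : CentredWalk m) : ∃ c δ : ℝ, 0 < c ∧ 0 < δ ∧
    ∀ t, |t| ≤ δ → ‖charFun m t‖ ≤ Real.exp (-(c * t ^ 2)) := by
  obtain ⟨s, hs, h0, h1, hφ⟩ := hm.exists_scale
  have hT := taylor_charFun_two (P := m) (X := fun x => x / s) (by fun_prop) h0 (by simpa using h1)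
  have hT' := hT.def (c := 1 / 4) (by norm_num)
  obtain ⟨ε, hε, hball⟩ := Metric.eventually_nhds_iff.mp hT'
  have hmin : 0 < min (ε / 2) 1 := by positivity
  refine ⟨s ^ 2 / 4, min (ε / 2) 1 / s, by positivity, by positivity, fun t ht => ?_⟩
  have ht1 : |s * t| ≤ min (ε / 2) 1 := by
    rw [abs_mul, abs_of_pos hs, mul_comm]
    exact (le_div_iff₀ hs).mp ht
  have ht2 : dist (s * t) 0 < ε := by
    rw [Real.dist_eq, sub_zero]
    exact ht1.trans_lt ((min_le_left _ _).trans_lt (by linarith))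
  have ht3 : |s * t| ≤ 1 := ht1.trans (min_le_right _ _)
  have ht4 : (s * t) ^ 2 ≤ 1 := by rw [← sq_abs]; nlinarith [abs_nonneg (s * t)]
  have h2 := hball ht2
  rw [hφ]
  set z := charFun (m.map fun x => x / s) (s * t)
  have h3 := norm_add_le (z - (1 - ((s * t : ℝ) : ℂ) ^ 2 / 2)) (1 - ((s * t : ℝ) : ℂ) ^ 2 / 2)
  rw [sub_add_cancel] at h3
  have h4 : ‖(1 - ((s * t : ℝ) : ℂ) ^ 2 / 2)‖ = 1 - (s * t) ^ 2 / 2 := by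
    rw [show (1 - ((s * t : ℝ) : ℂ) ^ 2 / 2) = ((1 - (s * t) ^ 2 / 2 : ℝ) : ℂ) by push_cast; ring,
      Complex.norm_real, Real.norm_eq_abs, abs_of_nonneg (by linarith)]
  have h5 : ‖(s * t) ^ 2‖ = (s * t) ^ 2 := by rw [Real.norm_eq_abs, abs_of_nonneg (sq_nonneg _)]
  rw [h4] at h3
  rw [h5] at h2
  have h6 := Real.add_one_le_exp (-(s ^ 2 / 4 * t ^ 2))
  nlinarith

lemma norm_charFun_le (hm : CentredWalk m) (T : ℝ) : ∃ c : ℝ, 0 < c ∧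
    ∀ t, |t| ≤ T → ‖charFun m t‖ ≤ Real.exp (-(c * t ^ 2)) := by
  obtain ⟨c, δ, hc, hδ, h⟩ := hm.norm_charFun_le_near
  set K := Icc (-T) T ∩ {t : ℝ | δ ≤ |t|} with hK
  have hKc : IsCompact K := isCompact_Icc.inter_right (isClosed_le continuous_const continuous_abs)
  have : ∃ r : ℝ, 0 < r ∧ r < 1 ∧ ∀ t ∈ K, ‖charFun m t‖ ≤ r := by
    rcases K.eq_empty_or_nonempty with he | hne
    · exact ⟨1 / 2, by norm_num, by norm_num, by simp [he]⟩
    · obtain ⟨t₀, ht₀, hmax⟩ := hKc.exists_isMaxOn hne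
        (f := fun t => ‖charFun m t‖) (continuous_charFun.norm.continuousOn)
      have hlt : ‖charFun m t₀‖ < 1 := norm_charFun_lt_one hm.nonLattice
        (abs_pos.mp (hδ.trans_le ht₀.2))
      exact ⟨max (1 / 2) ‖charFun m t₀‖, by positivity, max_lt (by norm_num) hlt,
        fun t ht => (hmax ht).trans (le_max_right _ _)⟩
  obtain ⟨r, hr0, hr1, hr⟩ := this
  have hlog : 0 < -Real.log r := by linarith [Real.log_neg hr0 hr1]
  refine ⟨min c (-Real.log r / (T ^ 2 + 1)), by positivity, fun t ht => ?_⟩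
  by_cases htδ : |t| ≤ δ
  · refine (h t htδ).trans (Real.exp_le_exp.mpr ?_)
    nlinarith [mul_le_mul_of_nonneg_right (min_le_left c (-Real.log r / (T ^ 2 + 1)))
      (sq_nonneg t)]
  · refine (hr t ⟨abs_le.mp ht, (not_le.mp htδ).le⟩).trans ?_
    rw [← Real.log_le_iff_le_exp hr0]
    have h1 : t ^ 2 ≤ T ^ 2 + 1 := by
      have : |t| ^ 2 ≤ T ^ 2 := by gcongr
      rw [sq_abs] at this
      linarith
    have h2 : min c (-Real.log r / (T ^ 2 + 1)) * t ^ 2 ≤ -Real.log r / (T ^ 2 + 1) * (T ^ 2 + 1) :=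
      mul_le_mul (min_le_right _ _) h1 (sq_nonneg _) (by positivity)
    rw [div_mul_cancel₀ _ (by positivity)] at h2
    linarith

lemma tendsto_charFun_pow (hm : CentredWalk m) : ∃ c : ℝ, 0 < c ∧ ∀ u : ℝ,
    Tendsto (fun n : ℕ => charFun m (u / √(n : ℝ)) ^ n) atTop
      (𝓝 (Real.exp (-(c * u ^ 2)) : ℝ)) := by
  obtain ⟨s, hs, h0, h1, hφ⟩ := hm.exists_scale
  refine ⟨s ^ 2 / 2, by positivity, fun u => ?_⟩
  have := tendsto_charFun_inv_sqrt_mul_pow (P := m) (X := fun x => x / s) (by fun_prop) h0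
    (by simpa using h1) (s * u)
  convert! this using 2 with n
  · rw [hφ]; congr 2; ring
  · push_cast; congr 2; ring

end CentredWalk
end CharFun

/-- The unnormalised inverse Fourier transform `x ↦ ∫ K(s) e^{isx} ds`. -/
def expTransform (K : ℝ → ℂ) (x : ℝ) : ℂ := ∫ s, K s * Complex.exp (s * x * Complex.I)

lemma expTransform_shift (K : ℝ → ℂ) (θ x : ℝ) :
    expTransform (fun s => K (s - θ)) x = Complex.exp (θ * x * Complex.I) * expTransform K x := by
  unfold expTransform
  rw [← integral_const_mul, ← integral_sub_right_eq_self (fun s : ℝ =>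
    Complex.exp (θ * x * Complex.I) * (K s * Complex.exp (s * x * Complex.I))) θ]
  refine integral_congr_ae (Eventually.of_forall fun s => ?_)
  simp only
  rw [mul_left_comm, ← Complex.exp_add]
  congr 2
  push_cast
  ring

lemma expTransform_modulate (K : ℝ → ℂ) (a x : ℝ) :
    expTransform (fun s => K s * Complex.exp (-(s * a * Complex.I))) x =
      expTransform K (x - a) := by
  unfold expTransform
  refine integral_congr_ae (Eventually.of_forall fun s => ?_)
  simp only
  rw [mul_assoc, ← Complex.exp_add]
  congr 2
  push_cast
  ring

lemma norm_exp_mul_mul_I (s x : ℝ) : ‖Complex.exp (s * x * Complex.I)‖ = 1 := by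
  rw [← Complex.ofReal_mul, Complex.norm_exp_ofReal_mul_I]

lemma integrable_mul_exp {K : ℝ → ℂ} (hK : Continuous K) (hc : HasCompactSupport K) (x : ℝ) :
    Integrable fun s : ℝ => K s * Complex.exp (s * x * Complex.I) :=
  Continuous.integrable_of_hasCompactSupport (by fun_prop) hc.mul_right

lemma expTransform_add {K L : ℝ → ℂ} (hK : Continuous K) (hKc : HasCompactSupport K)
    (hL : Continuous L) (hLc : HasCompactSupport L) (x : ℝ) :
    expTransform (fun s => K s + L s) x = expTransform K x + expTransform L x := by
  unfold expTransform
  simp_rw [add_mul]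
  exact integral_add (integrable_mul_exp hK hKc x) (integrable_mul_exp hL hLc x)

lemma integral_expTransform {K : ℝ → ℂ} (hK : Continuous K) (hc : HasCompactSupport K)
    (μ : Measure ℝ) [IsFiniteMeasure μ] :
    ∫ x, expTransform K x ∂μ = ∫ s, K s * charFun μ s := by
  unfold expTransform
  rw [integral_integral_swap]
  · refine integral_congr_ae (Eventually.of_forall fun s => ?_)
    simp only
    rw [integral_const_mul, charFun_apply_real]
  · have h1 : Integrable (fun p : ℝ × ℝ => K p.2) (μ.prod volume) :=
      (hK.integrable_of_hasCompactSupport hc).comp_snd μ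
    have h2 := h1.mul_bdd (c := 1)
      (g := fun p : ℝ × ℝ => Complex.exp (p.2 * p.1 * Complex.I)) (by fun_prop)
      (Eventually.of_forall fun p => (norm_exp_mul_mul_I p.2 p.1).le)
    exact h2

/-- Fourier inversion at the origin. -/
lemma integral_expTransform_volume {K : ℝ → ℂ} (hK : Continuous K) (hc : HasCompactSupport K)
    (hI : Integrable (expTransform K)) : ∫ x, expTransform K x = 2 * Real.pi * K 0 := by
  have hF : ∀ w : ℝ, FourierTransform.fourier K w = expTransform K (-(2 * Real.pi) * w) := by
    intro w
    rw [Real.fourier_eq']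
    refine integral_congr_ae (Eventually.of_forall fun s => ?_)
    simp only [smul_eq_mul]
    rw [mul_comm]
    congr 2
    simp
    ring
  have h2π : -(2 * Real.pi) ≠ 0 := neg_ne_zero.mpr (by positivity)
  have hFI : Integrable (FourierTransform.fourier K) := by
    rw [funext hF]
    exact hI.comp_mul_left' h2π
  have h := congrFun (hK.fourierInv_fourier_eq (hK.integrable_of_hasCompactSupport hc) hFI) 0
  rw [Real.fourierInv_eq'] at h
  simp only [inner_zero_right, mul_zero, Complex.ofReal_zero, zero_mul, Complex.exp_zero,
    one_smul] at h
  rw [← h]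
  simp_rw [hF]
  rw [Measure.integral_comp_mul_left]
  rw [abs_inv, abs_neg, abs_of_pos (by positivity), Complex.real_smul]
  push_cast
  field_simp

section LocalLimit

variable {m : Measure ℝ} [IsProbabilityMeasure m]

instance isProbabilityMeasure_convPow (n : ℕ) : IsProbabilityMeasure (convPow m n) := by
  induction n with
  | zero => rw [convPow]; infer_instance
  | succ n ih => rw [convPow]; infer_instance

lemma sqrt_mul_integral_expTransform {K : ℝ → ℂ} (hK : Continuous K) (hc : HasCompactSupport K)
    {n : ℕ} (hn : 1 ≤ n) :
    √(n : ℝ) * ∫ x, expTransform K x ∂(convPow m n) =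
      ∫ u : ℝ, K (u / √(n : ℝ)) * charFun m (u / √(n : ℝ)) ^ n := by
  have hs : 0 < √(n : ℝ) := Real.sqrt_pos.mpr (by exact_mod_cast hn)
  rw [integral_expTransform hK hc]
  simp_rw [charFun_convPow]
  rw [Measure.integral_comp_div (fun s : ℝ => K s * charFun m s ^ n), abs_of_pos hs,
    Complex.real_smul]

omit [IsProbabilityMeasure m] in
lemma norm_integrand_le {c T B : ℝ} (hφ : ∀ t, |t| ≤ T → ‖charFun m t‖ ≤ Real.exp (-(c * t ^ 2)))
    {K : ℝ → ℂ} (hB : ∀ s, ‖K s‖ ≤ B) (hT : ∀ s, T < |s| → K s = 0) {n : ℕ} (hn : 1 ≤ n) (u : ℝ) :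
    ‖K (u / √(n : ℝ)) * charFun m (u / √(n : ℝ)) ^ n‖ ≤ B * Real.exp (-c * u ^ 2) := by
  have hB0 : 0 ≤ B := (norm_nonneg _).trans (hB 0)
  have hn' : (0 : ℝ) < n := by exact_mod_cast hn
  rw [norm_mul, norm_pow]
  by_cases h : |u / √(n : ℝ)| ≤ T
  · refine mul_le_mul (hB _) ?_ (by positivity) hB0
    refine (pow_le_pow_left₀ (norm_nonneg _) (hφ _ h) n).trans (le_of_eq ?_)
    rw [← Real.exp_nat_mul, div_pow, Real.sq_sqrt hn'.le]
    congr 1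
    field_simp
  · rw [hT _ (not_le.mp h), norm_zero, zero_mul]
    positivity

namespace CentredWalk

/-- Uniform bound of order `n^{-1/2}` for band-limited test functions. -/
lemma sqrt_mul_norm_integral_le (hm : CentredWalk m) (T : ℝ) : ∃ C : ℝ, 0 ≤ C ∧
    ∀ K : ℝ → ℂ, Continuous K → HasCompactSupport K → (∀ s, ‖K s‖ ≤ 1) →
      (∀ s, T < |s| → K s = 0) →
      ∀ n : ℕ, √(n : ℝ) * ‖∫ x, expTransform K x ∂(convPow m n)‖ ≤ C := by
  obtain ⟨c, hc, hφ⟩ := hm.norm_charFun_le T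
  refine ⟨∫ u : ℝ, Real.exp (-c * u ^ 2), by positivity, fun K hK hKc hK1 hKT n => ?_⟩
  rcases Nat.eq_zero_or_pos n with rfl | hn
  · simp only [Nat.cast_zero, Real.sqrt_zero, zero_mul]; positivity
  have h : √(n : ℝ) * ‖∫ x, expTransform K x ∂(convPow m n)‖ =
      ‖∫ u : ℝ, K (u / √(n : ℝ)) * charFun m (u / √(n : ℝ)) ^ n‖ := by
    rw [← sqrt_mul_integral_expTransform hK hKc hn, norm_mul, Complex.norm_real,
      Real.norm_of_nonneg (Real.sqrt_nonneg _)]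
  rw [h]
  refine norm_integral_le_of_norm_le (integrable_exp_neg_mul_sq hc)
    (Eventually.of_forall fun u => ?_)
  simpa using norm_integrand_le hφ hK1 hKT hn u

/-- Local limit theorem for band-limited test functions. -/
lemma tendsto_sqrt_mul_integral_expTransform (hm : CentredWalk m) : ∃ κ : ℝ, 0 < κ ∧
    ∀ K : ℝ → ℂ, Continuous K → HasCompactSupport K →
      Tendsto (fun n : ℕ => √(n : ℝ) * ∫ x, expTransform K x ∂(convPow m n)) atTop
        (𝓝 (κ * K 0)) := by
  obtain ⟨c, hc, hlim⟩ := hm.tendsto_charFun_pow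
  refine ⟨∫ u : ℝ, Real.exp (-c * u ^ 2), ?_, fun K hK hKc => ?_⟩
  · rw [integral_gaussian]; positivity
  obtain ⟨B, hB⟩ := hKc.exists_bound_of_continuous hK
  obtain ⟨T, hT⟩ : ∃ T : ℝ, ∀ s, T < |s| → K s = 0 := by
    obtain ⟨T, hT⟩ := hKc.isCompact.isBounded.exists_norm_le
    refine ⟨T, fun s hs => ?_⟩
    by_contra h
    exact absurd (hT s (subset_tsupport _ h)) (not_le.mpr hs)
  obtain ⟨c', hc', hφ⟩ := hm.norm_charFun_le T
  have h1 : Tendsto (fun n : ℕ => ∫ u : ℝ, K (u / √(n : ℝ)) * charFun m (u / √(n : ℝ)) ^ n) atTop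
      (𝓝 (∫ u : ℝ, K 0 * (Real.exp (-(c * u ^ 2)) : ℝ))) := by
    refine tendsto_integral_filter_of_dominated_convergence
      (fun u => B * Real.exp (-c' * u ^ 2)) ?_ ?_ ((integrable_exp_neg_mul_sq hc').const_mul B) ?_
    · refine Eventually.of_forall fun n => ?_
      have : Continuous (charFun m) := continuous_charFun
      exact (by fun_prop : Continuous fun u : ℝ =>
        K (u / √(n : ℝ)) * charFun m (u / √(n : ℝ)) ^ n).aestronglyMeasurable
    · filter_upwards [eventually_ge_atTop 1] with n hn
      exact Eventually.of_forall fun u => norm_integrand_le hφ hB hT hn u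
    · refine Eventually.of_forall fun u => Tendsto.mul ?_ (hlim u)
      refine (hK.tendsto 0).comp (Tendsto.const_div_atTop ?_ u)
      exact Real.tendsto_sqrt_atTop.comp tendsto_natCast_atTop_atTop
  have h2 : (∫ u : ℝ, K 0 * ((Real.exp (-(c * u ^ 2)) : ℝ) : ℂ)) =
      ((∫ u : ℝ, Real.exp (-c * u ^ 2) : ℝ) : ℂ) * K 0 := by
    rw [integral_const_mul, integral_complex_ofReal, mul_comm]
    simp_rw [neg_mul]
  rw [h2] at h1
  refine h1.congr' ?_
  filter_upwards [eventually_ge_atTop 1] with n hn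
  exact (sqrt_mul_integral_expTransform hK hKc hn).symm

end CentredWalk
end LocalLimit

/-- The triangular kernel. -/
def tri (t : ℝ) : ℝ := max 0 (1 - |t|)

@[fun_prop]
lemma continuous_tri : Continuous tri := by unfold tri; fun_prop

lemma tri_nonneg (t : ℝ) : 0 ≤ tri t := le_max_left _ _

lemma tri_le_one (t : ℝ) : tri t ≤ 1 := max_le zero_le_one (by linarith [abs_nonneg t])

lemma tri_zero : tri 0 = 1 := by simp [tri]

lemma tri_neg (t : ℝ) : tri (-t) = tri t := by simp [tri]

lemma tri_eq_zero {t : ℝ} (h : 1 ≤ |t|) : tri t = 0 := max_eq_left (by linarith)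

lemma hasCompactSupport_tri : HasCompactSupport tri :=
  HasCompactSupport.intro (isCompact_Icc (a := (-1 : ℝ)) (b := 1)) fun t ht =>
    tri_eq_zero (by
      by_contra h
      exact ht (abs_le.mp (not_le.mp h).le))

lemma hasCompactSupport_tri_ofReal : HasCompactSupport fun s => (tri s : ℂ) :=
  hasCompactSupport_tri.comp_left (g := fun x : ℝ => (x : ℂ)) rfl

/-- The (Fejér type) Fourier transform of the triangular kernel. -/
def fejer (x : ℝ) : ℝ := ∫ t, tri t * Real.cos (t * x)

lemma integrable_tri : Integrable tri :=
  continuous_tri.integrable_of_hasCompactSupport hasCompactSupport_tri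

lemma integrable_tri_mul_cos (x : ℝ) : Integrable fun t => tri t * Real.cos (t * x) :=
  Continuous.integrable_of_hasCompactSupport (by fun_prop) hasCompactSupport_tri.mul_right

lemma continuous_fejer : Continuous fejer := by
  refine continuous_of_dominated (bound := tri) (fun x => by fun_prop)
    (fun x => Eventually.of_forall fun t => ?_) integrable_tri
    (Eventually.of_forall fun t => by fun_prop)
  rw [norm_mul, Real.norm_of_nonneg (tri_nonneg t)]
  exact mul_le_of_le_one_right (tri_nonneg t) (Real.abs_cos_le_one _)

lemma expTransform_tri (x : ℝ) : expTransform (fun s => (tri s : ℂ)) x = fejer x := by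
  have h0 := integrable_mul_exp (K := fun s => (tri s : ℂ)) (by fun_prop)
    hasCompactSupport_tri_ofReal x
  have h1 : expTransform (fun s => (tri s : ℂ)) x =
      ∫ s : ℝ, (tri s : ℂ) * Complex.exp (-(s * x * Complex.I)) := by
    unfold expTransform
    rw [← integral_neg_eq_self]
    simp [tri_neg]
  have h2 : Integrable fun s : ℝ => (tri s : ℂ) * Complex.exp (-(s * x * Complex.I)) := by
    have := integrable_mul_exp (K := fun s => (tri s : ℂ)) (by fun_prop)
      hasCompactSupport_tri_ofReal (-x)
    simpa using this
  have h3 : (2 : ℂ) * expTransform (fun s => (tri s : ℂ)) x = 2 * (fejer x : ℂ) := by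
    rw [two_mul]
    nth_rewrite 1 [h1]
    rw [expTransform, ← integral_add h2 h0, fejer, ← integral_complex_ofReal, ← integral_const_mul]
    refine integral_congr_ae (Eventually.of_forall fun s => ?_)
    simp only
    push_cast
    rw [Complex.cos, neg_mul]
    ring
  exact mul_left_cancel₀ two_ne_zero h3

lemma sq_mul_fejer (x : ℝ) : x ^ 2 * fejer x = 2 * (1 - Real.cos x) := by
  have h1 : fejer x = 2 * ∫ t in Ioi (0 : ℝ), max 0 (1 - t) * Real.cos (t * x) := by
    rw [← integral_comp_abs (f := fun t => max 0 (1 - t) * Real.cos (t * x)), fejer]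
    refine integral_congr_ae (Eventually.of_forall fun t => ?_)
    simp only [tri]
    rcases abs_choice t with h | h <;> rw [h]
    rw [neg_mul, Real.cos_neg]
  have h2 : ∫ t in Ioi (0 : ℝ), max 0 (1 - t) * Real.cos (t * x) =
      ∫ t in (0 : ℝ)..1, (1 - t) * Real.cos (t * x) := by
    rw [intervalIntegral.integral_of_le zero_le_one,
      setIntegral_eq_of_subset_of_forall_sdiff_eq_zero measurableSet_Ioi
        (fun t (ht : t ∈ Ioc (0 : ℝ) 1) => ht.1)]
    · refine setIntegral_congr_fun measurableSet_Ioc fun t ht => ?_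
      rw [max_eq_right (by linarith [ht.2])]
    · rintro t ⟨h0, h1⟩
      have h3 : (1 : ℝ) < t := by
        by_contra h
        exact h1 ⟨h0, not_lt.mp h⟩
      rw [max_eq_left (by linarith), zero_mul]
  have h3 : x ^ 2 * ∫ t in (0 : ℝ)..1, (1 - t) * Real.cos (t * x) = 1 - Real.cos x := by
    rw [← intervalIntegral.integral_const_mul]
    rw [intervalIntegral.integral_eq_sub_of_hasDerivAt
      (f := fun t => x * (1 - t) * Real.sin (t * x) - Real.cos (t * x))]
    · simp; ring
    · intro t _
      have hl : HasDerivAt (fun t : ℝ => t * x) x t := by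
        simpa using (hasDerivAt_id t).mul_const x
      have hs := hl.sin
      have hc := hl.cos
      have h4 : HasDerivAt (fun t : ℝ => x * (1 - t)) (x * -1) t := by
        have := ((hasDerivAt_id t).const_sub 1).const_mul x
        simpa using this
      refine ((h4.mul hs).sub hc).congr_deriv ?_
      ring
    · exact (by fun_prop : Continuous fun t : ℝ =>
        x ^ 2 * ((1 - t) * Real.cos (t * x))).intervalIntegrable _ _
  rw [h1, h2]
  linarith

lemma fejer_nonneg (x : ℝ) : 0 ≤ fejer x := by
  by_cases hx : x = 0
  · subst hx
    exact integral_nonneg fun t => by simpa using tri_nonneg t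
  · have h := sq_mul_fejer x
    have h1 : 0 < x ^ 2 := by positivity
    have h2 := Real.cos_le_one x
    by_contra h3
    nlinarith

lemma fejer_le (x : ℝ) : (1 + x ^ 2) * fejer x ≤ 6 := by
  have h0 : ∫ t, tri t ≤ 2 := by
    have : ∀ t, tri t ≤ (Icc (-1 : ℝ) 1).indicator (fun _ => (1 : ℝ)) t := fun t => by
      by_cases h : t ∈ Icc (-1 : ℝ) 1
      · rw [indicator_of_mem h]; exact tri_le_one t
      · rw [indicator_of_notMem h, tri_eq_zero]
        by_contra h'
        exact h (abs_le.mp (not_le.mp h').le)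
    have h2 : Integrable ((Icc (-1 : ℝ) 1).indicator (fun _ => (1 : ℝ))) :=
      (integrable_indicator_iff measurableSet_Icc).mpr (by simp)
    refine (integral_mono integrable_tri h2 this).trans ?_
    rw [integral_indicator measurableSet_Icc]
    simp
    norm_num
  have h1 : fejer x ≤ ∫ t, tri t := integral_mono (integrable_tri_mul_cos x) integrable_tri
    fun t => mul_le_of_le_one_right (tri_nonneg t) (Real.cos_le_one _)
  nlinarith [sq_mul_fejer x, Real.neg_one_le_cos x]

/-- A positive integrable band-limited function. -/
def fejerSum (x : ℝ) : ℝ := fejer x + fejer (x - 1)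

lemma continuous_fejerSum : Continuous fejerSum :=
  continuous_fejer.add (continuous_fejer.comp (by fun_prop))

lemma fejerSum_le (x : ℝ) : (1 + x ^ 2) * fejerSum x ≤ 24 := by
  have h1 := fejer_le x
  have h2 := fejer_le (x - 1)
  have h3 := fejer_nonneg (x - 1)
  have h4 : (1 + x ^ 2) ≤ 3 * (1 + (x - 1) ^ 2) := by nlinarith [sq_nonneg (2 * x - 3)]
  have h5 : (1 + x ^ 2) * fejer (x - 1) ≤ 3 * (1 + (x - 1) ^ 2) * fejer (x - 1) := by gcongr
  unfold fejerSum
  linarith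

lemma exists_le_fejerSum : ∃ c : ℝ, 0 < c ∧ ∀ x, c ≤ (1 + x ^ 2) * fejerSum x := by
  have hc : Real.cos (1 / 2) < 1 := by
    have := Real.cos_lt_cos_of_nonneg_of_le_pi_div_two (x := 0) (y := 1 / 2) le_rfl
      (by linarith [Real.pi_gt_three]) (by norm_num)
    rwa [Real.cos_zero] at this
  have hc0 : 0 < Real.cos (1 / 2) :=
    Real.cos_pos_of_mem_Ioo ⟨by linarith [Real.pi_gt_three], by linarith [Real.pi_gt_three]⟩
  refine ⟨2 * (1 - Real.cos (1 / 2)), by linarith, fun x => ?_⟩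
  have h1 := sq_mul_fejer x
  have h2 := sq_mul_fejer (x - 1)
  have h3 : Real.cos x + Real.cos (x - 1) = 2 * Real.cos (x - 1 / 2) * Real.cos (1 / 2) := by
    rw [Real.cos_add_cos]; ring_nf
  have h4 : Real.cos (x - 1 / 2) * Real.cos (1 / 2) ≤ Real.cos (1 / 2) :=
    mul_le_of_le_one_left hc0.le (Real.cos_le_one _)
  have h5 := fejer_nonneg x
  have h6 := fejer_nonneg (x - 1)
  unfold fejerSum
  have h7 : (x - 1) ^ 2 ≤ 2 * (1 + x ^ 2) := by nlinarith [sq_nonneg (x + 1)]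
  have h8 := mul_le_mul_of_nonneg_right h7 h6
  nlinarith

lemma fejerSum_pos (x : ℝ) : 0 < fejerSum x := by
  obtain ⟨c, hc, h⟩ := exists_le_fejerSum
  have := hc.trans_le (h x)
  exact (mul_pos_iff_of_pos_left (by positivity)).mp this

/-- The kernel whose transform is `e^{iθx} fejerSum x`. -/
def fejerKernel (θ s : ℝ) : ℂ :=
  (tri (s - θ) : ℂ) + (tri (s - θ) : ℂ) * Complex.exp (-((s - θ : ℝ) * (1 : ℝ) * Complex.I))

lemma continuous_fejerKernel (θ : ℝ) : Continuous (fejerKernel θ) := by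
  unfold fejerKernel; fun_prop

lemma hasCompactSupport_fejerKernel (θ : ℝ) : HasCompactSupport (fejerKernel θ) := by
  have h : HasCompactSupport fun s : ℝ => (tri (s - θ) : ℂ) := by
    have := hasCompactSupport_tri_ofReal.comp_homeomorph (Homeomorph.addRight (-θ))
    simpa [Function.comp_def, sub_eq_add_neg] using this
  exact h.add h.mul_right

lemma expTransform_fejerKernel (θ x : ℝ) :
    expTransform (fejerKernel θ) x = Complex.exp (θ * x * Complex.I) * fejerSum x := by
  have h1 := expTransform_shift (fun s => (tri s : ℂ) +
    (tri s : ℂ) * Complex.exp (-(s * (1 : ℝ) * Complex.I))) θ x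
  unfold fejerKernel
  rw [h1, expTransform_add (K := fun s => (tri s : ℂ))
    (L := fun s => (tri s : ℂ) * Complex.exp (-(s * (1 : ℝ) * Complex.I))) (by fun_prop)
    hasCompactSupport_tri_ofReal (by fun_prop) hasCompactSupport_tri_ofReal.mul_right, expTransform_modulate, expTransform_tri,
    expTransform_tri, fejerSum]
  push_cast
  rfl

lemma fejerKernel_zero_zero : fejerKernel 0 0 = 2 := by
  simp [fejerKernel, tri_zero]; norm_num

lemma integrable_one_add_sq_inv : Integrable fun x : ℝ => (1 + x ^ 2)⁻¹ :=
  integrable_inv_one_add_sq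

lemma integrable_fejerSum : Integrable fejerSum := by
  refine (integrable_one_add_sq_inv.const_mul 24).mono'
    continuous_fejerSum.aestronglyMeasurable (Eventually.of_forall fun x => ?_)
  rw [Real.norm_of_nonneg (fejerSum_pos x).le, ← div_eq_mul_inv, le_div_iff₀ (by positivity),
    mul_comm]
  exact fejerSum_le x

lemma exp_log_fejerSum (x : ℝ) : Real.exp (Real.log (fejerSum x)) = fejerSum x :=
  Real.exp_log (fejerSum_pos x)

lemma isProbabilityMeasure_tilted_fejerSum {μ : Measure ℝ} [NeZero μ]
    (h : Integrable fejerSum μ) :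
    IsProbabilityMeasure (μ.tilted fun x => Real.log (fejerSum x)) :=
  isProbabilityMeasure_tilted (by simpa only [exp_log_fejerSum] using h)

lemma integral_tilted_fejerSum {E : Type*} [NormedAddCommGroup E] [NormedSpace ℝ E]
    (μ : Measure ℝ) (k : ℝ → E) :
    ∫ x, k x ∂(μ.tilted fun x => Real.log (fejerSum x)) =
      (∫ x, fejerSum x ∂μ)⁻¹ • ∫ x, fejerSum x • k x ∂μ := by
  rw [integral_tilted, ← integral_smul]
  simp_rw [exp_log_fejerSum]
  refine integral_congr_ae (Eventually.of_forall fun x => ?_)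
  simp only
  rw [smul_smul, div_eq_inv_mul]

lemma integrable_fejerSum_of_isFiniteMeasure (μ : Measure ℝ) [IsFiniteMeasure μ] :
    Integrable fejerSum μ := by
  refine Integrable.of_bound (C := 24) continuous_fejerSum.aestronglyMeasurable
    (Eventually.of_forall fun x => ?_)
  rw [Real.norm_of_nonneg (fejerSum_pos x).le]
  nlinarith [fejerSum_le x, fejerSum_pos x, sq_nonneg x]

lemma charFun_tilted_fejerSum (μ : Measure ℝ) (θ : ℝ) :
    charFun (μ.tilted fun x => Real.log (fejerSum x)) θ =
      (∫ x, expTransform (fejerKernel 0) x ∂μ)⁻¹ * ∫ x, expTransform (fejerKernel θ) x ∂μ := by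
  rw [charFun_apply_real, integral_tilted_fejerSum]
  simp_rw [expTransform_fejerKernel]
  rw [Complex.real_smul]
  congr 1
  · rw [Complex.ofReal_inv, ← integral_complex_ofReal]
    simp
  · refine integral_congr_ae (Eventually.of_forall fun x => ?_)
    simp only [Complex.real_smul]
    rw [mul_comm]

lemma integral_expTransform_fejerKernel_zero (μ : Measure ℝ) :
    ∫ x, expTransform (fejerKernel 0) x ∂μ = ((∫ x, fejerSum x ∂μ : ℝ) : ℂ) := by
  rw [← integral_complex_ofReal]
  simp_rw [expTransform_fejerKernel]
  simp

lemma integral_expTransform_fejerKernel_volume (θ : ℝ) :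
    ∫ x, expTransform (fejerKernel θ) x = 2 * Real.pi * fejerKernel θ 0 := by
  refine integral_expTransform_volume (continuous_fejerKernel θ)
    (hasCompactSupport_fejerKernel θ) ?_
  have h := (integrable_fejerSum.ofReal (𝕜 := ℂ)).bdd_mul (c := 1)
    (f := fun x : ℝ => Complex.exp (θ * x * Complex.I)) (by fun_prop)
    (Eventually.of_forall fun x => (norm_exp_mul_mul_I θ x).le)
  refine h.congr (Eventually.of_forall fun x => ?_)
  simp only [expTransform_fejerKernel]
  rfl

lemma integral_fejerSum : ∫ x, fejerSum x = 4 * Real.pi := by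
  have h := integral_expTransform_fejerKernel_volume 0
  rw [integral_expTransform_fejerKernel_zero, fejerKernel_zero_zero] at h
  have h' : ((∫ x, fejerSum x : ℝ) : ℂ) = ((4 * Real.pi : ℝ) : ℂ) := by
    rw [h]; push_cast; ring
  exact_mod_cast h'

section LocalLimit

variable {m : Measure ℝ} [IsProbabilityMeasure m]

/-- Local limit theorem for continuous test functions with quadratic decay. -/
lemma CentredWalk.tendsto_sqrt_mul_integral (hm : CentredWalk m) : ∃ κ : ℝ, 0 < κ ∧
    ∀ (h : ℝ → ℝ) (C : ℝ), Continuous h → (∀ x, |h x| ≤ C * (1 + x ^ 2)⁻¹) →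
      Tendsto (fun n : ℕ => √(n : ℝ) * ∫ x, h x ∂(convPow m n)) atTop (𝓝 (κ * ∫ x, h x)) := by
  obtain ⟨κ, hκ, hlim⟩ := hm.tendsto_sqrt_mul_integral_expTransform
  refine ⟨κ / (2 * Real.pi), by positivity, fun h C hh hC => ?_⟩
  have hC0 : 0 ≤ C := by simpa using (abs_nonneg _).trans (hC 0)
  have hP : ∀ n, IsProbabilityMeasure ((convPow m n).tilted fun x => Real.log (fejerSum x)) :=
    fun n => isProbabilityMeasure_tilted_fejerSum (integrable_fejerSum_of_isFiniteMeasure _)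
  have hP0 : IsProbabilityMeasure ((volume : Measure ℝ).tilted fun x => Real.log (fejerSum x)) :=
    isProbabilityMeasure_tilted_fejerSum integrable_fejerSum
  set P : ℕ → ProbabilityMeasure ℝ := fun n => ⟨_, hP n⟩ with hPdef
  set P0 : ProbabilityMeasure ℝ := ⟨_, hP0⟩ with hP0def
  have hcf : Tendsto P atTop (𝓝 P0) := by
    refine ProbabilityMeasure.tendsto_iff_tendsto_charFun.mpr fun θ => ?_
    simp only [hPdef, hP0def, ProbabilityMeasure.coe_mk, charFun_tilted_fejerSum,
      integral_expTransform_fejerKernel_volume]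
    have h0 := hlim _ (continuous_fejerKernel 0) (hasCompactSupport_fejerKernel 0)
    have h1 := hlim _ (continuous_fejerKernel θ) (hasCompactSupport_fejerKernel θ)
    have hne : (κ : ℂ) * fejerKernel 0 0 ≠ 0 := by
      rw [fejerKernel_zero_zero]
      simp [hκ.ne']
    have h2 := (h0.inv₀ hne).mul h1
    have h3 : ((κ : ℂ) * fejerKernel 0 0)⁻¹ * (κ * fejerKernel θ 0) =
        (2 * Real.pi * fejerKernel 0 0)⁻¹ * (2 * Real.pi * fejerKernel θ 0) := by
      have : (κ : ℂ) ≠ 0 := by simp [hκ.ne']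
      have h2π : (Real.pi : ℂ) ≠ 0 := by simp [Real.pi_ne_zero]
      rw [fejerKernel_zero_zero]
      field_simp
    rw [h3] at h2
    refine h2.congr' ?_
    filter_upwards [eventually_ge_atTop 1] with n hn
    have hs : ((√(n : ℝ) : ℝ) : ℂ) ≠ 0 := by
      have : 0 < √(n : ℝ) := Real.sqrt_pos.mpr (by exact_mod_cast hn)
      simpa using this.ne'
    rw [mul_inv]
    field_simp
  obtain ⟨c, hc, hcg⟩ := exists_le_fejerSum
  have hb : ∀ x, ‖h x / fejerSum x‖ ≤ C / c := fun x => by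
    rw [norm_div, Real.norm_eq_abs, Real.norm_of_nonneg (fejerSum_pos x).le,
      div_le_div_iff₀ (fejerSum_pos x) hc]
    have h1 := mul_le_mul (hC x) (hcg x) hc.le (by positivity)
    have h2 : (1 + x ^ 2)⁻¹ * (1 + x ^ 2) = 1 := inv_mul_cancel₀ (by positivity)
    calc |h x| * c ≤ C * (1 + x ^ 2)⁻¹ * ((1 + x ^ 2) * fejerSum x) := h1
      _ = C * ((1 + x ^ 2)⁻¹ * (1 + x ^ 2)) * fejerSum x := by ring
      _ = C * fejerSum x := by rw [h2, mul_one]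
  have hcont : Continuous fun x => h x / fejerSum x :=
    hh.div continuous_fejerSum fun x => (fejerSum_pos x).ne'
  have hw := ProbabilityMeasure.tendsto_iff_forall_integral_tendsto.mp hcf
    (BoundedContinuousFunction.ofNormedAddCommGroup _ hcont _ hb)
  have hval : ∀ μ : Measure ℝ, ∫ x, h x / fejerSum x ∂(μ.tilted fun x => Real.log (fejerSum x)) =
      (∫ x, fejerSum x ∂μ)⁻¹ * ∫ x, h x ∂μ := fun μ => by
    rw [integral_tilted_fejerSum, smul_eq_mul]
    congr 1
    refine integral_congr_ae (Eventually.of_forall fun x => ?_)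
    exact mul_div_cancel₀ _ (fejerSum_pos x).ne'
  simp only [BoundedContinuousFunction.coe_ofNormedAddCommGroup, hPdef, hP0def,
    ProbabilityMeasure.coe_mk, hval, integral_fejerSum] at hw
  have hZ : Tendsto (fun n : ℕ => √(n : ℝ) * ∫ x, fejerSum x ∂(convPow m n)) atTop
      (𝓝 (κ * 2)) := by
    have h0 := hlim _ (continuous_fejerKernel 0) (hasCompactSupport_fejerKernel 0)
    simp_rw [integral_expTransform_fejerKernel_zero, fejerKernel_zero_zero] at h0
    have := (Complex.continuous_re.tendsto _).comp h0
    simpa [Function.comp_def, ← Complex.ofReal_mul] using this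
  have hfin := hZ.mul hw
  convert! hfin using 2 with n
  · have hpos : 0 < ∫ x, fejerSum x ∂(convPow m n) := by
      refine (integral_pos_iff_support_of_nonneg (fun x => (fejerSum_pos x).le)
        (integrable_fejerSum_of_isFiniteMeasure _)).mpr ?_
      rw [show Function.support fejerSum = univ from
        eq_univ_of_forall fun x => (fejerSum_pos x).ne', measure_univ]
      exact one_pos
    field_simp
  · field_simp
    ring

end LocalLimit

lemma integral_tri_mul_tendsto : Tendsto (fun k : ℕ => ∫ x, tri ((k + 1 : ℝ) * x)) atTop (𝓝 0) := by
  have h : ∀ k : ℕ, ∫ x, tri ((k + 1 : ℝ) * x) = (1 / (k + 1 : ℝ)) * ∫ x, tri x := fun k => by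
    have hk : (0 : ℝ) < k + 1 := by positivity
    rw [Measure.integral_comp_mul_left tri, abs_of_pos (inv_pos.mpr hk), smul_eq_mul, one_div]
  simp_rw [h]
  simpa using tendsto_one_div_add_atTop_nhds_zero_nat.mul_const (∫ x, tri x)

lemma tri_mul_le (k : ℕ) (x : ℝ) : |tri ((k + 1 : ℝ) * x)| ≤ 2 * (1 + x ^ 2)⁻¹ := by
  rw [abs_of_nonneg (tri_nonneg _), ← div_eq_mul_inv, le_div_iff₀ (by positivity)]
  by_cases h : |x| ≤ 1
  · have : x ^ 2 ≤ 1 := by rw [← sq_abs]; nlinarith [abs_nonneg x]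
    nlinarith [tri_le_one ((k + 1 : ℝ) * x), tri_nonneg ((k + 1 : ℝ) * x)]
  · rw [tri_eq_zero, zero_mul]
    · norm_num
    · rw [abs_mul, abs_of_pos (by positivity)]
      nlinarith [not_le.mp h, abs_nonneg x, (Nat.cast_nonneg k : (0 : ℝ) ≤ k)]

lemma abs_setIntegral_sub_le {μ : Measure ℝ} {I : Set ℝ} (hI : MeasurableSet I)
    {f r t : ℝ → ℝ} {C : ℝ} (hfI : Integrable f μ) (hfr : Integrable (fun x => f x * r x) μ)
    (ht : Integrable t μ) (hC : ∀ x, |f x| ≤ C)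
    (h : ∀ x, |I.indicator (fun _ => (1 : ℝ)) x - r x| ≤ t x) :
    |(∫ x in I, f x ∂μ) - ∫ x, f x * r x ∂μ| ≤ C * ∫ x, t x ∂μ := by
  rw [← integral_indicator hI, ← integral_sub (hfI.indicator hI) hfr, ← integral_const_mul]
  refine (abs_integral_le_integral_abs).trans ?_
  refine integral_mono ((hfI.indicator hI).sub hfr).abs (ht.const_mul C) fun x => ?_
  have : I.indicator f x = f x * I.indicator (fun _ => (1 : ℝ)) x := by
    by_cases hx : x ∈ I <;> simp [hx]
  simp only
  rw [this, ← mul_sub, abs_mul]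
  exact mul_le_mul (hC x) (h x) (abs_nonneg _) ((abs_nonneg _).trans (hC x))

lemma integrable_of_le_inv_one_add_sq {h : ℝ → ℝ} {C : ℝ} (hh : Continuous h)
    (hC : ∀ x, |h x| ≤ C * (1 + x ^ 2)⁻¹) : Integrable h :=
  (integrable_one_add_sq_inv.const_mul C).mono' hh.aestronglyMeasurable
    (Eventually.of_forall hC)

lemma inv_one_add_sq_le_one (x : ℝ) : (1 + x ^ 2)⁻¹ ≤ 1 :=
  inv_le_one_of_one_le₀ (by nlinarith [sq_nonneg x])

lemma integrable_of_le_inv_one_add_sq' {h : ℝ → ℝ} {C : ℝ} (hh : Continuous h)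
    (hC : ∀ x, |h x| ≤ C * (1 + x ^ 2)⁻¹) (μ : Measure ℝ) [IsFiniteMeasure μ] :
    Integrable h μ := by
  have hC0 : 0 ≤ C := by simpa using (abs_nonneg _).trans (hC 0)
  refine Integrable.of_bound (C := C) hh.aestronglyMeasurable (Eventually.of_forall fun x => ?_)
  exact (hC x).trans (mul_le_of_le_one_right hC0 (inv_one_add_sq_le_one x))

section LocalLimit

variable {m : Measure ℝ} [IsProbabilityMeasure m]

/-- Local limit theorem for continuous functions restricted to a set which can be approximated
by continuous functions up to a neighbourhood of the origin. -/
lemma CentredWalk.tendsto_sqrt_mul_setIntegral (hm : CentredWalk m) : ∃ κ : ℝ, 0 < κ ∧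
    ∀ (I : Set ℝ), MeasurableSet I → (∀ k : ℕ, ∃ r : ℝ → ℝ, Continuous r ∧ (∀ x, |r x| ≤ 1) ∧
        ∀ x, |I.indicator (fun _ => (1 : ℝ)) x - r x| ≤ tri ((k + 1 : ℝ) * x)) →
      ∀ (f : ℝ → ℝ) (C : ℝ), Continuous f → (∀ x, |f x| ≤ C * (1 + x ^ 2)⁻¹) →
      Tendsto (fun n : ℕ => √(n : ℝ) * ∫ x in I, f x ∂(convPow m n)) atTop
        (𝓝 (κ * ∫ x in I, f x)) := by
  obtain ⟨κ, hκ, hlim⟩ := hm.tendsto_sqrt_mul_integral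
  refine ⟨κ, hκ, fun I hI hr f C hf hfC => ?_⟩
  have hC0 : 0 ≤ C := by simpa using (abs_nonneg _).trans (hfC 0)
  have hfC' : ∀ x, |f x| ≤ C := fun x =>
    (hfC x).trans (mul_le_of_le_one_right hC0 (inv_one_add_sq_le_one x))
  rw [Metric.tendsto_atTop]
  intro ε hε
  set δ := ε / (4 * (C + 1)) with hδ
  have hδ0 : 0 < δ := by positivity
  have h0 : Tendsto (fun k : ℕ => κ * ∫ x, tri ((k + 1 : ℝ) * x)) atTop (𝓝 0) := by
    simpa using integral_tri_mul_tendsto.const_mul κ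
  obtain ⟨k, hk⟩ := (h0.eventually (gt_mem_nhds hδ0)).exists
  obtain ⟨r, hrc, hr1, hrt⟩ := hr k
  have hfr : ∀ x, |f x * r x| ≤ C * (1 + x ^ 2)⁻¹ := fun x => by
    rw [abs_mul]
    exact (mul_le_of_le_one_right (abs_nonneg _) (hr1 x)).trans (hfC x)
  have hfrc : Continuous fun x => f x * r x := hf.mul hrc
  have htc : Continuous fun x : ℝ => tri ((k + 1 : ℝ) * x) := by fun_prop
  have h1 := hlim _ C hfrc hfr
  have h2 := hlim _ 2 htc (tri_mul_le k)
  have e1 := (Metric.tendsto_nhds.mp h1) (ε / 4) (by positivity)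
  have e2 := h2.eventually (gt_mem_nhds hk)
  obtain ⟨N, hN⟩ := (e1.and e2).exists_forall_of_atTop
  refine ⟨N, fun n hn => ?_⟩
  obtain ⟨h3, h4⟩ := hN n hn
  have h5 := abs_setIntegral_sub_le hI (integrable_of_le_inv_one_add_sq' hf hfC (convPow m n))
    (integrable_of_le_inv_one_add_sq' hfrc hfr _)
    (integrable_of_le_inv_one_add_sq' htc (tri_mul_le k) _) hfC' hrt
  have h6 := abs_setIntegral_sub_le hI (integrable_of_le_inv_one_add_sq hf hfC)
    (integrable_of_le_inv_one_add_sq hfrc hfr)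
    (integrable_of_le_inv_one_add_sq htc (tri_mul_le k)) hfC' hrt
  have h7 : |√(n : ℝ) * (∫ x in I, f x ∂(convPow m n)) -
      √(n : ℝ) * ∫ x, f x * r x ∂(convPow m n)| ≤ C * δ := by
    rw [← mul_sub, abs_mul, abs_of_nonneg (Real.sqrt_nonneg _)]
    calc _ ≤ √(n : ℝ) * (C * ∫ x, tri ((k + 1 : ℝ) * x) ∂(convPow m n)) := by gcongr
      _ = C * (√(n : ℝ) * ∫ x, tri ((k + 1 : ℝ) * x) ∂(convPow m n)) := by ring
      _ ≤ C * δ := by gcongr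
  have h8 : |κ * (∫ x in I, f x) - κ * ∫ x, f x * r x| ≤ C * δ := by
    rw [← mul_sub, abs_mul, abs_of_pos hκ]
    calc _ ≤ κ * (C * ∫ x, tri ((k + 1 : ℝ) * x)) := by gcongr
      _ = C * (κ * ∫ x, tri ((k + 1 : ℝ) * x)) := by ring
      _ ≤ C * δ := by gcongr
  have h9 : C * δ ≤ ε / 4 := by
    rw [hδ, mul_div_assoc', div_le_div_iff₀ (by positivity) (by norm_num)]
    nlinarith
  rw [Real.dist_eq] at h3 ⊢
  rw [abs_le] at h7 h8
  rw [abs_lt] at h3 ⊢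
  constructor <;> linarith [h7.1, h7.2, h8.1, h8.2, h3.1, h3.2]

lemma ramp_Ioi_le (k : ℕ) (x : ℝ) :
    |(Ioi (0 : ℝ)).indicator (fun _ => (1 : ℝ)) x - max 0 (min 1 ((k + 1 : ℝ) * x))| ≤
      tri ((k + 1 : ℝ) * x) := by
  have hk : (0 : ℝ) < k + 1 := by positivity
  by_cases hx : 0 < x
  · have h1 : 0 < (k + 1 : ℝ) * x := mul_pos hk hx
    rw [indicator_of_mem (mem_Ioi.mpr hx), max_eq_right (by positivity), tri, abs_of_pos h1]
    rcases le_total 1 ((k + 1 : ℝ) * x) with h | h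
    · rw [min_eq_left h]; simp
    · rw [min_eq_right h, abs_of_nonneg (by linarith)]
      exact le_max_right _ _
  · have h1 : (k + 1 : ℝ) * x ≤ 0 := mul_nonpos_of_nonneg_of_nonpos hk.le (not_lt.mp hx)
    rw [indicator_of_notMem (by simpa using hx), max_eq_left ((min_le_right _ _).trans h1)]
    simpa using tri_nonneg _

lemma exists_ramp_Ioi (k : ℕ) : ∃ r : ℝ → ℝ, Continuous r ∧ (∀ x, |r x| ≤ 1) ∧
    ∀ x, |(Ioi (0 : ℝ)).indicator (fun _ => (1 : ℝ)) x - r x| ≤ tri ((k + 1 : ℝ) * x) := by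
  refine ⟨fun x => max 0 (min 1 ((k + 1 : ℝ) * x)), by fun_prop, fun x => ?_, ramp_Ioi_le k⟩
  rw [abs_of_nonneg (le_max_left _ _)]
  exact max_le zero_le_one (min_le_left _ _)

lemma exists_ramp_Iic (k : ℕ) : ∃ r : ℝ → ℝ, Continuous r ∧ (∀ x, |r x| ≤ 1) ∧
    ∀ x, |(Iic (0 : ℝ)).indicator (fun _ => (1 : ℝ)) x - r x| ≤ tri ((k + 1 : ℝ) * x) := by
  refine ⟨fun x => 1 - max 0 (min 1 ((k + 1 : ℝ) * x)), by fun_prop, fun x => ?_, fun x => ?_⟩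
  · have h1 : max 0 (min 1 ((k + 1 : ℝ) * x)) ≤ 1 := max_le zero_le_one (min_le_left _ _)
    have h2 : 0 ≤ max 0 (min 1 ((k + 1 : ℝ) * x)) := le_max_left _ _
    rw [abs_le]; constructor <;> linarith
  · have h0 : (Iic (0 : ℝ)).indicator (fun _ => (1 : ℝ)) x =
        1 - (Ioi (0 : ℝ)).indicator (fun _ => (1 : ℝ)) x := by
      by_cases hx : 0 < x
      · simp [hx]
      · simp [not_lt.mp hx]
    rw [h0, ← abs_neg]
    convert ramp_Ioi_le k x using 2
    ring

lemma exp_neg_abs_le {α : ℝ} (hα : 0 < α) (x : ℝ) :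
    |Real.exp (-α * |x|)| ≤ (1 + 2 / α ^ 2) * (1 + x ^ 2)⁻¹ := by
  rw [abs_of_pos (Real.exp_pos _), ← div_eq_mul_inv, le_div_iff₀ (by positivity), neg_mul,
    Real.exp_neg, inv_mul_le_iff₀ (Real.exp_pos _)]
  have h1 := Real.quadratic_le_exp_of_nonneg (x := α * |x|) (by positivity)
  have h2 : (α * |x|) ^ 2 = α ^ 2 * x ^ 2 := by rw [mul_pow, sq_abs]
  have h3 : 0 ≤ α * |x| := by positivity
  rw [h2] at h1
  have h4 : 1 + α ^ 2 * x ^ 2 / 2 ≤ Real.exp (α * |x|) := by linarith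
  calc 1 + x ^ 2 ≤ (1 + α ^ 2 * x ^ 2 / 2) * (1 + 2 / α ^ 2) := by
        have : (1 + α ^ 2 * x ^ 2 / 2) * (1 + 2 / α ^ 2) =
          1 + x ^ 2 + α ^ 2 * x ^ 2 / 2 + 2 / α ^ 2 := by field_simp; ring
        rw [this]
        have : 0 ≤ α ^ 2 * x ^ 2 / 2 + 2 / α ^ 2 := by positivity
        linarith
    _ ≤ _ := by gcongr

omit [IsProbabilityMeasure m] in
lemma lap_posPart_toReal (α : ℝ) {n : ℕ} (hn : 1 ≤ n) : (lap (-α) (posPart m n)).toReal =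
    ∫ x in Ioi 0, Real.exp (-α * |x|) ∂(convPow m n) := by
  obtain ⟨k, rfl⟩ : ∃ k, n = k + 1 := ⟨n - 1, by omega⟩
  rw [lap, posPart, ← integral_eq_lintegral_of_nonneg_ae
    (Eventually.of_forall fun x => (Real.exp_pos _).le) (by fun_prop)]
  refine setIntegral_congr_fun measurableSet_Ioi fun x hx => ?_
  rw [abs_of_pos hx]

omit [IsProbabilityMeasure m] in
lemma lap_negPart_toReal (β : ℝ) {n : ℕ} (hn : 1 ≤ n) : (lap β (negPart m n)).toReal =
    ∫ x in Iic 0, Real.exp (-β * |x|) ∂(convPow m n) := by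
  obtain ⟨k, rfl⟩ : ∃ k, n = k + 1 := ⟨n - 1, by omega⟩
  rw [lap, negPart, ← integral_eq_lintegral_of_nonneg_ae
    (Eventually.of_forall fun x => (Real.exp_pos _).le) (by fun_prop)]
  refine setIntegral_congr_fun measurableSet_Iic fun x hx => ?_
  rw [abs_of_nonpos hx]
  ring_nf

lemma integral_exp_neg_abs_pos {α : ℝ} (hα : 0 < α) {I : Set ℝ}
    (hI : volume I ≠ 0) : 0 < ∫ x in I, Real.exp (-α * |x|) := by
  have hc : Continuous fun x : ℝ => Real.exp (-α * |x|) := by fun_prop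
  rw [integral_pos_iff_support_of_nonneg (fun x => (Real.exp_pos _).le)
    (integrable_of_le_inv_one_add_sq hc (exp_neg_abs_le hα)).integrableOn]
  rw [show (Function.support fun x : ℝ => Real.exp (-α * |x|)) = univ from
    eq_univ_of_forall fun x => (Real.exp_pos _).ne', Measure.restrict_apply_univ]
  exact pos_iff_ne_zero.mpr hI

lemma CentredWalk.tendsto_lap_posPart (hm : CentredWalk m) {α : ℝ} (hα : 0 < α) :
    ∃ ρ : ℝ, 0 < ρ ∧
      Tendsto (fun n : ℕ => √(n : ℝ) * (lap (-α) (posPart m n)).toReal) atTop (𝓝 ρ) := by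
  obtain ⟨κ, hκ, h⟩ := hm.tendsto_sqrt_mul_setIntegral
  refine ⟨_, mul_pos hκ (integral_exp_neg_abs_pos hα (I := Ioi 0) (by simp)),
    (h _ measurableSet_Ioi exists_ramp_Ioi _ _ (by fun_prop) (exp_neg_abs_le hα)).congr' ?_⟩
  filter_upwards [eventually_ge_atTop 1] with n hn
  rw [lap_posPart_toReal α hn]

lemma CentredWalk.tendsto_lap_negPart (hm : CentredWalk m) {β : ℝ} (hβ : 0 < β) :
    ∃ ρ : ℝ, 0 < ρ ∧
      Tendsto (fun n : ℕ => √(n : ℝ) * (lap β (negPart m n)).toReal) atTop (𝓝 ρ) := by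
  obtain ⟨κ, hκ, h⟩ := hm.tendsto_sqrt_mul_setIntegral
  refine ⟨_, mul_pos hκ (integral_exp_neg_abs_pos hβ (I := Iic 0) (by simp)),
    (h _ measurableSet_Iic exists_ramp_Iic _ _ (by fun_prop) (exp_neg_abs_le hβ)).congr' ?_⟩
  filter_upwards [eventually_ge_atTop 1] with n hn
  rw [lap_negPart_toReal β hn]

end LocalLimit

section WeightedBounds

variable {m : Measure ℝ} [IsProbabilityMeasure m]

lemma CentredWalk.sqrt_mul_integral_fejer_le (hm : CentredWalk m) : ∃ C : ℝ, 0 ≤ C ∧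
    ∀ (y : ℝ) (n : ℕ), √(n : ℝ) * ∫ x, fejer (x - y) ∂(convPow m n) ≤ C := by
  obtain ⟨C, hC, h⟩ := hm.sqrt_mul_norm_integral_le 1
  refine ⟨C, hC, fun y n => ?_⟩
  have h1 := h (fun s => (tri s : ℂ) * Complex.exp (-(s * y * Complex.I)))
    ((Complex.continuous_ofReal.comp continuous_tri).mul (by fun_prop))
    hasCompactSupport_tri_ofReal.mul_right (fun s => ?_) (fun s hs => ?_) n
  · have h2 : ∀ x, expTransform (fun s => (tri s : ℂ) * Complex.exp (-(s * y * Complex.I))) x =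
        (fejer (x - y) : ℂ) := fun x => by
      rw [expTransform_modulate (fun s => (tri s : ℂ)), expTransform_tri]
    simp_rw [h2, integral_complex_ofReal, Complex.norm_real] at h1
    exact (mul_le_mul_of_nonneg_left (le_abs_self _) (Real.sqrt_nonneg _)).trans h1
  · rw [norm_mul, show -((s : ℂ) * y * Complex.I) = ((-(s * y) : ℝ) : ℂ) * Complex.I by
      push_cast; ring, Complex.norm_exp_ofReal_mul_I, mul_one, Complex.norm_real,
      Real.norm_of_nonneg (tri_nonneg s)]
    exact tri_le_one s
  · rw [tri_eq_zero hs.le]; simp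

lemma integrable_fejer_sub (μ : Measure ℝ) [IsFiniteMeasure μ] (y : ℝ) :
    Integrable (fun x => fejer (x - y)) μ := by
  refine Integrable.of_bound (C := 6) (continuous_fejer.comp
    (continuous_id.sub continuous_const)).aestronglyMeasurable (Eventually.of_forall fun x => ?_)
  rw [Real.norm_of_nonneg (fejer_nonneg _)]
  have := fejer_le (x - y)
  nlinarith [fejer_nonneg (x - y), sq_nonneg (x - y), mul_nonneg (sq_nonneg (x - y)) (fejer_nonneg (x - y))]

/-- Uniform concentration bound for the `n`-fold convolution on unit intervals. -/
lemma CentredWalk.sqrt_mul_convPow_Ico_le (hm : CentredWalk m) : ∃ C : ℝ, 0 ≤ C ∧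
    ∀ (y : ℝ) (n : ℕ), √(n : ℝ) * (convPow m n).real (Ico y (y + 1)) ≤ C := by
  obtain ⟨C, hC, h⟩ := hm.sqrt_mul_integral_fejer_le
  obtain ⟨c, hc, hl⟩ := exists_le_fejerSum
  refine ⟨4 * C / c, by positivity, fun y n => ?_⟩
  have hi : Integrable (fun x => fejer (x - y) + fejer (x - (y + 1))) (convPow m n) :=
    (integrable_fejer_sub _ _).add (integrable_fejer_sub _ _)
  have h1 : c / 2 * (convPow m n).real (Ico y (y + 1)) ≤
      ∫ x, (fejer (x - y) + fejer (x - (y + 1))) ∂(convPow m n) := by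
    rw [mul_comm, ← smul_eq_mul, ← setIntegral_const]
    refine (setIntegral_mono_on (integrable_const _).integrableOn hi.integrableOn
      measurableSet_Ico fun x hx => ?_).trans
      (setIntegral_le_integral hi (Eventually.of_forall fun x =>
        add_nonneg (fejer_nonneg _) (fejer_nonneg _)))
    have h2 := hl (x - y)
    have h3 : fejerSum (x - y) = fejer (x - y) + fejer (x - (y + 1)) := by
      rw [fejerSum, sub_sub]
    rw [← h3]
    have h4 : (x - y) ^ 2 ≤ 1 := by nlinarith [hx.1, hx.2]
    nlinarith [fejerSum_pos (x - y)]
  rw [integral_add (integrable_fejer_sub _ _) (integrable_fejer_sub _ _)] at h1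
  rw [le_div_iff₀ hc]
  have h5 := h y n
  have h6 := h (y + 1) n
  have h7 := mul_le_mul_of_nonneg_left h1 (Real.sqrt_nonneg (n : ℝ))
  nlinarith

lemma one_sub_exp_neg_ge {α : ℝ} (hα : 0 < α) (h1 : α ≤ 1) : α / 2 ≤ 1 - Real.exp (-α) := by
  have h := Real.add_one_le_exp α
  rw [Real.exp_neg]
  have h2 : (Real.exp α)⁻¹ ≤ (1 + α)⁻¹ := inv_anti₀ (by positivity) (by linarith)
  have h3 : (1 + α)⁻¹ ≤ 1 - α / 2 := by
    rw [inv_le_iff_one_le_mul₀ (by positivity)]; nlinarith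
  linarith

lemma CentredWalk.sqrt_mul_lap_posPart_le (hm : CentredWalk m) : ∃ C : ℝ, 1 ≤ C ∧
    ∀ (α : ℝ), 0 < α → α ≤ 1 → ∀ n : ℕ, √(n : ℝ) * (lap (-α) (posPart m n)).toReal ≤ C / α := by
  obtain ⟨C, hC, h⟩ := hm.sqrt_mul_convPow_Ico_le
  refine ⟨2 * C + 1, by linarith, fun α hα hα1 n => ?_⟩
  have hpos : 0 ≤ (2 * C + 1) / α := by positivity
  rcases n with _ | k
  · simpa using hpos
  set D := C / √((k + 1 : ℕ) : ℝ) with hD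
  have hs : 0 < √((k + 1 : ℕ) : ℝ) := by positivity
  have hD0 : 0 ≤ D := by positivity
  have hI : ∀ i : ℕ, convPow m (k + 1) (Ico (i : ℝ) (i + 1)) ≤ ENNReal.ofReal D := fun i => by
    rw [← ENNReal.ofReal_toReal (measure_ne_top (convPow m (k + 1)) _)]
    refine ENNReal.ofReal_le_ofReal ?_
    rw [hD, le_div_iff₀ hs, mul_comm]
    exact h i (k + 1)
  have hsum : Summable fun i : ℕ => Real.exp (-α) ^ i :=
    summable_geometric_of_lt_one (Real.exp_pos _).le (Real.exp_lt_one_iff.mpr (by linarith))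
  have hle : lap (-α) (posPart m (k + 1)) ≤ ENNReal.ofReal ((∑' i : ℕ, Real.exp (-α) ^ i) * D) := by
    have hsub : Ioi (0 : ℝ) ⊆ ⋃ i : ℕ, Ico (i : ℝ) (i + 1) := fun x hx =>
      mem_iUnion.mpr ⟨⌊x⌋₊, Nat.floor_le (le_of_lt hx), Nat.lt_floor_add_one x⟩
    calc lap (-α) (posPart m (k + 1))
        = ∫⁻ x in Ioi 0, ENNReal.ofReal (Real.exp (-α * x)) ∂(convPow m (k + 1)) := rfl
      _ ≤ ∫⁻ x in ⋃ i : ℕ, Ico (i : ℝ) (i + 1), ENNReal.ofReal (Real.exp (-α * x))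
          ∂(convPow m (k + 1)) := lintegral_mono_set hsub
      _ ≤ ∑' i : ℕ, ∫⁻ x in Ico (i : ℝ) (i + 1), ENNReal.ofReal (Real.exp (-α * x))
          ∂(convPow m (k + 1)) := lintegral_iUnion_le _ _
      _ ≤ ∑' i : ℕ, ENNReal.ofReal (Real.exp (-α) ^ i) * ENNReal.ofReal D := by
          refine ENNReal.tsum_le_tsum fun i => ?_
          refine (setLIntegral_mono (g := fun _ => ENNReal.ofReal (Real.exp (-α) ^ i))
            measurable_const fun x hx => ?_).trans ?_
          · refine ENNReal.ofReal_le_ofReal ?_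
            rw [← Real.exp_nat_mul]
            exact Real.exp_le_exp.mpr (by nlinarith [hx.1])
          · rw [setLIntegral_const]
            gcongr
            exact hI i
      _ = _ := by
          rw [ENNReal.tsum_mul_right, ← ENNReal.ofReal_tsum_of_nonneg
            (fun i => by positivity) hsum, ← ENNReal.ofReal_mul (tsum_nonneg fun i => by positivity)]
  have h2 := ENNReal.toReal_mono ENNReal.ofReal_ne_top hle
  have hgeo := tsum_geometric_of_lt_one (Real.exp_pos (-α)).le (Real.exp_lt_one_iff.mpr (by linarith))
  have h3 := one_sub_exp_neg_ge hα hα1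
  rw [ENNReal.toReal_ofReal (mul_nonneg (tsum_nonneg fun i => by positivity) hD0), hgeo] at h2
  have h4 : (1 - Real.exp (-α))⁻¹ ≤ 2 / α := by
    rw [inv_le_comm₀ (by linarith [half_pos hα]) (by positivity), inv_div]
    exact h3
  calc √((k + 1 : ℕ) : ℝ) * (lap (-α) (posPart m (k + 1))).toReal
      ≤ √((k + 1 : ℕ) : ℝ) * (2 / α * D) := by
        gcongr
        exact h2.trans (by gcongr)
    _ = 2 * C / α := by rw [hD]; field_simp
    _ ≤ _ := by gcongr; linarith

lemma CentredWalk.integrable_id (hm : CentredWalk m) : Integrable (fun x : ℝ => x) m := by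
  refine ((integrable_const (1 : ℝ)).add hm.sq).mono' (by fun_prop)
    (Eventually.of_forall fun x => ?_)
  simp only [Pi.add_apply, Real.norm_eq_abs]
  nlinarith [sq_abs x, sq_nonneg (|x| - 1), abs_nonneg x]

omit [IsProbabilityMeasure m] in
lemma sq_ae_zero_of_centred (hm : CentredWalk m) (h : ∀ᵐ x ∂m, x = 0) : False := by
  have : ∫ x, x ^ 2 ∂m = ∫ _, (0 : ℝ) ∂m :=
    integral_congr_ae (h.mono fun x hx => by simp [hx])
  have h2 := hm.var
  simp [this] at h2

lemma CentredWalk.measure_Ioi_pos (hm : CentredWalk m) : 0 < m (Ioi 0) := by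
  rw [pos_iff_ne_zero]
  intro h
  have h1 : ∀ᵐ x ∂m, x ≤ 0 := by
    rw [ae_iff]; simpa [Ioi] using h
  have h2 : 0 ≤ᵐ[m] fun x => -x := h1.mono fun x hx => by simpa using hx
  have h3 := (integral_eq_zero_iff_of_nonneg_ae h2 hm.integrable_id.neg).mp
    (by rw [integral_neg, hm.mean, neg_zero])
  exact sq_ae_zero_of_centred hm (h3.mono fun x hx => by simpa using hx)

lemma CentredWalk.measure_Iio_pos (hm : CentredWalk m) : 0 < m (Iio 0) := by
  rw [pos_iff_ne_zero]
  intro h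
  have h1 : ∀ᵐ x ∂m, 0 ≤ x := by
    rw [ae_iff]; simpa [Iio] using h
  have h3 := (integral_eq_zero_iff_of_nonneg_ae (f := fun x : ℝ => x) h1 hm.integrable_id).mp
    hm.mean
  exact sq_ae_zero_of_centred hm (h3.mono fun x hx => by simpa using hx)

/-- Laplace weights of the law of the walk conditioned to reach a new maximum at time `n`. -/
def posLap (m : Measure ℝ) (α : ℝ) (n : ℕ) : ℝ := (lap (-α) (posLaw m n)).toReal

/-- Laplace weights of the law of the walk conditioned to stay nonpositive up to time `n`. -/
def negLap (m : Measure ℝ) (β : ℝ) (n : ℕ) : ℝ := (lap β (negLaw m n)).toReal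

omit [IsProbabilityMeasure m] in
lemma posLap_nonneg (α : ℝ) (n : ℕ) : 0 ≤ posLap m α n := ENNReal.toReal_nonneg

omit [IsProbabilityMeasure m] in
lemma negLap_nonneg (β : ℝ) (n : ℕ) : 0 ≤ negLap m β n := ENNReal.toReal_nonneg

omit [IsProbabilityMeasure m] in
lemma posLap_zero (α : ℝ) : posLap m α 0 = 1 := by simp [posLap, posLaw, lap_dirac_zero]

omit [IsProbabilityMeasure m] in
lemma negLap_zero (β : ℝ) : negLap m β 0 = 1 := by simp [negLap, negLaw, lap_dirac_zero]

lemma toReal_le_one {x : ENNReal} (h : x ≤ 1) : x.toReal ≤ 1 := by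
  simpa using ENNReal.toReal_mono ENNReal.one_ne_top h

lemma CentredWalk.wt_mul_posLap_le (hm : CentredWalk m) : ∃ C : ℝ, 0 ≤ C ∧
    ∀ α : ℝ, 0 < α → α ≤ 1 → ∀ n, wt n * posLap m α n ≤ C / α ^ 2 := by
  obtain ⟨C, hC, h⟩ := hm.sqrt_mul_lap_posPart_le
  obtain ⟨κ, hκ, hU⟩ := sum_lap_posLaw_le m hm.measure_Ioi_pos
  refine ⟨24 * (C / κ), by positivity, fun α hα hα1 n => ?_⟩
  refine (renewal_wt_bound (a := posLap m α) (posLap_nonneg α)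
    (fun k => toReal_le_one (lap_posPart_le m k hα.le)) (fun k _ => h α hα hα1 k) ?_
    (hU α hα hα1) (lap_posLaw_renewal m hα.le) n).trans_eq (by field_simp)
  rw [le_div_iff₀ hα]; linarith

lemma posLap_anti {α γ : ℝ} (hγ : 0 ≤ γ) (h : γ ≤ α) (n : ℕ) : posLap m α n ≤ posLap m γ n := by
  refine ENNReal.toReal_mono (ne_top_of_le_ne_top ENNReal.one_ne_top (lap_posLaw_le m n hγ)) ?_
  refine lintegral_mono_ae ((ae_posLaw m n).mono fun x hx => ENNReal.ofReal_le_ofReal ?_)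
  exact Real.exp_le_exp.mpr (by nlinarith)

lemma CentredWalk.tendsto_posLap (hm : CentredWalk m) {α : ℝ} (hα : 0 < α) :
    ∃ l : ℝ, 0 < l ∧ Tendsto (fun n => wt n * posLap m α n) atTop (𝓝 l) := by
  obtain ⟨κ, hκ, hU⟩ := sum_lap_posLaw_le m hm.measure_Ioi_pos
  have hγ : 0 < min α 1 := lt_min hα one_pos
  have hU' : ∀ N, ∑ k ∈ Finset.range N, posLap m α k ≤ 1 / (κ * min α 1) := fun N =>
    (Finset.sum_le_sum fun k _ => posLap_anti hγ.le (min_le_left _ _) k).trans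
      (hU _ hγ (min_le_right _ _) N)
  obtain ⟨ρ, hρ, hlim⟩ := hm.tendsto_lap_posPart hα
  obtain ⟨P, hP⟩ := hlim.bddAbove_range
  have h : ∀ k : ℕ, 1 ≤ k → √(k : ℝ) * (lap (-α) (posPart m k)).toReal ≤ max 1 P :=
    fun k _ => (hP ⟨k, rfl⟩).trans (le_max_right _ _)
  have h1 := renewal_wt_bound (a := posLap m α) (posLap_nonneg α)
    (fun k => toReal_le_one (lap_posPart_le m k hα.le)) h (le_max_left _ _)
    hU' (lap_posLaw_renewal m hα.le)
  refine ⟨ρ * ∑' j, posLap m α j, mul_pos hρ ?_, renewal_tendsto (a := posLap m α)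
    (posLap_nonneg α) (fun k => ENNReal.toReal_nonneg)
    (fun k => toReal_le_one (lap_posPart_le m k hα.le)) h (le_max_left _ _)
    hU' (lap_posLaw_renewal m hα.le) hlim⟩
  exact (summable_of_wt_mul_le (posLap_nonneg α) h1).tsum_pos (posLap_nonneg α) 0
    (by rw [posLap_zero]; exact one_pos)

lemma CentredWalk.negLap_asymptotics (hm : CentredWalk m) {β : ℝ} (hβ : 0 < β) :
    (∃ C : ℝ, 0 ≤ C ∧ ∀ n, wt n * negLap m β n ≤ C) ∧
    ∃ l : ℝ, 0 < l ∧ Tendsto (fun n => wt n * negLap m β n) atTop (𝓝 l) := by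
  obtain ⟨U, hU⟩ := sum_lap_negLaw_le m hm.measure_Iio_pos hβ
  obtain ⟨ρ, hρ, hlim⟩ := hm.tendsto_lap_negPart hβ
  obtain ⟨P, hP⟩ := hlim.bddAbove_range
  have h : ∀ k : ℕ, 1 ≤ k → √(k : ℝ) * (lap β (negPart m k)).toReal ≤ max 1 P :=
    fun k _ => (hP ⟨k, rfl⟩).trans (le_max_right _ _)
  have h1 := renewal_wt_bound (a := negLap m β) (negLap_nonneg β)
    (fun k => toReal_le_one (lap_negPart_le m k hβ.le)) h (le_max_left _ _)
    hU (lap_negLaw_renewal m hβ.le)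
  refine ⟨⟨24 * (max 1 P * U), (mul_nonneg (wt_pos 0).le (negLap_nonneg β 0)).trans (h1 0), h1⟩,
    ρ * ∑' j, negLap m β j, mul_pos hρ ?_, renewal_tendsto (a := negLap m β)
    (negLap_nonneg β) (fun k => ENNReal.toReal_nonneg)
    (fun k => toReal_le_one (lap_negPart_le m k hβ.le)) h (le_max_left _ _)
    hU (lap_negLaw_renewal m hβ.le) hlim⟩
  exact (summable_of_wt_mul_le (negLap_nonneg β) h1).tsum_pos (negLap_nonneg β) 0
    (by rw [negLap_zero]; exact one_pos)

end WeightedBounds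

/-- The sum over the middle range of a convolution of two summable weights is negligible. -/
lemma sum_middle_le (j : ℕ) (n : ℕ) (hn : 2 * j ≤ n) :
    ∑ i ∈ Finset.Ico j (n - j), (wt i)⁻¹ * (wt (n - i))⁻¹ ≤
      6 * (∑' i, (wt (i + j))⁻¹) / wt n := by
  have hs : Summable fun i => (wt (i + j))⁻¹ := (summable_nat_add_iff j).mpr summable_inv_wt
  have hp : ∀ i, 0 ≤ (wt i)⁻¹ := fun i => (inv_pos.mpr (wt_pos i)).le
  have h1 : ∑ i ∈ Finset.Ico j (n - j), (wt i)⁻¹ ≤ ∑' i, (wt (i + j))⁻¹ := by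
    rw [Finset.sum_Ico_eq_sum_range]
    simp_rw [add_comm j]
    exact hs.sum_le_tsum _ fun i _ => hp _
  have h2 : ∑ i ∈ Finset.Ico j (n - j), (wt (n - i))⁻¹ ≤ ∑' i, (wt (i + j))⁻¹ := by
    rw [Finset.sum_Ico_eq_sum_range, ← Finset.sum_range_reflect]
    refine (Finset.sum_le_sum fun i hi => ?_).trans
      (hs.sum_le_tsum (Finset.range (n - j - j)) fun i _ => hp _)
    rw [Finset.mem_range] at hi
    refine inv_anti₀ (wt_pos _) (wt_mono ?_)
    omega
  calc _ ≤ ∑ i ∈ Finset.Ico j (n - j), 3 * (wt n)⁻¹ * ((wt i)⁻¹ + (wt (n - i))⁻¹) :=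
        Finset.sum_le_sum fun i hi => inv_wt_mul_inv_wt_le (by
          rw [Finset.mem_Ico] at hi; omega)
    _ ≤ 3 * (wt n)⁻¹ * (∑' i, (wt (i + j))⁻¹ + ∑' i, (wt (i + j))⁻¹) := by
        rw [← Finset.mul_sum, Finset.sum_add_distrib]
        have := hp n
        gcongr
    _ = _ := by rw [div_eq_mul_inv]; ring

lemma tendsto_tail_wt : Tendsto (fun j => ∑' i, (wt (i + j))⁻¹) atTop (𝓝 0) :=
  tendsto_sum_nat_add fun i => (wt i)⁻¹

/-! ### The law of the walk together with its maximum and the weighted sum -/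

/-- Prepending the increment `ξ = (x, η)` to a path with endpoint `S`, maximum `M ≥ 0` and
weighted sum `b = ∑ η_{i+1} e^{S_i}`, encoded as `(S, M, b)`. -/
def stepFun (ξ : ℝ × ℝ) (u : ℝ × ℝ × ℝ) : ℝ × ℝ × ℝ :=
  (ξ.1 + u.1, max 0 (ξ.1 + u.2.1), ξ.2 + Real.exp ξ.1 * u.2.2)

/-- Concatenation of paths at the level of the triples `(S, M, b)`. -/
def joinFun (u v : ℝ × ℝ × ℝ) : ℝ × ℝ × ℝ :=
  (u.1 + v.1, max u.2.1 (u.1 + v.2.1), u.2.2 + Real.exp u.1 * v.2.2)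

/-- Law of `(S_n, max (S_0, …, S_n), ∑_{i<n} η_{i+1} e^{S_i})` when the pairs
`(S_{i+1} - S_i, η_{i+1})` are independent with law `ν`. -/
def pathLaw (ν : Measure (ℝ × ℝ)) : ℕ → Measure (ℝ × ℝ × ℝ)
  | 0 => Measure.dirac (0, 0, 0)
  | n + 1 => (ν.prod (pathLaw ν n)).map fun p => stepFun p.1 p.2

@[fun_prop]
lemma measurable_stepFun : Measurable fun p : (ℝ × ℝ) × ℝ × ℝ × ℝ => stepFun p.1 p.2 := by
  unfold stepFun; fun_prop

@[fun_prop]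
lemma continuous_joinFun :
    Continuous fun p : (ℝ × ℝ × ℝ) × ℝ × ℝ × ℝ => joinFun p.1 p.2 := by
  unfold joinFun; fun_prop

@[fun_prop]
lemma measurable_joinFun : Measurable fun p : (ℝ × ℝ × ℝ) × ℝ × ℝ × ℝ => joinFun p.1 p.2 :=
  continuous_joinFun.measurable

lemma measurable_joinFun_comp {α : Type*} [MeasurableSpace α] {f g : α → ℝ × ℝ × ℝ}
    (hf : Measurable f) (hg : Measurable g) : Measurable fun a => joinFun (f a) (g a) :=
  measurable_joinFun.comp (hf.prodMk hg)

lemma joinFun_assoc (u v w : ℝ × ℝ × ℝ) :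
    joinFun (joinFun u v) w = joinFun u (joinFun v w) := by
  simp only [joinFun, Prod.mk.injEq]
  refine ⟨by ring, ?_, by rw [Real.exp_add]; ring⟩
  rw [max_assoc, ← max_add_add_left, add_assoc]

lemma stepFun_joinFun (ξ : ℝ × ℝ) (u v : ℝ × ℝ × ℝ) :
    stepFun ξ (joinFun u v) = joinFun (stepFun ξ u) v := by
  simp only [joinFun, stepFun, Prod.mk.injEq]
  refine ⟨by ring, ?_, by rw [Real.exp_add]; ring⟩
  rw [max_assoc, ← max_add_add_left, add_assoc]

lemma zero_joinFun {v : ℝ × ℝ × ℝ} (hv : 0 ≤ v.2.1) : joinFun (0, 0, 0) v = v := by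
  simp [joinFun, hv]

section PathLaw

variable {ν : Measure (ℝ × ℝ)} [IsProbabilityMeasure ν]

instance isProbabilityMeasure_pathLaw (n : ℕ) : IsProbabilityMeasure (pathLaw ν n) := by
  induction n with
  | zero => unfold pathLaw; infer_instance
  | succ n ih =>
    unfold pathLaw
    exact Measure.isProbabilityMeasure_map measurable_stepFun.aemeasurable

lemma lintegral_pathLaw_zero (ν : Measure (ℝ × ℝ)) (f : ℝ × ℝ × ℝ → ENNReal) :
    ∫⁻ u, f u ∂(pathLaw ν 0) = f (0, 0, 0) := by
  rw [pathLaw, lintegral_dirac]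

lemma lintegral_pathLaw_succ (n : ℕ) {f : ℝ × ℝ × ℝ → ENNReal} (hf : Measurable f) :
    ∫⁻ u, f u ∂(pathLaw ν (n + 1)) = ∫⁻ ξ, ∫⁻ u, f (stepFun ξ u) ∂(pathLaw ν n) ∂ν := by
  rw [pathLaw, lintegral_map hf measurable_stepFun, lintegral_prod _ (by fun_prop)]

lemma ae_pathLaw_succ {n : ℕ} {p : ℝ × ℝ × ℝ → Prop} (hp : MeasurableSet {u | p u})
    (h : ∀ᵐ ξ ∂ν, ∀ᵐ u ∂(pathLaw ν n), p (stepFun ξ u)) : ∀ᵐ u ∂(pathLaw ν (n + 1)), p u := by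
  rw [pathLaw, ae_map_iff measurable_stepFun.aemeasurable hp]
  rw [Measure.ae_prod_iff_ae_ae]
  · exact h
  · exact measurable_stepFun hp

lemma ae_pathLaw_max (n : ℕ) : ∀ᵐ u ∂(pathLaw ν n), 0 ≤ u.2.1 ∧ u.1 ≤ u.2.1 := by
  have hm : MeasurableSet {u : ℝ × ℝ × ℝ | 0 ≤ u.2.1 ∧ u.1 ≤ u.2.1} :=
    MeasurableSet.inter (s₁ := {u : ℝ × ℝ × ℝ | 0 ≤ u.2.1}) (s₂ := {u : ℝ × ℝ × ℝ | u.1 ≤ u.2.1})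
      (measurableSet_le (by fun_prop) (by fun_prop)) (measurableSet_le (by fun_prop) (by fun_prop))
  induction n with
  | zero => simp [pathLaw]
  | succ n ih =>
    refine ae_pathLaw_succ hm (Eventually.of_forall fun ξ => ?_)
    filter_upwards [ih] with u hu
    exact ⟨le_max_left _ _, le_max_of_le_right (by simpa [stepFun] using hu.2)⟩

lemma lintegral_pathLaw_add (i n : ℕ) {f : ℝ × ℝ × ℝ → ENNReal} (hf : Measurable f) :
    ∫⁻ u, f u ∂(pathLaw ν (i + n)) =
      ∫⁻ u, ∫⁻ v, f (joinFun u v) ∂(pathLaw ν n) ∂(pathLaw ν i) := by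
  induction i generalizing f with
  | zero =>
    rw [lintegral_pathLaw_zero, zero_add]
    refine lintegral_congr_ae ((ae_pathLaw_max n).mono fun v hv => ?_)
    simp only
    rw [zero_joinFun hv.1]
  | succ i ih =>
    have hg : Measurable fun u => ∫⁻ v, f (joinFun u v) ∂(pathLaw ν n) :=
      Measurable.lintegral_prod_right' (f := fun p : (ℝ × ℝ × ℝ) × ℝ × ℝ × ℝ =>
        f (joinFun p.1 p.2)) (by fun_prop)
    rw [lintegral_pathLaw_succ i hg, show i + 1 + n = i + n + 1 by ring,
      lintegral_pathLaw_succ _ hf]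
    refine lintegral_congr fun ξ => ?_
    have hξ : Measurable (stepFun ξ) := measurable_stepFun.comp measurable_prodMk_left
    rw [ih (f := fun u => f (stepFun ξ u)) (hf.comp hξ)]
    simp_rw [stepFun_joinFun]

instance : IsProbabilityMeasure (ν.map Prod.fst) :=
  Measure.isProbabilityMeasure_map measurable_fst.aemeasurable

/-- Decomposition of the joint law of the endpoint and the maximum at the time of the maximum. -/
lemma lintegral_pathLaw_max (n : ℕ) {f : ℝ × ℝ → ENNReal} (hf : Measurable f) :
    ∫⁻ u, f (u.1, u.2.1) ∂(pathLaw ν n) =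
      ∑ p ∈ Finset.HasAntidiagonal.antidiagonal n, ∫⁻ a, ∫⁻ b, f (a + b, a)
        ∂(negLaw (ν.map Prod.fst) p.2) ∂(posLaw (ν.map Prod.fst) p.1) := by
  set m := ν.map Prod.fst with hm
  induction n generalizing f with
  | zero =>
    rw [lintegral_pathLaw_zero]
    simp [posLaw, negLaw]
  | succ n ih =>
    set K : ℕ → ℝ → ENNReal := fun j y => ∫⁻ b, f (y + b, max 0 y) ∂(negLaw m j) with hK
    have hKm : ∀ j, Measurable (K j) := fun j =>
      Measurable.lintegral_prod_right' (f := fun p : ℝ × ℝ => f (p.1 + p.2, max 0 p.1))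
        (by fun_prop)
    have hinner : ∀ p : ℕ × ℕ, Measurable fun x : ℝ =>
        ∫⁻ a, ∫⁻ b, f (x + (a + b), max 0 (x + a)) ∂(negLaw m p.2) ∂(posLaw m p.1) := fun p => by
      have h1 : Measurable fun q : ℝ × ℝ =>
          ∫⁻ b, f (q.1 + (q.2 + b), max 0 (q.1 + q.2)) ∂(negLaw m p.2) :=
        Measurable.lintegral_prod_right' (f := fun r : (ℝ × ℝ) × ℝ =>
          f (r.1.1 + (r.1.2 + r.2), max 0 (r.1.1 + r.1.2))) (by fun_prop)
      exact Measurable.lintegral_prod_right' h1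
    have hterm : ∀ p : ℕ × ℕ, ∫⁻ x, ∫⁻ a, ∫⁻ b, f (x + (a + b), max 0 (x + a))
          ∂(negLaw m p.2) ∂(posLaw m p.1) ∂m =
        (∫⁻ a, ∫⁻ b, f (a + b, a) ∂(negLaw m p.2) ∂(posLaw m (p.1 + 1))) +
          ∫⁻ z, f (z, 0) ∂(negEntrance m (p.1 + 1) ∗ negLaw m p.2) := fun p => by
      have h1 : ∫⁻ x, ∫⁻ a, ∫⁻ b, f (x + (a + b), max 0 (x + a))
          ∂(negLaw m p.2) ∂(posLaw m p.1) ∂m = ∫⁻ y, K p.2 y ∂(m ∗ posLaw m p.1) := by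
        rw [Measure.lintegral_conv (hKm _)]
        simp only [hK, add_assoc]
      rw [h1, ← posLaw_add_negEntrance, lintegral_add_measure]
      congr 1
      · refine lintegral_congr_ae ((ae_posLaw_succ m p.1).mono fun y hy => ?_)
        simp only [hK]
        rw [max_eq_right hy.le]
      · rw [Measure.lintegral_conv (by fun_prop)]
        refine lintegral_congr_ae ((ae_negEntrance m _).mono fun y hy => ?_)
        simp only [hK]
        rw [max_eq_left hy]
    rw [lintegral_pathLaw_succ n (f := fun u => f (u.1, u.2.1)) (by fun_prop)]
    have hstep : ∀ ξ : ℝ × ℝ, ∫⁻ u, f ((stepFun ξ u).1, (stepFun ξ u).2.1) ∂(pathLaw ν n) =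
        ∑ p ∈ Finset.HasAntidiagonal.antidiagonal n, ∫⁻ a, ∫⁻ b,
          f (ξ.1 + (a + b), max 0 (ξ.1 + a)) ∂(negLaw m p.2) ∂(posLaw m p.1) := fun ξ =>
      ih (f := fun q : ℝ × ℝ => f (ξ.1 + q.1, max 0 (ξ.1 + q.2))) (by fun_prop)
    simp_rw [hstep]
    have hinner' : ∀ p : ℕ × ℕ, Measurable fun ξ : ℝ × ℝ => ∫⁻ a, ∫⁻ b,
        f (ξ.1 + (a + b), max 0 (ξ.1 + a)) ∂(negLaw m p.2) ∂(posLaw m p.1) := fun p =>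
      (hinner p).comp measurable_fst
    rw [lintegral_finsetSum _ fun p _ => hinner' p, Finset.Nat.sum_antidiagonal_succ]
    have hmap : ∀ p : ℕ × ℕ, ∫⁻ ξ, ∫⁻ a, ∫⁻ b, f (ξ.1 + (a + b), max 0 (ξ.1 + a))
        ∂(negLaw m p.2) ∂(posLaw m p.1) ∂ν = ∫⁻ x, ∫⁻ a, ∫⁻ b, f (x + (a + b), max 0 (x + a))
          ∂(negLaw m p.2) ∂(posLaw m p.1) ∂m := fun p => by
      rw [hm, lintegral_map (hinner p) measurable_fst]
    simp_rw [hmap, hterm]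
    rw [Finset.sum_add_distrib, add_comm]
    congr 1
    have hB := (wienerHopf_succ m n).2
    rw [convSeq, Finset.Nat.sum_antidiagonal_succ] at hB
    have h0 : negEntrance m 0 ∗ negLaw m (n + 1) = 0 := by
      simp [negEntrance]
    rw [h0, zero_add] at hB
    rw [posLaw, lintegral_dirac]
    simp only [zero_add]
    rw [hB, lintegral_finsetSum_measure]

end PathLaw

/-- Exponential weight in the maximum `M` and the distance `M - S` of the endpoint to it. -/
def decay (α β : ℝ) (u : ℝ × ℝ × ℝ) : ℝ := Real.exp (-α * u.2.1 - β * (u.2.1 - u.1))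

@[fun_prop]
lemma continuous_decay (α β : ℝ) : Continuous (decay α β) := by unfold decay; fun_prop

@[fun_prop]
lemma measurable_decay (α β : ℝ) : Measurable (decay α β) := (continuous_decay α β).measurable

lemma decay_pos (α β : ℝ) (u : ℝ × ℝ × ℝ) : 0 < decay α β u := Real.exp_pos _

section Decay

variable {ν : Measure (ℝ × ℝ)} [IsProbabilityMeasure ν]

lemma integrable_of_le_decay {α β C : ℝ} (hα : 0 ≤ α) (hβ : 0 ≤ β) {f : ℝ × ℝ × ℝ → ℝ} (n : ℕ)
    (hf : Measurable f) (h : ∀ᵐ u ∂(pathLaw ν n), |f u| ≤ C * decay α β u) :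
    Integrable f (pathLaw ν n) := by
  refine Integrable.of_bound (C := |C|) hf.aestronglyMeasurable ?_
  filter_upwards [h, ae_pathLaw_max n] with u hu h1
  have h2 : decay α β u ≤ 1 := by
    refine Real.exp_le_one_iff.mpr ?_
    nlinarith [mul_nonneg hα h1.1, mul_nonneg hβ (sub_nonneg.mpr h1.2)]
  calc ‖f u‖ ≤ C * decay α β u := hu
    _ ≤ |C| * decay α β u := by gcongr; exacts [(decay_pos _ _ _).le, le_abs_self C]
    _ ≤ |C| := mul_le_of_le_one_right (abs_nonneg C) h2

lemma integrable_decay {α β : ℝ} (hα : 0 ≤ α) (hβ : 0 ≤ β) (n : ℕ) :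
    Integrable (decay α β) (pathLaw ν n) :=
  integrable_of_le_decay (C := 1) hα hβ n (by fun_prop) (Eventually.of_forall fun u => by
    rw [abs_of_pos (decay_pos _ _ _), one_mul])

lemma integral_decay {α β : ℝ} (hα : 0 ≤ α) (hβ : 0 ≤ β) (n : ℕ) :
    ∫ u, decay α β u ∂(pathLaw ν n) = ∑ k ∈ Finset.range (n + 1),
      posLap (ν.map Prod.fst) α k * negLap (ν.map Prod.fst) β (n - k) := by
  set m := ν.map Prod.fst
  have h1 := lintegral_pathLaw_max (ν := ν) n
    (f := fun p : ℝ × ℝ => ENNReal.ofReal (Real.exp (-α * p.2 - β * (p.2 - p.1)))) (by fun_prop)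
  have h2 : ∀ p : ℕ × ℕ, ∫⁻ a, ∫⁻ b,
      ENNReal.ofReal (Real.exp (-α * a - β * (a - (a + b)))) ∂(negLaw m p.2) ∂(posLaw m p.1) =
      lap (-α) (posLaw m p.1) * lap β (negLaw m p.2) := fun p => by
    have h3 : ∀ a b : ℝ, ENNReal.ofReal (Real.exp (-α * a - β * (a - (a + b)))) =
        ENNReal.ofReal (Real.exp (-α * a)) * ENNReal.ofReal (Real.exp (β * b)) := fun a b => by
      rw [← ENNReal.ofReal_mul (Real.exp_pos _).le, ← Real.exp_add]
      ring_nf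
    simp_rw [h3]
    unfold lap
    rw [← lintegral_mul_const _ (by fun_prop)]
    exact lintegral_congr fun a => lintegral_const_mul _ (by fun_prop)
  rw [integral_eq_lintegral_of_nonneg_ae (Eventually.of_forall fun u => (decay_pos _ _ _).le)
    (by fun_prop)]
  unfold decay
  rw [h1, Finset.sum_congr rfl fun p _ => h2 p, ENNReal.toReal_sum fun p _ =>
    ENNReal.mul_ne_top (ne_top_of_le_ne_top ENNReal.one_ne_top (lap_posLaw_le m _ hα))
      (ne_top_of_le_ne_top ENNReal.one_ne_top (lap_negLaw_le m _ hβ)),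
    Finset.Nat.sum_antidiagonal_eq_sum_range_succ_mk]
  simp only [ENNReal.toReal_mul]
  rfl

lemma wt_mul_integral_decay_le (hm : CentredWalk (ν.map Prod.fst)) {β : ℝ} (hβ : 0 < β) :
    ∃ C : ℝ, 0 ≤ C ∧ ∀ α : ℝ, 0 < α → α ≤ 1 → ∀ n,
      wt n * ∫ u, decay α β u ∂(pathLaw ν n) ≤ C / α ^ 2 := by
  obtain ⟨A, hA, hA'⟩ := hm.wt_mul_posLap_le
  obtain ⟨⟨B, hB, hB'⟩, -⟩ := hm.negLap_asymptotics hβ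
  refine ⟨6 * (∑' j, (wt j)⁻¹) * (A * B),
    mul_nonneg (mul_nonneg (by norm_num) (tsum_nonneg fun j => (inv_pos.mpr (wt_pos j)).le))
      (mul_nonneg hA hB), fun α hα hα1 n => ?_⟩
  rw [integral_decay hα.le hβ.le]
  refine (conv_le (posLap_nonneg α) (negLap_nonneg β) (hA' α hα hα1) hB' n).trans_eq ?_
  ring

lemma tendsto_wt_mul_integral_decay (hm : CentredWalk (ν.map Prod.fst)) {α β : ℝ} (hα : 0 < α)
    (hβ : 0 < β) : ∃ l : ℝ,
      Tendsto (fun n => wt n * ∫ u, decay α β u ∂(pathLaw ν n)) atTop (𝓝 l) := by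
  obtain ⟨a, -, ha⟩ := hm.tendsto_posLap hα
  obtain ⟨-, b, -, hb⟩ := hm.negLap_asymptotics hβ
  simp_rw [integral_decay hα.le hβ.le]
  exact ⟨_, conv_tendsto (posLap_nonneg α) (negLap_nonneg β) ha hb⟩

lemma exists_le_wt_mul_integral_decay (hm : CentredWalk (ν.map Prod.fst)) {α β : ℝ} (hα : 0 < α)
    (hβ : 0 < β) : ∃ c : ℝ, 0 < c ∧
      ∀ᶠ n in atTop, c ≤ wt n * ∫ u, decay α β u ∂(pathLaw ν n) := by
  obtain ⟨-, b, hb0, hb⟩ := hm.negLap_asymptotics hβ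
  refine ⟨b / 2, by positivity, ?_⟩
  filter_upwards [hb.eventually (lt_mem_nhds (half_lt_self hb0))] with n hn
  rw [integral_decay hα.le hβ.le]
  refine hn.le.trans (mul_le_mul_of_nonneg_left ?_ (wt_pos n).le)
  refine le_trans ?_ (Finset.single_le_sum (fun k _ => mul_nonneg (posLap_nonneg α k)
    (negLap_nonneg β (n - k))) (Finset.mem_range.mpr n.succ_pos))
  rw [posLap_zero, one_mul, Nat.sub_zero]

end Decay

/-- A real sequence that is eventually uniformly approximated by convergent ones converges. -/
lemma exists_tendsto_of_approx {a : ℕ → ℝ}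
    (h : ∀ ε : ℝ, 0 < ε → ∃ (b : ℕ → ℝ) (l : ℝ), Tendsto b atTop (𝓝 l) ∧
      ∀ᶠ n in atTop, |a n - b n| ≤ ε) : ∃ l, Tendsto a atTop (𝓝 l) := by
  refine cauchySeq_tendsto_of_complete (Metric.cauchySeq_iff'.mpr fun ε hε => ?_)
  obtain ⟨b, l, hb, hab⟩ := h (ε / 5) (by positivity)
  have h1 := Metric.tendsto_atTop.mp hb (ε / 5) (by positivity)
  obtain ⟨N, hN⟩ := h1
  obtain ⟨N', hN'⟩ := eventually_atTop.mp hab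
  refine ⟨max N N', fun n hn => ?_⟩
  have e1 := hN n (le_trans (le_max_left _ _) hn)
  have e2 := hN (max N N') (le_max_left _ _)
  have e3 := hN' n (le_trans (le_max_right _ _) hn)
  have e4 := hN' (max N N') (le_max_right _ _)
  rw [Real.dist_eq] at e1 e2 ⊢
  rw [abs_lt] at *
  rw [abs_le] at e3 e4
  constructor <;> linarith

open unitInterval in
/-- First coordinate on the unit square. -/
def squareFst : C(I × I, ℝ) := ⟨fun p => (p.1 : ℝ), by fun_prop⟩

open unitInterval in
/-- Second coordinate on the unit square. -/
def squareSnd : C(I × I, ℝ) := ⟨fun p => (p.2 : ℝ), by fun_prop⟩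

open unitInterval in
/-- Method of moments on the unit square. -/
lemma exists_tendsto_of_moments {C : ℝ} (L : ℕ → (C(I × I, ℝ) →ₗ[ℝ] ℝ))
    (hC : ∀ n g, |L n g| ≤ C * ‖g‖)
    (h : ∀ p q : ℕ, ∃ l, Tendsto (fun n => L n (squareFst ^ p * squareSnd ^ q)) atTop (𝓝 l))
    (g : C(I × I, ℝ)) : ∃ l, Tendsto (fun n => L n g) atTop (𝓝 l) := by
  set V : Submodule ℝ C(I × I, ℝ) :=
    { carrier := {g | ∃ l, Tendsto (fun n => L n g) atTop (𝓝 l)}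
      add_mem' := by
        rintro a b ⟨l, hl⟩ ⟨l', hl'⟩
        exact ⟨l + l', by simpa using hl.add hl'⟩
      zero_mem' := ⟨0, by simp⟩
      smul_mem' := by
        rintro c a ⟨l, hl⟩
        exact ⟨c * l, by simpa using hl.const_mul c⟩ } with hV
  set A : Subalgebra ℝ C(I × I, ℝ) := Algebra.adjoin ℝ {squareFst, squareSnd} with hA
  have hAV : ∀ f ∈ A, f ∈ V := by
    intro f hf
    have h1 : f ∈ Submodule.span ℝ
        (Submonoid.closure {squareFst, squareSnd} : Set C(I × I, ℝ)) := by
      rw [← Algebra.adjoin_eq_span]; exact hf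
    refine (Submodule.span_le.mpr ?_ : _ ≤ V) h1
    intro f hf
    obtain ⟨p, q, rfl⟩ := (Submonoid.mem_closure_pair _ _ _).mp hf
    exact h p q
  have hsep : A.SeparatesPoints := by
    intro x y hxy
    by_cases h1 : x.1 = y.1
    · have h2 : x.2 ≠ y.2 := fun h2 => hxy (Prod.ext h1 h2)
      exact ⟨squareSnd, ⟨squareSnd, Algebra.subset_adjoin (by simp), rfl⟩,
        fun h3 => h2 (Subtype.ext h3)⟩
    · exact ⟨squareFst, ⟨squareFst, Algebra.subset_adjoin (by simp), rfl⟩,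
        fun h3 => h1 (Subtype.ext h3)⟩
  have htop := ContinuousMap.subalgebra_topologicalClosure_eq_top_of_separatesPoints A hsep
  have hg : g ∈ closure (A : Set C(I × I, ℝ)) := by
    have h1 : g ∈ A.topologicalClosure := by rw [htop]; trivial
    exact h1
  refine exists_tendsto_of_approx fun ε hε => ?_
  obtain ⟨f, hf, hfg⟩ := Metric.mem_closure_iff.mp hg (ε / (|C| + 1)) (by positivity)
  obtain ⟨l, hl⟩ := hAV f hf
  refine ⟨_, l, hl, Eventually.of_forall fun n => ?_⟩
  rw [← map_sub]
  refine (hC n _).trans ?_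
  rw [dist_eq_norm] at hfg
  calc C * ‖g - f‖ ≤ (|C| + 1) * (ε / (|C| + 1)) := by
        gcongr
        linarith [le_abs_self C]
    _ = ε := by field_simp

section Decay

variable {ν : Measure (ℝ × ℝ)} [IsProbabilityMeasure ν]

/-- The point `(e^{-M}, e^{-(M - S)})` of the unit square. -/
def squarePoint (u : ℝ × ℝ × ℝ) : unitInterval × unitInterval :=
  (projIcc 0 1 zero_le_one (Real.exp (-u.2.1)),
    projIcc 0 1 zero_le_one (Real.exp (-(u.2.1 - u.1))))

lemma continuous_squarePoint : Continuous squarePoint := by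
  unfold squarePoint
  exact (continuous_projIcc.comp (by fun_prop)).prodMk (continuous_projIcc.comp (by fun_prop))

lemma squarePoint_coe {u : ℝ × ℝ × ℝ} (hu : 0 ≤ u.2.1 ∧ u.1 ≤ u.2.1) :
    ((squarePoint u).1 : ℝ) = Real.exp (-u.2.1) ∧
      ((squarePoint u).2 : ℝ) = Real.exp (-(u.2.1 - u.1)) := by
  have h1 : Real.exp (-u.2.1) ∈ Icc (0 : ℝ) 1 :=
    ⟨(Real.exp_pos _).le, Real.exp_le_one_iff.mpr (by linarith [hu.1])⟩
  have h2 : Real.exp (-(u.2.1 - u.1)) ∈ Icc (0 : ℝ) 1 :=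
    ⟨(Real.exp_pos _).le, Real.exp_le_one_iff.mpr (by linarith [hu.2])⟩
  simp only [squarePoint, projIcc_of_mem _ h1, projIcc_of_mem _ h2, and_self]

lemma integrable_squarePoint_mul_decay (g : C(unitInterval × unitInterval, ℝ)) (n : ℕ) :
    Integrable (fun u => g (squarePoint u) * decay (1 / 2) (1 / 2) u) (pathLaw ν n) := by
  refine integrable_of_le_decay (α := 1 / 2) (β := 1 / 2) (C := ‖g‖) (by norm_num) (by norm_num) n
    ?_ (Eventually.of_forall fun u => ?_)
  · exact ((g.continuous.comp continuous_squarePoint).mul (continuous_decay _ _)).measurable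
  · rw [abs_mul, abs_of_pos (decay_pos _ _ _)]
    exact mul_le_mul_of_nonneg_right (g.norm_coe_le_norm _) (decay_pos _ _ _).le

lemma tendsto_wt_mul_integral_squarePoint (hm : CentredWalk (ν.map Prod.fst))
    (g : C(unitInterval × unitInterval, ℝ)) : ∃ l : ℝ, Tendsto (fun n => wt n *
      ∫ u, g (squarePoint u) * decay (1 / 2) (1 / 2) u ∂(pathLaw ν n)) atTop (𝓝 l) := by
  obtain ⟨C, hC, hC'⟩ := wt_mul_integral_decay_le hm (β := 1 / 2) (by norm_num)
  set L : ℕ → (C(unitInterval × unitInterval, ℝ) →ₗ[ℝ] ℝ) := fun n =>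
    { toFun := fun g => wt n *
        ∫ u, g (squarePoint u) * decay (1 / 2) (1 / 2) u ∂(pathLaw ν n)
      map_add' := fun g g' => by
        simp only [ContinuousMap.add_apply, add_mul]
        rw [integral_add (integrable_squarePoint_mul_decay g n)
          (integrable_squarePoint_mul_decay g' n)]
        ring
      map_smul' := fun c g => by
        simp only [ContinuousMap.smul_apply, smul_eq_mul, mul_assoc, RingHom.id_apply]
        rw [integral_const_mul]
        ring }
  refine exists_tendsto_of_moments (C := C / (1 / 2) ^ 2) L (fun n g => ?_) (fun p q => ?_) g
  · change |wt n * _| ≤ _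
    rw [abs_mul, abs_of_pos (wt_pos n)]
    have h1 : |∫ u, g (squarePoint u) * decay (1 / 2) (1 / 2) u ∂(pathLaw ν n)| ≤
        ∫ u, ‖g‖ * decay (1 / 2) (1 / 2) u ∂(pathLaw ν n) := by
      refine (abs_integral_le_integral_abs).trans (integral_mono
        (integrable_squarePoint_mul_decay g n).abs
        ((integrable_decay (by norm_num) (by norm_num) n).const_mul _) fun u => ?_)
      simp only [abs_mul, abs_of_pos (decay_pos _ _ _)]
      exact mul_le_mul_of_nonneg_right (g.norm_coe_le_norm _) (decay_pos _ _ _).le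
    rw [integral_const_mul] at h1
    calc _ ≤ wt n * (‖g‖ * ∫ u, decay (1 / 2) (1 / 2) u ∂(pathLaw ν n)) :=
          mul_le_mul_of_nonneg_left h1 (wt_pos n).le
      _ = ‖g‖ * (wt n * ∫ u, decay (1 / 2) (1 / 2) u ∂(pathLaw ν n)) := by ring
      _ ≤ ‖g‖ * (C / (1 / 2) ^ 2) :=
          mul_le_mul_of_nonneg_left (hC' _ (by norm_num) (by norm_num) n) (norm_nonneg _)
      _ = _ := mul_comm _ _
  · obtain ⟨l, hl⟩ := tendsto_wt_mul_integral_decay (ν := ν) hm (α := p + 1 / 2) (β := q + 1 / 2)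
      (by positivity) (by positivity)
    refine ⟨l, hl.congr fun n => ?_⟩
    change _ = wt n * _
    congr 1
    refine integral_congr_ae ?_
    filter_upwards [ae_pathLaw_max n] with u hu
    obtain ⟨h1, h2⟩ := squarePoint_coe hu
    simp only [ContinuousMap.mul_apply, ContinuousMap.pow_apply]
    change _ = ((squarePoint u).1 : ℝ) ^ p * ((squarePoint u).2 : ℝ) ^ q * _
    rw [h1, h2, ← Real.exp_nat_mul, ← Real.exp_nat_mul, decay, decay, ← Real.exp_add,
      ← Real.exp_add]
    congr 1
    ring

/-- Continuous functions of `(S_n, M_n)` dominated by `e^{-M_n - (M_n - S_n)}` have expectations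
of order `n^{-3/2}`, with a limiting constant. -/
lemma tendsto_wt_mul_integral_of_le (hm : CentredWalk (ν.map Prod.fst)) {f : ℝ × ℝ → ℝ}
    (hf : Continuous f) {C : ℝ}
    (hC : ∀ s m : ℝ, 0 ≤ m → s ≤ m → |f (s, m)| ≤ C * Real.exp (-m - (m - s))) :
    ∃ l : ℝ, Tendsto (fun n => wt n * ∫ u, f (u.1, u.2.1) ∂(pathLaw ν n)) atTop (𝓝 l) := by
  set φ : unitInterval × unitInterval → ℝ := fun p =>
    f (-Real.log p.1 + Real.log p.2, -Real.log p.1) / √(p.1 * p.2) with hφ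
  have hbd : ∀ p : unitInterval × unitInterval, |φ p| ≤ C * √(p.1 * p.2) := fun p => by
    rcases (mul_nonneg p.1.2.1 p.2.2.1).eq_or_lt with h0 | h0
    · simp only [hφ]
      rw [← h0]
      simp
    · have h1 : 0 < (p.1 : ℝ) := lt_of_le_of_ne p.1.2.1 fun h => by rw [← h] at h0; simp at h0
      have h2 : 0 < (p.2 : ℝ) := lt_of_le_of_ne p.2.2.1 fun h => by rw [← h] at h0; simp at h0
      have h3 := Real.log_nonpos p.1.2.1 p.1.2.2
      have h4 := Real.log_nonpos p.2.2.1 p.2.2.2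
      have h5 := hC (-Real.log p.1 + Real.log p.2) (-Real.log p.1) (by linarith) (by linarith)
      have h6 : -(-Real.log p.1) - (-Real.log p.1 - (-Real.log p.1 + Real.log p.2)) =
          Real.log p.1 + Real.log (p.2 : ℝ) := by ring
      rw [h6, Real.exp_add, Real.exp_log h1, Real.exp_log h2] at h5
      simp only [hφ]
      rw [abs_div, abs_of_pos (Real.sqrt_pos.mpr h0), div_le_iff₀ (Real.sqrt_pos.mpr h0),
        mul_assoc, Real.mul_self_sqrt h0.le]
      exact h5
  have hcont : Continuous φ := by
    refine continuous_iff_continuousAt.mpr fun p => ?_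
    rcases (mul_nonneg p.1.2.1 p.2.2.1).eq_or_lt with h0 | h0
    · have h1 : φ p = 0 := by
        have := hbd p
        rw [← h0] at this
        simpa using this
      rw [ContinuousAt, h1]
      refine squeeze_zero_norm (a := fun p : unitInterval × unitInterval =>
        C * √(p.1 * p.2)) hbd ?_
      have h2 : Continuous fun p : unitInterval × unitInterval =>
        C * √((p.1 : ℝ) * p.2) := by fun_prop
      have h3 := h2.tendsto p
      simp only [← h0] at h3
      simpa using h3
    · have h1 : (p.1 : ℝ) ≠ 0 := fun h => by rw [h] at h0; simp at h0
      have h2 : (p.2 : ℝ) ≠ 0 := fun h => by rw [h] at h0; simp at h0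
      have c1 : ContinuousAt (fun p : unitInterval × unitInterval => Real.log (p.1 : ℝ)) p :=
        ContinuousAt.log (by fun_prop) h1
      have c2 : ContinuousAt (fun p : unitInterval × unitInterval => Real.log (p.2 : ℝ)) p :=
        ContinuousAt.log (by fun_prop) h2
      refine ContinuousAt.div ?_ (by fun_prop) (Real.sqrt_pos.mpr h0).ne'
      exact ContinuousAt.comp (g := f) hf.continuousAt ((c1.neg.add c2).prodMk c1.neg)
  obtain ⟨l, hl⟩ := tendsto_wt_mul_integral_squarePoint hm ⟨φ, hcont⟩
  refine ⟨l, hl.congr fun n => ?_⟩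
  congr 1
  refine integral_congr_ae ?_
  filter_upwards [ae_pathLaw_max n] with u hu
  obtain ⟨h1, h2⟩ := squarePoint_coe hu
  simp only [ContinuousMap.coe_mk, hφ, h1, h2, Real.log_exp]
  rw [← Real.exp_add]
  have h3 : decay (1 / 2) (1 / 2) u = √(Real.exp (-u.2.1 + -(u.2.1 - u.1))) := by
    rw [decay, Real.sqrt_eq_rpow, ← Real.exp_mul]
    congr 1
    ring
  rw [h3, div_mul_cancel₀ _ (Real.sqrt_pos.mpr (Real.exp_pos _)).ne']
  congr 2 <;> ring

end Decay

/-- Step laws of the pairs `(x, η)`: centred walk and uniformly elliptic offspring laws. -/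
structure StepLaw (ν : Measure (ℝ × ℝ)) (χ H : ℝ) : Prop where
  centred : CentredWalk (ν.map Prod.fst)
  pos : 0 < χ
  le_one : χ ≤ 1
  ae_le : ∀ᵐ ξ ∂ν, χ ≤ ξ.2 ∧ 1 + χ ≤ Real.exp ξ.1 + ξ.2 ∧ Real.exp ξ.1 + ξ.2 ≤ H

section StepLaw

variable {ν : Measure (ℝ × ℝ)} [IsProbabilityMeasure ν] {χ H : ℝ}

lemma StepLaw.one_le (h : StepLaw ν χ H) : 1 ≤ H := by
  obtain ⟨ξ, -, h1, h2⟩ := h.ae_le.exists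
  linarith [h.pos]

omit [IsProbabilityMeasure ν] in
lemma StepLaw.ae_snd_le (h : StepLaw ν χ H) : ∀ᵐ ξ ∂ν, ξ.2 ≤ H := by
  filter_upwards [h.ae_le] with ξ hξ
  linarith [Real.exp_pos ξ.1]

omit [IsProbabilityMeasure ν] in
lemma StepLaw.ae_exp_le (h : StepLaw ν χ H) : ∀ᵐ ξ ∂ν, Real.exp ξ.1 ≤ H := by
  filter_upwards [h.ae_le] with ξ hξ
  linarith [h.pos]

lemma StepLaw.ae_lower (h : StepLaw ν χ H) (n : ℕ) : ∀ᵐ u ∂(pathLaw ν n),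
    0 ≤ u.2.2 ∧ χ * Real.exp u.2.1 ≤ Real.exp u.1 + u.2.2 := by
  induction n with
  | zero =>
    change ∀ᵐ u ∂(Measure.dirac _), _
    rw [ae_dirac_iff (by measurability)]
    simpa using h.le_one
  | succ n ih =>
    refine ae_pathLaw_succ (by measurability) ?_
    filter_upwards [h.ae_le] with ξ hξ
    filter_upwards [ih] with u hu
    have hp := Real.exp_pos ξ.1
    simp only [stepFun]
    have h0 : 0 ≤ Real.exp ξ.1 * u.2.2 := mul_nonneg hp.le hu.1
    refine ⟨by linarith [h.pos], ?_⟩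
    rw [Real.exp_add]
    have h1 := mul_le_mul_of_nonneg_left hu.2 hp.le
    rcases max_cases (0 : ℝ) (ξ.1 + u.2.1) with ⟨h2, -⟩ | ⟨h2, -⟩ <;> rw [h2]
    · rw [Real.exp_zero]
      have := mul_pos hp (Real.exp_pos u.1)
      linarith
    · rw [Real.exp_add]
      linarith [h.pos]

lemma StepLaw.ae_le_weight (h : StepLaw ν χ H) {n : ℕ} (hn : n ≠ 0) :
    ∀ᵐ u ∂(pathLaw ν n), χ ≤ u.2.2 := by
  obtain ⟨n, rfl⟩ := Nat.exists_eq_succ_of_ne_zero hn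
  refine ae_pathLaw_succ (by measurability) ?_
  filter_upwards [h.ae_le] with ξ hξ
  filter_upwards [h.ae_lower n] with u hu
  simp only [stepFun]
  linarith [mul_nonneg (Real.exp_pos ξ.1).le hu.1]

lemma StepLaw.ae_exp_le_pow (h : StepLaw ν χ H) (n : ℕ) :
    ∀ᵐ u ∂(pathLaw ν n), Real.exp u.1 ≤ H ^ n := by
  induction n with
  | zero =>
    change ∀ᵐ u ∂(Measure.dirac _), _
    rw [ae_dirac_iff (by measurability)]
    simp
  | succ n ih =>
    refine ae_pathLaw_succ (by measurability) ?_
    filter_upwards [h.ae_exp_le] with ξ hξ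
    filter_upwards [ih] with u hu
    simp only [stepFun]
    rw [Real.exp_add, pow_succ']
    have := h.one_le
    gcongr

lemma StepLaw.integrable_sq (h : StepLaw ν χ H) (n : ℕ) :
    Integrable (fun u => u.1 ^ 2) (pathLaw ν n) := by
  have h1 : ∫⁻ ξ, ENNReal.ofReal (ξ.1 ^ 2) ∂ν < ⊤ := by
    have h2 := h.centred.sq.lintegral_lt_top
    rwa [lintegral_map (by fun_prop) measurable_fst] at h2
  have key : ∫⁻ u, ENNReal.ofReal (u.1 ^ 2) ∂(pathLaw ν n) < ⊤ := by
    induction n with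
    | zero => rw [lintegral_pathLaw_zero]; simp
    | succ n ih =>
      rw [lintegral_pathLaw_succ n (by fun_prop)]
      calc ∫⁻ ξ, ∫⁻ u, ENNReal.ofReal ((stepFun ξ u).1 ^ 2) ∂(pathLaw ν n) ∂ν
          ≤ ∫⁻ ξ, ∫⁻ u, (2 * ENNReal.ofReal (ξ.1 ^ 2) + 2 * ENNReal.ofReal (u.1 ^ 2))
              ∂(pathLaw ν n) ∂ν := by
            refine lintegral_mono fun ξ => lintegral_mono fun u => ?_
            rw [← ENNReal.ofReal_ofNat, ← ENNReal.ofReal_mul (by norm_num),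
              ← ENNReal.ofReal_mul (by norm_num), ← ENNReal.ofReal_add (by positivity)
              (by positivity)]
            refine ENNReal.ofReal_le_ofReal ?_
            simp only [stepFun]
            nlinarith [sq_nonneg (ξ.1 - u.1)]
        _ = 2 * ∫⁻ ξ, ENNReal.ofReal (ξ.1 ^ 2) ∂ν +
              2 * ∫⁻ u, ENNReal.ofReal (u.1 ^ 2) ∂(pathLaw ν n) := by
            simp only [lintegral_add_left measurable_const, lintegral_const, measure_univ, mul_one]
            rw [lintegral_add_right _ measurable_const, lintegral_const, measure_univ, mul_one,
              lintegral_const_mul _ (by fun_prop), lintegral_const_mul _ (by fun_prop)]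
        _ < ⊤ := ENNReal.add_lt_top.mpr
            ⟨ENNReal.mul_lt_top (by simp) h1, ENNReal.mul_lt_top (by simp) ih⟩
  refine ⟨by fun_prop, ?_⟩
  rw [hasFiniteIntegral_iff_ofReal (Eventually.of_forall fun u => sq_nonneg _)]
  exact key

/-- Expansion of the weighted sum `b_n = ∑_{i<n} η_{i+1} e^{S_i}` with bounded weights. -/
lemma lintegral_weight_le (hη : ∀ᵐ ξ ∂ν, ξ.2 ≤ H) (n : ℕ) {Ψ : ℝ × ℝ × ℝ → ENNReal}
    (hΨ : Measurable Ψ) :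
    ∫⁻ u, ENNReal.ofReal u.2.2 * Ψ u ∂(pathLaw ν n) ≤ ENNReal.ofReal H *
      ∑ i ∈ Finset.range n, ∫⁻ u, ∫⁻ v, ENNReal.ofReal (Real.exp u.1) * Ψ (joinFun u v)
        ∂(pathLaw ν (n - i)) ∂(pathLaw ν i) := by
  induction n generalizing Ψ with
  | zero => rw [lintegral_pathLaw_zero]; simp
  | succ n ih =>
    have hm : Measurable fun p : (ℝ × ℝ × ℝ) × ℝ × ℝ × ℝ =>
        ENNReal.ofReal (Real.exp p.1.1) * Ψ (joinFun p.1 p.2) := by fun_prop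
    have hstep : Measurable fun p : (ℝ × ℝ) × ℝ × ℝ × ℝ => Ψ (stepFun p.1 p.2) := by fun_prop
    have e0 : ∫⁻ u, ∫⁻ v, ENNReal.ofReal (Real.exp u.1) * Ψ (joinFun u v)
        ∂(pathLaw ν (n + 1)) ∂(pathLaw ν 0) = ∫⁻ u, Ψ u ∂(pathLaw ν (n + 1)) := by
      rw [lintegral_pathLaw_zero]
      refine lintegral_congr_ae ?_
      filter_upwards [ae_pathLaw_max (n + 1)] with v hv
      simp [zero_joinFun hv.1]
    have e1 : ∀ i, ∫⁻ u, ∫⁻ v, ENNReal.ofReal (Real.exp u.1) * Ψ (joinFun u v)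
        ∂(pathLaw ν (n - i)) ∂(pathLaw ν (i + 1)) =
        ∫⁻ ξ, ENNReal.ofReal (Real.exp ξ.1) * ∫⁻ u, ∫⁻ v, ENNReal.ofReal (Real.exp u.1) *
          Ψ (stepFun ξ (joinFun u v)) ∂(pathLaw ν (n - i)) ∂(pathLaw ν i) ∂ν := fun i => by
      rw [lintegral_pathLaw_succ i (f := fun u => ∫⁻ v, ENNReal.ofReal (Real.exp u.1) *
        Ψ (joinFun u v) ∂(pathLaw ν (n - i))) hm.lintegral_prod_right']
      refine lintegral_congr fun ξ => ?_
      have hm2 : Measurable fun p : (ℝ × ℝ × ℝ) × ℝ × ℝ × ℝ =>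
          ENNReal.ofReal (Real.exp p.1.1) * Ψ (stepFun ξ (joinFun p.1 p.2)) := by
        have := hstep.comp ((measurable_const (a := ξ)).prodMk measurable_joinFun)
        exact (by fun_prop : Measurable fun p : (ℝ × ℝ × ℝ) × ℝ × ℝ × ℝ =>
          ENNReal.ofReal (Real.exp p.1.1)).mul this
      rw [← lintegral_const_mul _ hm2.lintegral_prod_right']
      refine lintegral_congr fun u => ?_
      rw [← lintegral_const_mul' _ _ ENNReal.ofReal_ne_top]
      refine lintegral_congr fun v => ?_
      rw [stepFun_joinFun, ← mul_assoc, ← ENNReal.ofReal_mul (Real.exp_pos _).le, ← Real.exp_add]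
      rfl
    rw [Finset.sum_range_succ', Nat.sub_zero, e0]
    simp only [Nat.add_sub_add_right, e1]
    have hmeas : ∀ i, Measurable fun ξ : ℝ × ℝ => ENNReal.ofReal (Real.exp ξ.1) *
        ∫⁻ u, ∫⁻ v, ENNReal.ofReal (Real.exp u.1) *
          Ψ (stepFun ξ (joinFun u v)) ∂(pathLaw ν (n - i)) ∂(pathLaw ν i) := fun i => by
      have : Measurable fun q : ((ℝ × ℝ) × ℝ × ℝ × ℝ) × ℝ × ℝ × ℝ =>
          ENNReal.ofReal (Real.exp q.1.2.1) * Ψ (stepFun q.1.1 (joinFun q.1.2 q.2)) := by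
        have h1 := hstep.comp (measurable_fst.fst.prodMk
          (measurable_joinFun_comp (measurable_fst.snd) measurable_snd) :
          Measurable fun q : ((ℝ × ℝ) × ℝ × ℝ × ℝ) × ℝ × ℝ × ℝ => (q.1.1, joinFun q.1.2 q.2))
        exact (by fun_prop : Measurable fun q : ((ℝ × ℝ) × ℝ × ℝ × ℝ) × ℝ × ℝ × ℝ =>
          ENNReal.ofReal (Real.exp q.1.2.1)).mul h1
      exact (by fun_prop : Measurable fun ξ : ℝ × ℝ => ENNReal.ofReal (Real.exp ξ.1)).mul
        (this.lintegral_prod_right').lintegral_prod_right'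
    rw [lintegral_pathLaw_succ n (f := fun u => ENNReal.ofReal u.2.2 * Ψ u) (by fun_prop),
      lintegral_pathLaw_succ n hΨ, ← lintegral_finsetSum _ fun i _ => hmeas i, add_comm,
      ← lintegral_add_left hstep.lintegral_prod_right', ← lintegral_const_mul' _ _ (by simp)]
    refine lintegral_mono_ae ?_
    filter_upwards [hη] with ξ hξ
    have hst : Measurable fun u => Ψ (stepFun ξ u) := hstep.comp measurable_prodMk_left
    have hih := ih hst
    calc ∫⁻ u, ENNReal.ofReal (stepFun ξ u).2.2 * Ψ (stepFun ξ u) ∂(pathLaw ν n)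
        ≤ ∫⁻ u, (ENNReal.ofReal H * Ψ (stepFun ξ u) + ENNReal.ofReal (Real.exp ξ.1) *
            (ENNReal.ofReal u.2.2 * Ψ (stepFun ξ u))) ∂(pathLaw ν n) := by
          refine lintegral_mono fun u => ?_
          rw [← mul_assoc, ← add_mul]
          gcongr
          rw [← ENNReal.ofReal_mul (Real.exp_pos _).le]
          exact ENNReal.ofReal_add_le.trans (add_le_add_left (ENNReal.ofReal_le_ofReal hξ) _)
      _ = ENNReal.ofReal H * ∫⁻ u, Ψ (stepFun ξ u) ∂(pathLaw ν n) +
            ENNReal.ofReal (Real.exp ξ.1) *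
            ∫⁻ u, ENNReal.ofReal u.2.2 * Ψ (stepFun ξ u) ∂(pathLaw ν n) := by
          rw [lintegral_add_left (hst.const_mul _), lintegral_const_mul _ hst,
            lintegral_const_mul _ (by fun_prop)]
      _ ≤ _ := by
          rw [mul_add]
          refine add_le_add le_rfl ((mul_le_mul_right hih _).trans_eq ?_)
          rw [← Finset.mul_sum]
          ring

end StepLaw

lemma exp_mul_decay_joinFun_le (u v : ℝ × ℝ × ℝ) :
    Real.exp u.1 * decay (3 / 2) 1 (joinFun u v) ≤
      decay (1 / 2) (1 / 2) u * decay (1 / 2) 1 v := by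
  simp only [decay, joinFun]
  rw [← Real.exp_add, ← Real.exp_add]
  refine Real.exp_le_exp.mpr ?_
  linarith [le_max_left u.2.1 (u.1 + v.2.1), le_max_right u.2.1 (u.1 + v.2.1)]

section StepLaw

variable {ν : Measure (ℝ × ℝ)} [IsProbabilityMeasure ν] {χ H : ℝ}

lemma ofReal_integral_decay {α β : ℝ} (hα : 0 ≤ α) (hβ : 0 ≤ β) (n : ℕ) :
    ∫⁻ u, ENNReal.ofReal (decay α β u) ∂(pathLaw ν n) =
      ENNReal.ofReal (∫ u, decay α β u ∂(pathLaw ν n)) :=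
  (ofReal_integral_eq_lintegral_ofReal (integrable_decay hα hβ n)
    (Eventually.of_forall fun _ => (decay_pos _ _ _).le)).symm

lemma exists_lintegral_exp_mul_decay_joinFun_le (hm : CentredWalk (ν.map Prod.fst)) :
    ∃ K : ℝ, 0 ≤ K ∧ ∀ p q : ℕ, ∫⁻ u, ∫⁻ v, ENNReal.ofReal (Real.exp u.1) *
      ENNReal.ofReal (decay (3 / 2) 1 (joinFun u v)) ∂(pathLaw ν q) ∂(pathLaw ν p) ≤
        ENNReal.ofReal (K * ((wt p)⁻¹ * (wt q)⁻¹)) := by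
  obtain ⟨A, hA, hA'⟩ := wt_mul_integral_decay_le hm (β := 1 / 2) (by norm_num)
  obtain ⟨B, hB, hB'⟩ := wt_mul_integral_decay_le hm (β := 1) (by norm_num)
  refine ⟨A / (1 / 2) ^ 2 * (B / (1 / 2) ^ 2), by positivity, fun p q => ?_⟩
  have hA'' := hA' (1 / 2) (by norm_num) (by norm_num) p
  have hB'' := hB' (1 / 2) (by norm_num) (by norm_num) q
  calc _ ≤ ∫⁻ u, ∫⁻ v, ENNReal.ofReal (decay (1 / 2) (1 / 2) u) *
        ENNReal.ofReal (decay (1 / 2) 1 v) ∂(pathLaw ν q) ∂(pathLaw ν p) := by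
        refine lintegral_mono fun u => lintegral_mono fun v => ?_
        rw [← ENNReal.ofReal_mul (Real.exp_pos _).le, ← ENNReal.ofReal_mul (decay_pos _ _ _).le]
        exact ENNReal.ofReal_le_ofReal (exp_mul_decay_joinFun_le u v)
    _ = ENNReal.ofReal ((∫ u, decay (1 / 2) (1 / 2) u ∂(pathLaw ν p)) *
          ∫ u, decay (1 / 2) 1 u ∂(pathLaw ν q)) := by
        simp_rw [lintegral_const_mul' _ _ ENNReal.ofReal_ne_top]
        rw [lintegral_mul_const _ (by fun_prop), ofReal_integral_decay (by norm_num) (by norm_num),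
          ofReal_integral_decay (by norm_num) (by norm_num), ← ENNReal.ofReal_mul]
        exact integral_nonneg fun u => (decay_pos _ _ _).le
    _ ≤ _ := by
        refine ENNReal.ofReal_le_ofReal ?_
        have e1 : ∫ u, decay (1 / 2) (1 / 2) u ∂(pathLaw ν p) ≤ A / (1 / 2) ^ 2 * (wt p)⁻¹ := by
          rw [← div_eq_mul_inv, le_div_iff₀ (wt_pos p), mul_comm]; exact hA''
        have e2 : ∫ u, decay (1 / 2) 1 u ∂(pathLaw ν q) ≤ B / (1 / 2) ^ 2 * (wt q)⁻¹ := by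
          rw [← div_eq_mul_inv, le_div_iff₀ (wt_pos q), mul_comm]; exact hB''
        have e3 := (wt_pos p).le
        calc _ ≤ (A / (1 / 2) ^ 2 * (wt p)⁻¹) * (B / (1 / 2) ^ 2 * (wt q)⁻¹) :=
              mul_le_mul e1 e2 (integral_nonneg fun u => (decay_pos _ _ _).le) (by positivity)
          _ = _ := by ring

/-- The increments in the middle of the path contribute little to the weighted sum. -/
lemma StepLaw.exists_middle_weight_le (h : StepLaw ν χ H) :
    ∃ K : ℝ, 0 ≤ K ∧ ∀ j m : ℕ, ∫⁻ u, ∫⁻ v, ∫⁻ w, ENNReal.ofReal v.2.2 *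
      (ENNReal.ofReal (Real.exp u.1) *
        ENNReal.ofReal (decay (3 / 2) 1 (joinFun u (joinFun v w))))
        ∂(pathLaw ν j) ∂(pathLaw ν m) ∂(pathLaw ν j) ≤
      ENNReal.ofReal (K * (∑' i, (wt (i + j))⁻¹) / wt (j + m + j)) := by
  obtain ⟨K, hK, hK'⟩ := exists_lintegral_exp_mul_decay_joinFun_le h.centred
  have hH := h.one_le
  refine ⟨H * (K * 6), by positivity, fun j m => ?_⟩
  set Φ : ℝ × ℝ × ℝ → ENNReal := fun u => ENNReal.ofReal (decay (3 / 2) 1 u) with hΦ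
  have hΦm : Measurable Φ := by fun_prop
  set Ψ : ℝ × ℝ × ℝ → ℝ × ℝ × ℝ → ENNReal := fun u v =>
    ENNReal.ofReal (Real.exp u.1) * ∫⁻ w, Φ (joinFun u (joinFun v w)) ∂(pathLaw ν j) with hΨ
  have m3 : Measurable fun p : ((ℝ × ℝ × ℝ) × ℝ × ℝ × ℝ) × ℝ × ℝ × ℝ =>
      Φ (joinFun p.1.1 (joinFun p.1.2 p.2)) :=
    hΦm.comp (measurable_joinFun_comp measurable_fst.fst
      (measurable_joinFun_comp measurable_fst.snd measurable_snd))
  have m2 : Measurable fun p : (ℝ × ℝ × ℝ) × ℝ × ℝ × ℝ => Ψ p.1 p.2 :=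
    (by fun_prop : Measurable fun p : (ℝ × ℝ × ℝ) × ℝ × ℝ × ℝ =>
      ENNReal.ofReal (Real.exp p.1.1)).mul m3.lintegral_prod_right'
  have e1 : ∀ i, Measurable fun u => ∫⁻ v, ∫⁻ w, ENNReal.ofReal (Real.exp v.1) *
      Ψ u (joinFun v w) ∂(pathLaw ν (m - i)) ∂(pathLaw ν i) := fun i => by
    have := m2.comp ((measurable_fst.fst).prodMk
      (measurable_joinFun_comp measurable_fst.snd measurable_snd) :
      Measurable fun p : ((ℝ × ℝ × ℝ) × ℝ × ℝ × ℝ) × ℝ × ℝ × ℝ => (p.1.1, joinFun p.1.2 p.2))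
    exact (((by fun_prop : Measurable fun p : ((ℝ × ℝ × ℝ) × ℝ × ℝ × ℝ) × ℝ × ℝ × ℝ =>
      ENNReal.ofReal (Real.exp p.1.2.1)).mul this).lintegral_prod_right').lintegral_prod_right'
  have e2 : ∀ i, ∫⁻ u, ∫⁻ v, ∫⁻ w, ENNReal.ofReal (Real.exp v.1) *
      Ψ u (joinFun v w) ∂(pathLaw ν (m - i)) ∂(pathLaw ν i) ∂(pathLaw ν j) =
      ∫⁻ u, ∫⁻ v, ENNReal.ofReal (Real.exp u.1) * Φ (joinFun u v)
        ∂(pathLaw ν (m - i + j)) ∂(pathLaw ν (j + i)) := fun i => by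
    have n2 : Measurable fun p : (ℝ × ℝ × ℝ) × ℝ × ℝ × ℝ =>
        ENNReal.ofReal (Real.exp p.1.1) * Φ (joinFun p.1 p.2) := by fun_prop
    rw [lintegral_pathLaw_add j i n2.lintegral_prod_right']
    refine lintegral_congr fun u => lintegral_congr fun v => ?_
    dsimp only
    rw [lintegral_pathLaw_add (m - i) j (f := fun y => ENNReal.ofReal
      (Real.exp (joinFun u v).1) * Φ (joinFun (joinFun u v) y))
      (n2.comp (measurable_prodMk_left (x := joinFun u v)))]
    refine lintegral_congr fun w => ?_
    simp only [hΨ]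
    rw [← mul_assoc, lintegral_const_mul' _ _ ENNReal.ofReal_ne_top,
      ← ENNReal.ofReal_mul (Real.exp_pos _).le, ← Real.exp_add]
    simp only [joinFun_assoc]
    congr 3
    simp only [joinFun]
    ring
  calc _ = ∫⁻ u, ∫⁻ v, ENNReal.ofReal v.2.2 * Ψ u v ∂(pathLaw ν m) ∂(pathLaw ν j) := by
        refine lintegral_congr fun u => lintegral_congr fun v => ?_
        rw [lintegral_const_mul' _ _ ENNReal.ofReal_ne_top,
          lintegral_const_mul' _ _ ENNReal.ofReal_ne_top]
    _ ≤ ∫⁻ u, ENNReal.ofReal H * ∑ i ∈ Finset.range m, ∫⁻ v, ∫⁻ w,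
          ENNReal.ofReal (Real.exp v.1) * Ψ u (joinFun v w)
          ∂(pathLaw ν (m - i)) ∂(pathLaw ν i) ∂(pathLaw ν j) :=
        lintegral_mono fun u => lintegral_weight_le h.ae_snd_le m
          (m2.comp (measurable_prodMk_left (x := u)))
    _ = ENNReal.ofReal H * ∑ i ∈ Finset.range m, ∫⁻ u, ∫⁻ v, ENNReal.ofReal (Real.exp u.1) *
          Φ (joinFun u v) ∂(pathLaw ν (m - i + j)) ∂(pathLaw ν (j + i)) := by
        rw [lintegral_const_mul' _ _ ENNReal.ofReal_ne_top, lintegral_finsetSum _ fun i _ => e1 i]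
        simp_rw [e2]
    _ ≤ ENNReal.ofReal H * ∑ i ∈ Finset.range m,
          ENNReal.ofReal (K * ((wt (j + i))⁻¹ * (wt (m - i + j))⁻¹)) := by
        gcongr with i hi
        exact hK' _ _
    _ ≤ _ := by
        have hp : ∀ k, 0 ≤ (wt k)⁻¹ := fun k => (inv_pos.mpr (wt_pos k)).le
        rw [← ENNReal.ofReal_sum_of_nonneg fun i _ =>
          mul_nonneg hK (mul_nonneg (hp _) (hp _)), ← ENNReal.ofReal_mul (by linarith),
          ← Finset.mul_sum]
        refine ENNReal.ofReal_le_ofReal ?_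
        have h1 := sum_middle_le j (j + m + j) (by omega)
        rw [Finset.sum_Ico_eq_sum_range, show j + m + j - j - j = m by omega] at h1
        have h2 : ∑ i ∈ Finset.range m, (wt (j + i))⁻¹ * (wt (m - i + j))⁻¹ =
            ∑ i ∈ Finset.range m, (wt (j + i))⁻¹ * (wt (j + m + j - (j + i)))⁻¹ := by
          refine Finset.sum_congr rfl fun i hi => ?_
          rw [Finset.mem_range] at hi
          rw [show j + m + j - (j + i) = m - i + j by omega]
        rw [h2]
        calc _ ≤ H * (K * (6 * (∑' i, (wt (i + j))⁻¹) / wt (j + m + j))) := by gcongr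
          _ = _ := by ring

end StepLaw

/-- Expected decrement of `1 / (e^S + b)` when one more step of law `ν` is appended. -/
def gap (ν : Measure (ℝ × ℝ)) (s b : ℝ) : ℝ :=
  ∫ ξ, ((Real.exp s + b)⁻¹ - (Real.exp s * (Real.exp ξ.1 + ξ.2) + b)⁻¹) ∂ν

section Elementary

variable {t b W χ H : ℝ}

lemma inv_sub_inv_eq (ht : 0 < t) (hb : 0 ≤ b) (hW : 0 < W) :
    (t + b)⁻¹ - (t * W + b)⁻¹ = t * (W - 1) / ((t + b) * (t * W + b)) := by
  have h1 : t + b ≠ 0 := by positivity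
  have h2 : t * W + b ≠ 0 := by positivity
  field_simp
  ring

lemma inv_sub_inv_le (ht : 0 < t) (hb : 0 ≤ b) (hW : 1 ≤ W) (hWH : W ≤ H) :
    (t + b)⁻¹ - (t * W + b)⁻¹ ≤ H * (t / (t + b) ^ 2) := by
  rw [inv_sub_inv_eq ht hb (by linarith), ← mul_div_assoc, mul_comm H]
  have h0 : 0 < t + b := by positivity
  have h1 : t + b ≤ t * W + b := by nlinarith
  have h2 : 0 ≤ H := by linarith
  gcongr
  · linarith
  · rw [sq]; gcongr

lemma le_inv_sub_inv (hχ : 0 < χ) (ht : 0 < t) (hb : 0 ≤ b) (hW : 1 + χ ≤ W) (hWH : W ≤ H) :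
    χ / H * (t / (t + b) ^ 2) ≤ (t + b)⁻¹ - (t * W + b)⁻¹ := by
  rw [inv_sub_inv_eq ht hb (by linarith), div_mul_div_comm, mul_comm χ]
  have h0 : 0 < t + b := by positivity
  have h2 : 0 < W := by linarith
  have h1 : t * W + b ≤ H * (t + b) := by nlinarith
  have h3 : (t + b) * (t * W + b) ≤ H * (t + b) ^ 2 := by nlinarith
  have h4 : 0 ≤ W - 1 := by linarith
  gcongr
  linarith

lemma abs_inv_sub_inv_sub_le {b' : ℝ} (hχ : 0 < χ) (ht : 0 < t) (hb : χ ≤ b) (hb' : χ ≤ b')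
    (hW : 1 ≤ W) (hWH : W ≤ H) :
    |((t + b)⁻¹ - (t * W + b)⁻¹) - ((t + b')⁻¹ - (t * W + b')⁻¹)| ≤
      2 * H / χ ^ 3 * t * |b - b'| := by
  rw [inv_sub_inv_eq ht (by linarith) (by linarith),
    inv_sub_inv_eq ht (by linarith) (by linarith)]
  have hW0 : 0 < W := by linarith
  have a1 : χ ≤ t + b := by linarith
  have a2 : χ ≤ t * W + b := by nlinarith
  have a3 : χ ≤ t + b' := by linarith
  have a4 : χ ≤ t * W + b' := by nlinarith
  set A := t + b
  set B := t * W + b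
  set A' := t + b'
  set B' := t * W + b'
  have p1 : 0 < A := by linarith
  have p2 : 0 < B := by linarith
  have p3 : 0 < A' := by linarith
  have p4 : 0 < B' := by linarith
  have e : t * (W - 1) / (A * B) - t * (W - 1) / (A' * B') =
      t * (W - 1) * (b' - b) * ((A * B * B')⁻¹ + (A * A' * B')⁻¹) := by
    have h1 : A' * B' - A * B = (b' - b) * (A' + B) := by simp only [A, A', B, B']; ring
    clear_value A B A' B'
    field_simp
    linear_combination (W - 1) * h1
  have q1 : (A * B * B')⁻¹ ≤ (χ ^ 3)⁻¹ := by
    rw [pow_succ, sq]; gcongr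
  have q2 : (A * A' * B')⁻¹ ≤ (χ ^ 3)⁻¹ := by
    rw [pow_succ, sq]; gcongr
  rw [e, abs_mul, abs_mul, abs_of_nonneg (mul_nonneg ht.le (by linarith : 0 ≤ W - 1)),
    abs_of_nonneg (by positivity : 0 ≤ (A * B * B')⁻¹ + (A * A' * B')⁻¹), abs_sub_comm b' b]
  have hH : 0 ≤ H := by linarith
  calc t * (W - 1) * |b - b'| * ((A * B * B')⁻¹ + (A * A' * B')⁻¹)
      ≤ t * H * |b - b'| * ((χ ^ 3)⁻¹ + (χ ^ 3)⁻¹) := by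
        gcongr
        linarith
    _ = _ := by field_simp; ring

end Elementary

section StepLaw

variable {ν : Measure (ℝ × ℝ)} [IsProbabilityMeasure ν] {χ H : ℝ}

lemma StepLaw.integrable_gap (h : StepLaw ν χ H) (s : ℝ) {b : ℝ} (hb : 0 ≤ b) :
    Integrable (fun ξ : ℝ × ℝ =>
      (Real.exp s + b)⁻¹ - (Real.exp s * (Real.exp ξ.1 + ξ.2) + b)⁻¹) ν := by
  have hs := Real.exp_pos s
  refine Integrable.of_bound (C := H * (Real.exp s / (Real.exp s + b) ^ 2)) (by fun_prop) ?_
  filter_upwards [h.ae_le] with ξ hξ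
  rw [Real.norm_eq_abs, abs_of_nonneg]
  · exact inv_sub_inv_le hs hb (by linarith [h.pos]) hξ.2.2
  · refine le_trans ?_ (le_inv_sub_inv h.pos hs hb hξ.2.1 hξ.2.2)
    have := h.pos
    have := h.one_le
    positivity

lemma StepLaw.gap_le (h : StepLaw ν χ H) (s : ℝ) {b : ℝ} (hb : 0 ≤ b) :
    gap ν s b ≤ H * (Real.exp s / (Real.exp s + b) ^ 2) := by
  have h1 := integral_mono_ae (h.integrable_gap s hb)
    (integrable_const (H * (Real.exp s / (Real.exp s + b) ^ 2))) (by
      filter_upwards [h.ae_le] with ξ hξ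
      exact inv_sub_inv_le (Real.exp_pos s) hb (by linarith [h.pos]) hξ.2.2)
  simpa [gap] using h1

lemma StepLaw.le_gap (h : StepLaw ν χ H) (s : ℝ) {b : ℝ} (hb : 0 ≤ b) :
    χ / H * (Real.exp s / (Real.exp s + b) ^ 2) ≤ gap ν s b := by
  have h1 := integral_mono_ae
    (integrable_const (χ / H * (Real.exp s / (Real.exp s + b) ^ 2))) (h.integrable_gap s hb) (by
      filter_upwards [h.ae_le] with ξ hξ
      exact le_inv_sub_inv h.pos (Real.exp_pos s) hb hξ.2.1 hξ.2.2)
  simpa [gap] using h1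

lemma StepLaw.gap_nonneg (h : StepLaw ν χ H) (s : ℝ) {b : ℝ} (hb : 0 ≤ b) : 0 ≤ gap ν s b := by
  refine le_trans ?_ (h.le_gap s hb)
  have := h.pos
  have := h.one_le
  positivity

lemma StepLaw.abs_gap_sub_le (h : StepLaw ν χ H) (s : ℝ) {b b' : ℝ} (hb : χ ≤ b) (hb' : χ ≤ b') :
    |gap ν s b - gap ν s b'| ≤ 2 * H / χ ^ 3 * Real.exp s * |b - b'| := by
  have hχ := h.pos
  rw [gap, gap, ← integral_sub (h.integrable_gap s (hχ.le.trans hb))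
    (h.integrable_gap s (hχ.le.trans hb'))]
  have h1 := norm_integral_le_of_norm_le_const (μ := ν)
    (f := fun ξ : ℝ × ℝ => ((Real.exp s + b)⁻¹ - (Real.exp s * (Real.exp ξ.1 + ξ.2) + b)⁻¹) -
      ((Real.exp s + b')⁻¹ - (Real.exp s * (Real.exp ξ.1 + ξ.2) + b')⁻¹))
    (C := 2 * H / χ ^ 3 * Real.exp s * |b - b'|) (by
      filter_upwards [h.ae_le] with ξ hξ
      exact abs_inv_sub_inv_sub_le hχ (Real.exp_pos s) hb hb' (by linarith) hξ.2.2)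
  simpa using h1

lemma measurable_gap : Measurable fun p : ℝ × ℝ => gap ν p.1 p.2 := by
  have h1 : StronglyMeasurable fun q : (ℝ × ℝ) × ℝ × ℝ =>
      (Real.exp q.1.1 + q.1.2)⁻¹ - (Real.exp q.1.1 * (Real.exp q.2.1 + q.2.2) + q.1.2)⁻¹ := by
    apply Measurable.stronglyMeasurable; fun_prop
  exact h1.integral_prod_right'.measurable

lemma StepLaw.continuousOn_gap (h : StepLaw ν χ H) :
    ContinuousOn (fun p : ℝ × ℝ => gap ν p.1 p.2) {p | χ ≤ p.2} := by
  have hχ := h.pos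
  refine continuousOn_of_dominated (bound := fun _ => χ⁻¹ + χ⁻¹) (fun p _ => by fun_prop) ?_
    (integrable_const _) ?_
  · intro p hp
    have hp : χ ≤ p.2 := hp
    have hp0 := hχ.trans_le hp
    filter_upwards [h.ae_le] with ξ hξ
    have h1 := Real.exp_pos p.1
    have h2 : 0 < Real.exp p.1 * (Real.exp ξ.1 + ξ.2) := by
      have : 0 < Real.exp ξ.1 + ξ.2 := by linarith
      positivity
    refine (norm_sub_le _ _).trans (add_le_add ?_ ?_)
    · rw [Real.norm_eq_abs, abs_of_pos (by positivity)]
      gcongr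
      linarith
    · rw [Real.norm_eq_abs, abs_of_pos (by positivity)]
      gcongr
      linarith
  · filter_upwards [h.ae_le] with ξ hξ
    have h3 : 0 < Real.exp ξ.1 + ξ.2 := by linarith
    refine ContinuousOn.sub (ContinuousOn.inv₀ (by fun_prop) fun p hp => ?_)
      (ContinuousOn.inv₀ (by fun_prop) fun p hp => ?_)
    · have hp : χ ≤ p.2 := hp
      exact (add_pos (Real.exp_pos p.1) (hχ.trans_le hp)).ne'
    · have hp : χ ≤ p.2 := hp
      exact (add_pos (mul_pos (Real.exp_pos p.1) h3) (hχ.trans_le hp)).ne'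

end StepLaw

/-- Continuous cutoff on `[0, R]`. -/
def cutoff (R m : ℝ) : ℝ := max 0 (1 - m / R)

@[fun_prop]
lemma continuous_cutoff (R : ℝ) : Continuous (cutoff R) := by unfold cutoff; fun_prop

@[fun_prop]
lemma measurable_cutoff (R : ℝ) : Measurable (cutoff R) := (continuous_cutoff R).measurable

lemma cutoff_nonneg (R m : ℝ) : 0 ≤ cutoff R m := le_max_left _ _

lemma cutoff_le_one {R m : ℝ} (hR : 0 < R) (hm : 0 ≤ m) : cutoff R m ≤ 1 :=
  max_le zero_le_one (by linarith [div_nonneg hm hR.le])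

lemma cutoff_eq_zero {R m : ℝ} (hR : 0 < R) (hm : R ≤ m) : cutoff R m = 0 :=
  max_eq_left (by linarith [(one_le_div hR).mpr hm])

lemma one_sub_cutoff_le (R m : ℝ) : 1 - cutoff R m ≤ m / R := by
  linarith [le_max_right 0 (1 - m / R), show cutoff R m = max 0 (1 - m / R) from rfl]

section StepLaw

variable {ν : Measure (ℝ × ℝ)} [IsProbabilityMeasure ν] {χ H : ℝ}

lemma StepLaw.gap_le_exp (h : StepLaw ν χ H) (s : ℝ) {b : ℝ} (hb : χ ≤ b) :
    gap ν s b ≤ H / χ ^ 2 * Real.exp s := by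
  have hχ := h.pos
  have hH := h.one_le
  refine (h.gap_le s (hχ.le.trans hb)).trans ?_
  rw [div_mul_eq_mul_div, mul_div_assoc]
  have := Real.exp_pos s
  gcongr
  linarith

lemma StepLaw.gap_le_const (h : StepLaw ν χ H) (s : ℝ) {b : ℝ} (hb : χ ≤ b) :
    gap ν s b ≤ H / χ := by
  have hχ := h.pos
  have hH := h.one_le
  refine (h.gap_le s (hχ.le.trans hb)).trans ?_
  rw [div_eq_mul_inv H]
  have hs := Real.exp_pos s
  have hb0 := hχ.trans_le hb
  have : Real.exp s / (Real.exp s + b) ^ 2 ≤ χ⁻¹ := by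
    rw [div_le_iff₀ (by positivity), inv_mul_eq_div, le_div_iff₀ hχ]
    nlinarith [mul_pos hs hχ, mul_nonneg hs.le (sub_nonneg.mpr hb), sq_nonneg b]
  gcongr

lemma StepLaw.ae_gap_le (h : StepLaw ν χ H) (n : ℕ) : ∀ᵐ u ∂(pathLaw ν n),
    0 ≤ gap ν u.1 u.2.2 ∧ gap ν u.1 u.2.2 ≤ H / χ ^ 2 * Real.exp (u.1 - 2 * u.2.1) := by
  have hχ := h.pos
  have hH := h.one_le
  filter_upwards [h.ae_lower n] with u hu
  refine ⟨h.gap_nonneg _ hu.1, (h.gap_le _ hu.1).trans ?_⟩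
  have h1 : (χ * Real.exp u.2.1) ^ 2 ≤ (Real.exp u.1 + u.2.2) ^ 2 := by gcongr; exact hu.2
  calc H * (Real.exp u.1 / (Real.exp u.1 + u.2.2) ^ 2)
      ≤ H * (Real.exp u.1 / (χ * Real.exp u.2.1) ^ 2) := by gcongr
    _ = H / χ ^ 2 * Real.exp (u.1 - 2 * u.2.1) := by
      rw [Real.exp_sub, two_mul, Real.exp_add]
      field_simp

lemma measurable_gap_path : Measurable fun u : ℝ × ℝ × ℝ => gap ν u.1 u.2.2 :=
  measurable_gap.comp (measurable_fst.prodMk measurable_snd.snd)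

lemma StepLaw.integrable_gap_path (h : StepLaw ν χ H) (n : ℕ) :
    Integrable (fun u => gap ν u.1 u.2.2) (pathLaw ν n) := by
  refine integrable_of_le_decay (α := 1) (β := 1) (C := H / χ ^ 2) zero_le_one zero_le_one n
    measurable_gap_path ?_
  filter_upwards [h.ae_gap_le n] with u hu
  rw [abs_of_nonneg hu.1, decay]
  convert! hu.2 using 3
  ring

lemma StepLaw.integrable_gap_mul_cutoff (h : StepLaw ν χ H) {R : ℝ} (hR : 0 < R) (n : ℕ) :
    Integrable (fun u => gap ν u.1 u.2.2 * cutoff R u.2.1) (pathLaw ν n) := by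
  refine (h.integrable_gap_path n).mono
    (measurable_gap_path.mul (by fun_prop)).aestronglyMeasurable ?_
  filter_upwards [ae_pathLaw_max n] with u hu
  rw [norm_mul, Real.norm_of_nonneg (cutoff_nonneg _ _)]
  exact mul_le_of_le_one_right (norm_nonneg _) (cutoff_le_one hR hu.1)

/-- Paths with a large maximum contribute little. -/
lemma StepLaw.exists_cutoff_error_le (h : StepLaw ν χ H) : ∃ C : ℝ, 0 ≤ C ∧ ∀ R : ℝ, 0 < R → ∀ n,
    |∫ u, gap ν u.1 u.2.2 ∂(pathLaw ν n) -
      ∫ u, gap ν u.1 u.2.2 * cutoff R u.2.1 ∂(pathLaw ν n)| ≤ C / R / wt n := by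
  have hχ := h.pos
  have hH := h.one_le
  obtain ⟨A, hA, hA'⟩ := wt_mul_integral_decay_le h.centred (β := 1) (by norm_num)
  refine ⟨2 * H / χ ^ 2 * (A / (1 / 2) ^ 2), by positivity, fun R hR n => ?_⟩
  rw [← integral_sub (h.integrable_gap_path n) (h.integrable_gap_mul_cutoff hR n)]
  have h1 : ∀ᵐ u ∂(pathLaw ν n), ‖gap ν u.1 u.2.2 - gap ν u.1 u.2.2 * cutoff R u.2.1‖ ≤
      2 * H / χ ^ 2 / R * decay (1 / 2) 1 u := by
    filter_upwards [h.ae_gap_le n, ae_pathLaw_max n] with u hu hu'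
    have h2 := sub_nonneg.mpr (cutoff_le_one hR hu'.1)
    rw [show gap ν u.1 u.2.2 - gap ν u.1 u.2.2 * cutoff R u.2.1 =
      gap ν u.1 u.2.2 * (1 - cutoff R u.2.1) by ring, Real.norm_of_nonneg (mul_nonneg hu.1 h2)]
    have h3 : 1 - cutoff R u.2.1 ≤ 2 * Real.exp (u.2.1 / 2) / R := by
      refine (one_sub_cutoff_le _ _).trans ?_
      gcongr
      linarith [Real.add_one_le_exp (u.2.1 / 2)]
    calc gap ν u.1 u.2.2 * (1 - cutoff R u.2.1)
        ≤ H / χ ^ 2 * Real.exp (u.1 - 2 * u.2.1) * (2 * Real.exp (u.2.1 / 2) / R) :=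
          mul_le_mul hu.2 h3 h2 (by positivity)
      _ = 2 * H / χ ^ 2 / R * (Real.exp (u.1 - 2 * u.2.1) * Real.exp (u.2.1 / 2)) := by ring
      _ = _ := by
        rw [← Real.exp_add, decay]
        ring_nf
  have h4 := norm_integral_le_of_norm_le
    ((integrable_decay (α := 1 / 2) (β := 1) (by norm_num) (by norm_num) n).const_mul _) h1
  rw [integral_const_mul] at h4
  refine h4.trans ?_
  rw [le_div_iff₀ (wt_pos n)]
  have h5 := hA' (1 / 2) (by norm_num) (by norm_num) n
  calc 2 * H / χ ^ 2 / R * (∫ u, decay (1 / 2) 1 u ∂(pathLaw ν n)) * wt n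
      = 2 * H / χ ^ 2 / R * (wt n * ∫ u, decay (1 / 2) 1 u ∂(pathLaw ν n)) := by ring
    _ ≤ 2 * H / χ ^ 2 / R * (A / (1 / 2) ^ 2) := by gcongr
    _ = _ := by ring

/-- Law of an initial block and a final block of length `j`, and of a middle block of
length `m`. -/
def tripleLaw (ν : Measure (ℝ × ℝ)) (j m : ℕ) :
    Measure (((ℝ × ℝ × ℝ) × ℝ × ℝ × ℝ) × ℝ × ℝ × ℝ) :=
  ((pathLaw ν j).prod (pathLaw ν j)).prod (pathLaw ν m)

/-- Concatenation of the three blocks. -/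
def tripleJoin (p : ((ℝ × ℝ × ℝ) × ℝ × ℝ × ℝ) × ℝ × ℝ × ℝ) : ℝ × ℝ × ℝ :=
  joinFun p.1.1 (joinFun p.2 p.1.2)

/-- Weighted sum of the concatenated path without the contribution of the middle block. -/
def outerWeight (p : ((ℝ × ℝ × ℝ) × ℝ × ℝ × ℝ) × ℝ × ℝ × ℝ) : ℝ :=
  p.1.1.2.2 + Real.exp (p.1.1.1 + p.2.1) * p.1.2.2.2

instance (j m : ℕ) : IsProbabilityMeasure (tripleLaw ν j m) := by
  unfold tripleLaw; infer_instance

lemma measurable_tripleJoin : Measurable tripleJoin :=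
  measurable_joinFun_comp measurable_fst.fst
    (measurable_joinFun_comp measurable_snd measurable_fst.snd)

lemma measurable_outerWeight : Measurable outerWeight := by unfold outerWeight; fun_prop

lemma lintegral_tripleLaw (j m : ℕ)
    {f : ((ℝ × ℝ × ℝ) × ℝ × ℝ × ℝ) × ℝ × ℝ × ℝ → ENNReal} (hf : Measurable f) :
    ∫⁻ p, f p ∂(tripleLaw ν j m) = ∫⁻ u, ∫⁻ v, ∫⁻ w, f ((u, w), v)
      ∂(pathLaw ν j) ∂(pathLaw ν m) ∂(pathLaw ν j) := by
  rw [tripleLaw, lintegral_prod _ hf.aemeasurable,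
    lintegral_prod _ hf.lintegral_prod_right'.aemeasurable]
  refine lintegral_congr fun u => ?_
  rw [lintegral_lintegral_swap]
  exact (hf.comp (((measurable_const (a := u)).prodMk measurable_fst).prodMk
    measurable_snd)).aemeasurable

lemma map_tripleLaw (j m : ℕ) : (tripleLaw ν j m).map tripleJoin = pathLaw ν (j + (m + j)) := by
  refine Measure.ext_of_lintegral _ fun f hf => ?_
  rw [lintegral_map hf measurable_tripleJoin,
    lintegral_tripleLaw _ _ (f := fun p => f (tripleJoin p)) (hf.comp measurable_tripleJoin),
    lintegral_pathLaw_add _ _ hf]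
  refine lintegral_congr fun u => ?_
  rw [lintegral_pathLaw_add m j (f := fun v => f (joinFun u v))
    (hf.comp (measurable_joinFun_comp measurable_const measurable_id))]
  rfl

lemma StepLaw.ae_tripleLaw (h : StepLaw ν χ H) {j : ℕ} (hj : j ≠ 0) (m : ℕ) :
    ∀ᵐ p ∂(tripleLaw ν j m), χ ≤ p.1.1.2.2 ∧ 0 ≤ p.1.2.2.2 ∧ 0 ≤ p.2.2.2 ∧
      0 ≤ p.1.1.2.1 := by
  have h1 : ∀ᵐ q ∂((pathLaw ν j).prod (pathLaw ν j)),
      χ ≤ q.1.2.2 ∧ 0 ≤ q.1.2.1 ∧ 0 ≤ q.2.2.2 := by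
    filter_upwards [Measure.quasiMeasurePreserving_fst.ae (h.ae_le_weight hj),
      Measure.quasiMeasurePreserving_fst.ae (ae_pathLaw_max (ν := ν) j),
      Measure.quasiMeasurePreserving_snd.ae (h.ae_lower j)] with q a1 a2 a3
    exact ⟨a1, a2.1, a3.1⟩
  filter_upwards [Measure.quasiMeasurePreserving_fst.ae h1,
    Measure.quasiMeasurePreserving_snd.ae (h.ae_lower m)] with p a1 a2
  exact ⟨a1.1, a1.2.2, a2.1, a1.2.1⟩

lemma StepLaw.integrable_outer (h : StepLaw ν χ H) {R : ℝ} (hR : 0 < R) {j : ℕ} (hj : j ≠ 0)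
    (m : ℕ) : Integrable (fun p => gap ν (tripleJoin p).1 (outerWeight p) *
      cutoff R (tripleJoin p).2.1) (tripleLaw ν j m) := by
  have hχ := h.pos
  refine Integrable.of_bound (C := H / χ) ?_ ?_
  · exact ((measurable_gap.comp (measurable_tripleJoin.fst.prodMk measurable_outerWeight)).mul
      ((measurable_cutoff R).comp measurable_tripleJoin.snd.fst)).aestronglyMeasurable
  · filter_upwards [h.ae_tripleLaw hj m] with p hp
    have h1 : χ ≤ outerWeight p := by
      have := mul_nonneg (Real.exp_pos (p.1.1.1 + p.2.1)).le hp.2.1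
      unfold outerWeight
      linarith [hp.1]
    have h2 : 0 ≤ (tripleJoin p).2.1 := hp.2.2.2.trans (le_max_left _ _)
    rw [norm_mul, Real.norm_of_nonneg (cutoff_nonneg _ _),
      Real.norm_of_nonneg (h.gap_nonneg _ (hχ.le.trans h1))]
    exact (mul_le_of_le_one_right (h.gap_nonneg _ (hχ.le.trans h1))
      (cutoff_le_one hR h2)).trans (h.gap_le_const _ h1)

/-- The middle block contributes little to the weighted sum on paths with a bounded maximum. -/
lemma StepLaw.exists_middle_error_le (h : StepLaw ν χ H) {R : ℝ} (hR : 0 < R) :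
    ∃ K : ℝ, 0 ≤ K ∧ ∀ j m : ℕ, j ≠ 0 →
      |∫ u, gap ν u.1 u.2.2 * cutoff R u.2.1 ∂(pathLaw ν (j + m + j)) -
        ∫ p, gap ν (tripleJoin p).1 (outerWeight p) * cutoff R (tripleJoin p).2.1
          ∂(tripleLaw ν j m)| ≤ K * (∑' i, (wt (i + j))⁻¹) / wt (j + m + j) := by
  have hχ := h.pos
  have hH := h.one_le
  obtain ⟨K, hK, hK'⟩ := h.exists_middle_weight_le
  set c : ℝ := 2 * H / χ ^ 3 * Real.exp (5 / 2 * R) with hc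
  have hc0 : 0 ≤ c := by positivity
  refine ⟨c * K, by positivity, fun j m hj => ?_⟩
  have ht : 0 ≤ ∑' i, (wt (i + j))⁻¹ := tsum_nonneg fun i => (inv_pos.mpr (wt_pos _)).le
  have hw := wt_pos (j + m + j)
  have hmF : Measurable fun u : ℝ × ℝ × ℝ => gap ν u.1 u.2.2 * cutoff R u.2.1 :=
    measurable_gap_path.mul (by fun_prop)
  have h_integrable := h.integrable_gap_mul_cutoff hR (j + (m + j))
  rw [← map_tripleLaw] at h_integrable
  have h_integrable' : Integrable (fun p => gap ν (tripleJoin p).1 (tripleJoin p).2.2 *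
      cutoff R (tripleJoin p).2.1) (tripleLaw ν j m) := h_integrable.comp_measurable measurable_tripleJoin
  rw [add_assoc, ← map_tripleLaw, integral_map measurable_tripleJoin.aemeasurable
    hmF.aestronglyMeasurable, ← integral_sub h_integrable'
    (h.integrable_outer hR hj m), ← add_assoc, ← Real.norm_eq_abs]
  refine (norm_integral_le_lintegral_norm _).trans ?_
  refine ENNReal.toReal_le_of_le_ofReal (by positivity) ?_
  set E : ((ℝ × ℝ × ℝ) × ℝ × ℝ × ℝ) × ℝ × ℝ × ℝ → ENNReal := fun p =>
    ENNReal.ofReal p.2.2.2 * (ENNReal.ofReal (Real.exp p.1.1.1) *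
      ENNReal.ofReal (decay (3 / 2) 1 (tripleJoin p))) with hE
  have hEm : Measurable E := by
    have := (measurable_decay (3 / 2) 1).comp measurable_tripleJoin
    exact (by fun_prop : Measurable fun p : ((ℝ × ℝ × ℝ) × ℝ × ℝ × ℝ) × ℝ × ℝ × ℝ =>
      ENNReal.ofReal p.2.2.2).mul ((by fun_prop :
        Measurable fun p : ((ℝ × ℝ × ℝ) × ℝ × ℝ × ℝ) × ℝ × ℝ × ℝ =>
          ENNReal.ofReal (Real.exp p.1.1.1)).mul this.ennreal_ofReal)
  calc _ ≤ ∫⁻ p, ENNReal.ofReal c * E p ∂(tripleLaw ν j m) := by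
        refine lintegral_mono_ae ?_
        filter_upwards [h.ae_tripleLaw hj m] with p hp
        obtain ⟨b1, b3, b2, hM⟩ := hp
        simp only [hE]
        rw [← ENNReal.ofReal_mul (Real.exp_pos _).le, ← ENNReal.ofReal_mul b2,
          ← ENNReal.ofReal_mul hc0]
        refine ENNReal.ofReal_le_ofReal ?_
        have k1 := mul_nonneg (Real.exp_pos (p.1.1.1 + p.2.1)).le b3
        have k2 := mul_nonneg (Real.exp_pos p.1.1.1).le b2
        have k3 : χ ≤ outerWeight p := by unfold outerWeight; linarith
        have k4 : (tripleJoin p).2.2 = outerWeight p + Real.exp p.1.1.1 * p.2.2.2 := by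
          simp only [tripleJoin, joinFun, outerWeight, Real.exp_add]
          ring
        have k5 : 0 ≤ (tripleJoin p).2.1 := hM.trans (le_max_left _ _)
        have k6 := h.abs_gap_sub_le (tripleJoin p).1 (b := (tripleJoin p).2.2)
          (b' := outerWeight p) (by linarith) k3
        rw [k4, add_sub_cancel_left, abs_of_nonneg k2, ← k4] at k6
        have k7 := decay_pos (3 / 2) 1 (tripleJoin p)
        have k8 := Real.exp_pos p.1.1.1
        rw [← sub_mul, norm_mul, Real.norm_of_nonneg (cutoff_nonneg _ _), Real.norm_eq_abs]
        rcases le_or_gt R (tripleJoin p).2.1 with hRM | hRM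
        · rw [cutoff_eq_zero hR hRM, mul_zero]
          positivity
        · have k9 : Real.exp (tripleJoin p).1 ≤
              Real.exp (5 / 2 * R) * decay (3 / 2) 1 (tripleJoin p) := by
            rw [decay, ← Real.exp_add]
            refine Real.exp_le_exp.mpr ?_
            linarith
          calc _ ≤ |gap ν (tripleJoin p).1 (tripleJoin p).2.2 -
                gap ν (tripleJoin p).1 (outerWeight p)| * 1 := by
                gcongr
                exact cutoff_le_one hR k5
            _ ≤ 2 * H / χ ^ 3 * Real.exp (tripleJoin p).1 *
                (Real.exp p.1.1.1 * p.2.2.2) := by rw [mul_one]; exact k6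
            _ ≤ 2 * H / χ ^ 3 * (Real.exp (5 / 2 * R) * decay (3 / 2) 1 (tripleJoin p)) *
                (Real.exp p.1.1.1 * p.2.2.2) := by gcongr
            _ = _ := by rw [hc]; ring
    _ = ENNReal.ofReal c * ∫⁻ u, ∫⁻ v, ∫⁻ w, E ((u, w), v)
          ∂(pathLaw ν j) ∂(pathLaw ν m) ∂(pathLaw ν j) := by
        rw [lintegral_const_mul _ hEm, lintegral_tripleLaw _ _ hEm]
    _ ≤ ENNReal.ofReal c * ENNReal.ofReal (K * (∑' i, (wt (i + j))⁻¹) / wt (j + m + j)) :=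
        mul_le_mul_right (hK' j m) _
    _ = _ := by
        rw [← ENNReal.ofReal_mul hc0]
        congr 1
        ring

end StepLaw

section StepLaw

variable {ν : Measure (ℝ × ℝ)} [IsProbabilityMeasure ν] {χ H : ℝ}

lemma StepLaw.gap_mul_cutoff_outer_nonneg (h : StepLaw ν χ H) (R : ℝ)
    {p : ((ℝ × ℝ × ℝ) × ℝ × ℝ × ℝ) × ℝ × ℝ × ℝ} (h1 : χ ≤ p.1.1.2.2) (h3 : 0 ≤ p.1.2.2.2) :
    0 ≤ gap ν (tripleJoin p).1 (outerWeight p) * cutoff R (tripleJoin p).2.1 := by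
  have k1 := mul_nonneg (Real.exp_pos (p.1.1.1 + p.2.1)).le h3
  refine mul_nonneg (h.gap_nonneg _ ?_) (cutoff_nonneg _ _)
  unfold outerWeight
  linarith [h.pos]

lemma StepLaw.gap_mul_cutoff_outer_le (h : StepLaw ν χ H) {R : ℝ} (hR : 0 < R)
    {p : ((ℝ × ℝ × ℝ) × ℝ × ℝ × ℝ) × ℝ × ℝ × ℝ} (h1 : χ ≤ p.1.1.2.2) (h2 : 0 ≤ p.1.1.2.1)
    (h3 : 0 ≤ p.1.2.2.2) {c : ℝ} (hc0 : 0 ≤ c)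
    (hc : p.1.1.1 + p.2.2.1 ≤ R → Real.exp (p.1.1.1 + (p.2.1 + p.1.2.1)) ≤ c) :
    gap ν (tripleJoin p).1 (outerWeight p) * cutoff R (tripleJoin p).2.1 ≤ H / χ ^ 2 * c := by
  have hχ := h.pos
  have hH := h.one_le
  have k1 := mul_nonneg (Real.exp_pos (p.1.1.1 + p.2.1)).le h3
  have k2 : χ ≤ outerWeight p := by unfold outerWeight; linarith
  have k3 : p.1.1.1 + p.2.2.1 ≤ (tripleJoin p).2.1 :=
    le_max_of_le_right (add_le_add le_rfl (le_max_left _ _))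
  have k4 : 0 ≤ (tripleJoin p).2.1 := h2.trans (le_max_left _ _)
  rcases le_or_gt R (tripleJoin p).2.1 with hRM | hRM
  · rw [cutoff_eq_zero hR hRM, mul_zero]
    positivity
  · calc _ ≤ gap ν (tripleJoin p).1 (outerWeight p) :=
          mul_le_of_le_one_right (h.gap_nonneg _ (hχ.le.trans k2)) (cutoff_le_one hR k4)
      _ ≤ H / χ ^ 2 * Real.exp (tripleJoin p).1 := h.gap_le_exp _ k2
      _ ≤ H / χ ^ 2 * c := by
        gcongr
        exact hc (k3.trans hRM.le)

/-- Convergence for a fixed initial block and a fixed final block. -/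
lemma StepLaw.exists_tendsto_inner (h : StepLaw ν χ H) {R : ℝ} (hR : 0 < R)
    {q : (ℝ × ℝ × ℝ) × ℝ × ℝ × ℝ} (h1 : χ ≤ q.1.2.2) (h2 : 0 ≤ q.1.2.1) (h3 : 0 ≤ q.2.2.2) :
    ∃ l : ℝ, Tendsto (fun m => wt m * ∫ v, gap ν (tripleJoin (q, v)).1 (outerWeight (q, v)) *
      cutoff R (tripleJoin (q, v)).2.1 ∂(pathLaw ν m)) atTop (𝓝 l) := by
  refine tendsto_wt_mul_integral_of_le h.centred
    (f := fun x => gap ν (q.1.1 + (x.1 + q.2.1)) (q.1.2.2 + Real.exp (q.1.1 + x.1) * q.2.2.2) *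
      cutoff R (max q.1.2.1 (q.1.1 + max x.2 (x.1 + q.2.2.1)))) ?_
    (C := H / χ ^ 2 * Real.exp (q.1.1 + q.2.1 + 2 * (R - q.1.1))) fun s m hm hs => ?_
  · refine Continuous.mul ?_ (by fun_prop)
    refine h.continuousOn_gap.comp_continuous
      (f := fun x : ℝ × ℝ =>
        (q.1.1 + (x.1 + q.2.1), q.1.2.2 + Real.exp (q.1.1 + x.1) * q.2.2.2))
      (by fun_prop) fun x => ?_
    have := mul_nonneg (Real.exp_pos (q.1.1 + x.1)).le h3
    change χ ≤ q.1.2.2 + Real.exp (q.1.1 + x.1) * q.2.2.2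
    linarith
  · have k0 := h.gap_mul_cutoff_outer_nonneg R (p := (q, (s, m, 0))) h1 h3
    have k1 := h.gap_mul_cutoff_outer_le hR (p := (q, (s, m, 0))) h1 h2 h3
      (c := Real.exp (q.1.1 + q.2.1 + 2 * (R - q.1.1)) * Real.exp (-m - (m - s)))
      (by positivity) (fun hle => by
        rw [← Real.exp_add]
        refine Real.exp_le_exp.mpr ?_
        dsimp only at hle ⊢
        linarith)
    rw [← mul_assoc] at k1
    simp only [tripleJoin, joinFun, outerWeight] at k0 k1
    rw [abs_of_nonneg k0]
    exact k1

lemma StepLaw.exists_tendsto_outer (h : StepLaw ν χ H) {R : ℝ} (hR : 0 < R) {j : ℕ}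
    (hj : j ≠ 0) : ∃ l : ℝ, Tendsto (fun m => wt m * ∫ p, gap ν (tripleJoin p).1 (outerWeight p) *
      cutoff R (tripleJoin p).2.1 ∂(tripleLaw ν j m)) atTop (𝓝 l) := by
  have hχ := h.pos
  have hH := h.one_le
  obtain ⟨A, hA, hA'⟩ := wt_mul_integral_decay_le h.centred (β := 1) (by norm_num)
  set a : ℕ → (ℝ × ℝ × ℝ) × ℝ × ℝ × ℝ → ℝ := fun m q => wt m *
    ∫ v, gap ν (tripleJoin (q, v)).1 (outerWeight (q, v)) *
      cutoff R (tripleJoin (q, v)).2.1 ∂(pathLaw ν m) with ha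
  set B : ℝ := H / χ ^ 2 * (H ^ j * Real.exp (R + 1)) with hB
  have hB0 : 0 ≤ B := by positivity
  have hgood : ∀ᵐ q ∂((pathLaw ν j).prod (pathLaw ν j)),
      χ ≤ q.1.2.2 ∧ 0 ≤ q.1.2.1 ∧ 0 ≤ q.2.2.2 ∧ Real.exp q.2.1 ≤ H ^ j := by
    filter_upwards [Measure.quasiMeasurePreserving_fst.ae (h.ae_le_weight hj),
      Measure.quasiMeasurePreserving_fst.ae (ae_pathLaw_max (ν := ν) j),
      Measure.quasiMeasurePreserving_snd.ae (h.ae_lower j),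
      Measure.quasiMeasurePreserving_snd.ae (h.ae_exp_le_pow j)] with q a1 a2 a3 a4
    exact ⟨a1, a2.1, a3.1, a4⟩
  have hmeas : StronglyMeasurable fun p => gap ν (tripleJoin p).1 (outerWeight p) *
      cutoff R (tripleJoin p).2.1 :=
    ((measurable_gap.comp (measurable_tripleJoin.fst.prodMk measurable_outerWeight)).mul
      ((measurable_cutoff R).comp measurable_tripleJoin.snd.fst)).stronglyMeasurable
  have hlim : Tendsto (fun m => ∫ q, a m q ∂((pathLaw ν j).prod (pathLaw ν j))) atTop
      (𝓝 (∫ q, limUnder atTop (fun m => a m q) ∂((pathLaw ν j).prod (pathLaw ν j)))) := by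
    refine tendsto_integral_of_dominated_convergence
      (fun q => B * A * (2 * (1 + R) ^ 2 + 2 * q.1.1 ^ 2)) (fun m => ?_) ?_ (fun m => ?_) ?_
    · exact (hmeas.integral_prod_right'.const_mul _).aestronglyMeasurable
    · exact ((integrable_const _).add (((h.integrable_sq j).comp_fst _).const_mul 2)).const_mul _
    · filter_upwards [hgood] with q hq
      obtain ⟨h1, h2, h3, h4⟩ := hq
      set L : ℝ := max 0 (R - q.1.1) with hL
      have hL0 : 0 ≤ L := le_max_left _ _
      have hL1 : R - q.1.1 ≤ L := le_max_right _ _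
      have hL2 : L ≤ R + |q.1.1| :=
        max_le (by positivity) (by linarith [neg_abs_le q.1.1])
      have hα : 0 < (1 + L)⁻¹ := by positivity
      have hα1 : (1 + L)⁻¹ ≤ 1 := inv_le_one_of_one_le₀ (by linarith)
      have hbd : ∀ᵐ v ∂(pathLaw ν m), ‖gap ν (tripleJoin (q, v)).1 (outerWeight (q, v)) *
          cutoff R (tripleJoin (q, v)).2.1‖ ≤ B * decay (1 + L)⁻¹ 1 v := by
        filter_upwards [ae_pathLaw_max m] with v hv
        rw [Real.norm_of_nonneg (h.gap_mul_cutoff_outer_nonneg R (p := (q, v)) h1 h3), hB,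
          mul_assoc]
        refine h.gap_mul_cutoff_outer_le hR (p := (q, v)) h1 h2 h3
          (mul_nonneg (by positivity) (decay_pos _ _ _).le) fun hle => ?_
        dsimp only at hle ⊢
        have k1 : (1 + L)⁻¹ * v.2.1 ≤ 1 := by
          rw [inv_mul_le_iff₀ (by positivity)]
          linarith
        calc Real.exp (q.1.1 + (v.1 + q.2.1)) = Real.exp q.2.1 * Real.exp (q.1.1 + v.1) := by
              rw [← Real.exp_add]; ring_nf
          _ ≤ H ^ j * (Real.exp (R + 1) * decay (1 + L)⁻¹ 1 v) := by
              have k2 : Real.exp (q.1.1 + v.1) ≤ Real.exp (R + 1) * decay (1 + L)⁻¹ 1 v := by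
                rw [decay, ← Real.exp_add]
                exact Real.exp_le_exp.mpr (by linarith)
              exact mul_le_mul h4 k2 (Real.exp_pos _).le (by positivity)
          _ = _ := by ring
      have h5 := norm_integral_le_of_norm_le
        ((integrable_decay hα.le zero_le_one m).const_mul B) hbd
      rw [integral_const_mul] at h5
      have h6 := hA' _ hα hα1 m
      rw [inv_pow, div_inv_eq_mul] at h6
      simp only [ha]
      rw [norm_mul, Real.norm_of_nonneg (wt_pos m).le]
      calc _ ≤ wt m * (B * ∫ v, decay (1 + L)⁻¹ 1 v ∂(pathLaw ν m)) :=
            mul_le_mul_of_nonneg_left h5 (wt_pos m).le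
        _ = B * (wt m * ∫ v, decay (1 + L)⁻¹ 1 v ∂(pathLaw ν m)) := by ring
        _ ≤ B * (A * (1 + L) ^ 2) := by gcongr
        _ ≤ B * (A * (2 * (1 + R) ^ 2 + 2 * q.1.1 ^ 2)) := by
            gcongr
            have h7 : (1 + L) ^ 2 ≤ (1 + R + |q.1.1|) ^ 2 :=
              pow_le_pow_left₀ (by linarith) (by linarith) 2
            nlinarith [sq_nonneg (1 + R - |q.1.1|), sq_abs q.1.1]
        _ = _ := by ring
    · filter_upwards [hgood] with q hq
      exact tendsto_nhds_limUnder (h.exists_tendsto_inner hR hq.1 hq.2.1 hq.2.2.1)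
  refine ⟨_, hlim.congr fun m => ?_⟩
  simp only [ha]
  rw [integral_const_mul, tripleLaw, integral_prod _ (h.integrable_outer hR hj m)]

/-- The decrements of the survival probabilities are of order `n^{-3/2}` with a limiting
constant. -/
lemma StepLaw.exists_tendsto_gap (h : StepLaw ν χ H) :
    ∃ l : ℝ, Tendsto (fun n => wt n * ∫ u, gap ν u.1 u.2.2 ∂(pathLaw ν n)) atTop (𝓝 l) := by
  obtain ⟨C, hC, hC'⟩ := h.exists_cutoff_error_le
  refine exists_tendsto_of_approx fun ε hε => ?_
  set R : ℝ := 2 * (C + 1) / ε with hRdef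
  have hR : 0 < R := by positivity
  have hCR : C / R ≤ ε / 2 := by
    rw [div_le_iff₀ hR, hRdef]
    field_simp
    linarith
  obtain ⟨K, hK, hK'⟩ := h.exists_middle_error_le hR
  have h1 : Tendsto (fun j => K * ∑' i, (wt (i + j))⁻¹) atTop (𝓝 0) := by
    simpa using tendsto_tail_wt.const_mul K
  obtain ⟨j, hj0, hj⟩ := ((eventually_ne_atTop 0).and
    (h1.eventually (gt_mem_nhds (half_pos hε)))).exists
  obtain ⟨l, hl⟩ := h.exists_tendsto_outer hR hj0
  refine ⟨fun n => wt n * ∫ p, gap ν (tripleJoin p).1 (outerWeight p) *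
      cutoff R (tripleJoin p).2.1 ∂(tripleLaw ν j (n - 2 * j)), 1 * l, ?_, ?_⟩
  · refine ((tendsto_wt_ratio (2 * j)).mul (hl.comp (tendsto_sub_atTop_nat (2 * j)))).congr
      fun n => ?_
    have := (wt_pos (n - 2 * j)).ne'
    simp only [Function.comp]
    field_simp
  · filter_upwards [eventually_ge_atTop (2 * j)] with n hn
    have e1 := hC' R hR n
    have e2 := hK' j (n - 2 * j) hj0
    rw [show j + (n - 2 * j) + j = n by omega] at e2
    have hw := wt_pos n
    rw [← mul_sub, abs_mul, abs_of_pos hw, ← le_div_iff₀' hw]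
    refine (abs_sub_le _ _ _).trans ((add_le_add e1 e2).trans ?_)
    rw [← add_div]
    gcongr
    linarith

end StepLaw

section StepLaw

variable {ν : Measure (ℝ × ℝ)} [IsProbabilityMeasure ν] {χ H : ℝ}

lemma pathLaw_append (n : ℕ) : pathLaw ν (n + 1) =
    ((pathLaw ν n).prod ν).map fun p => joinFun p.1 (stepFun p.2 (0, 0, 0)) := by
  have hs : Measurable fun ξ : ℝ × ℝ => stepFun ξ (0, 0, 0) :=
    measurable_stepFun.comp (measurable_id.prodMk measurable_const)
  have hm : Measurable fun p : (ℝ × ℝ × ℝ) × ℝ × ℝ => joinFun p.1 (stepFun p.2 (0, 0, 0)) :=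
    measurable_joinFun_comp measurable_fst (hs.comp measurable_snd)
  refine Measure.ext_of_lintegral _ fun f hf => ?_
  rw [lintegral_pathLaw_add n 1 hf, lintegral_map hf hm, lintegral_prod _ (by fun_prop)]
  refine lintegral_congr fun u => ?_
  have hu : Measurable fun v => f (joinFun u v) :=
    hf.comp (measurable_joinFun_comp measurable_const measurable_id)
  rw [← zero_add 1, lintegral_pathLaw_succ 0 hu]
  simp_rw [lintegral_pathLaw_zero]

/-- Survival probability expressed through the environment. -/
def survival (ν : Measure (ℝ × ℝ)) (n : ℕ) : ℝ :=
  ∫ u, (Real.exp u.1 + u.2.2)⁻¹ ∂(pathLaw ν n)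

lemma StepLaw.integrable_inv (h : StepLaw ν χ H) (n : ℕ) :
    Integrable (fun u => (Real.exp u.1 + u.2.2)⁻¹) (pathLaw ν n) := by
  have hχ := h.pos
  refine Integrable.of_bound (C := χ⁻¹) (by fun_prop) ?_
  filter_upwards [h.ae_lower n, ae_pathLaw_max n] with u hu hM
  have h1 : χ ≤ Real.exp u.1 + u.2.2 := by
    refine le_trans ?_ hu.2
    have := Real.one_le_exp hM.1
    nlinarith
  rw [Real.norm_of_nonneg (inv_nonneg.mpr (hχ.le.trans h1))]
  gcongr

lemma StepLaw.survival_sub_succ (h : StepLaw ν χ H) (n : ℕ) :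
    survival ν n - survival ν (n + 1) = ∫ u, gap ν u.1 u.2.2 ∂(pathLaw ν n) := by
  have hs : Measurable fun ξ : ℝ × ℝ => stepFun ξ (0, 0, 0) :=
    measurable_stepFun.comp (measurable_id.prodMk measurable_const)
  have hm : Measurable fun p : (ℝ × ℝ × ℝ) × ℝ × ℝ => joinFun p.1 (stepFun p.2 (0, 0, 0)) :=
    measurable_joinFun_comp measurable_fst (hs.comp measurable_snd)
  have hi := h.integrable_inv (n + 1)
  rw [pathLaw_append, integrable_map_measure (by fun_prop) hm.aemeasurable,
    Function.comp_def] at hi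
  rw [survival, survival, pathLaw_append, integral_map hm.aemeasurable (by fun_prop)]
  have hi0 : Integrable (fun p : (ℝ × ℝ × ℝ) × ℝ × ℝ => (Real.exp p.1.1 + p.1.2.2)⁻¹)
      ((pathLaw ν n).prod ν) := (h.integrable_inv n).comp_fst ν
  have e1 : ∫ u, (Real.exp u.1 + u.2.2)⁻¹ ∂(pathLaw ν n) =
      ∫ p, (Real.exp p.1.1 + p.1.2.2)⁻¹ ∂((pathLaw ν n).prod ν) := by
    rw [integral_prod _ hi0]
    simp
  rw [e1, ← integral_sub hi0 hi]
  refine (integral_prod _ (hi0.sub hi)).trans ?_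
  refine integral_congr_ae (Eventually.of_forall fun u => ?_)
  refine integral_congr_ae (Eventually.of_forall fun ξ => ?_)
  simp only [Pi.sub_apply, joinFun, stepFun, mul_zero, add_zero, Real.exp_add]
  ring_nf

lemma inv_sq_ge {y l : ℝ} (hy : 0 < y) (hl : 0 < l) :
    (l ^ 2)⁻¹ * (3 - 2 / l * y) ≤ (y ^ 2)⁻¹ := by
  rw [← sub_nonneg]
  have : (y ^ 2)⁻¹ - (l ^ 2)⁻¹ * (3 - 2 / l * y) =
      (y - l) ^ 2 * (2 * y + l) / (y ^ 2 * l ^ 3) := by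
    field_simp
    ring
  rw [this]
  positivity

lemma StepLaw.exists_weighted_decay_le (h : StepLaw ν χ H) : ∃ K : ℝ, 0 ≤ K ∧ ∀ n,
    Integrable (fun u => decay (3 / 2) 1 u * (Real.exp u.1 + u.2.2)) (pathLaw ν n) ∧
    wt n * ∫ u, decay (3 / 2) 1 u * (Real.exp u.1 + u.2.2) ∂(pathLaw ν n) ≤ K := by
  obtain ⟨C, hC, hC'⟩ := wt_mul_integral_decay_le h.centred (β := 2) (by norm_num)
  obtain ⟨K, hK, hK'⟩ := h.exists_middle_weight_le
  set K₀ : ℝ := K * ∑' i, (wt i)⁻¹ with hK₀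
  have hK₀' : 0 ≤ K₀ := mul_nonneg hK (tsum_nonneg fun i => (inv_pos.mpr (wt_pos i)).le)
  refine ⟨C / (1 / 2) ^ 2 + K₀, by positivity, fun n => ?_⟩
  have hw := wt_pos n
  have e1 : ∀ u : ℝ × ℝ × ℝ, decay (3 / 2) 1 u * Real.exp u.1 = decay (1 / 2) 2 u := fun u => by
    rw [decay, decay, ← Real.exp_add]
    ring_nf
  have i1 : Integrable (fun u => decay (3 / 2) 1 u * Real.exp u.1) (pathLaw ν n) := by
    simp_rw [e1]
    exact integrable_decay (by norm_num) (by norm_num) n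
  have hl : ∫⁻ u, ENNReal.ofReal (decay (3 / 2) 1 u * u.2.2) ∂(pathLaw ν n) ≤
      ENNReal.ofReal (K₀ / wt n) := by
    have := hK' 0 n
    simp only [lintegral_pathLaw_zero, add_zero, zero_add, Real.exp_zero, ENNReal.ofReal_one,
      one_mul] at this
    refine le_trans (le_of_eq (lintegral_congr_ae ?_)) this
    filter_upwards [ae_pathLaw_max n] with u hu
    have e : decay (3 / 2) 1 (joinFun (0, 0, 0) (joinFun u (0, 0, 0))) = decay (3 / 2) 1 u := by
      simp [joinFun, decay, hu.1, hu.2]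
    rw [e, mul_comm, ENNReal.ofReal_mul' (decay_pos _ _ _).le]
  have hnn : ∀ᵐ u ∂(pathLaw ν n), 0 ≤ decay (3 / 2) 1 u * u.2.2 := by
    filter_upwards [h.ae_lower n] with u hu
    exact mul_nonneg (decay_pos _ _ _).le hu.1
  have i2 : Integrable (fun u => decay (3 / 2) 1 u * u.2.2) (pathLaw ν n) := by
    refine ⟨by fun_prop, ?_⟩
    rw [hasFiniteIntegral_iff_ofReal hnn]
    exact hl.trans_lt ENNReal.ofReal_lt_top
  have l2 : ∫ u, decay (3 / 2) 1 u * u.2.2 ∂(pathLaw ν n) ≤ K₀ / wt n := by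
    rw [integral_eq_lintegral_of_nonneg_ae hnn (by fun_prop)]
    exact ENNReal.toReal_le_of_le_ofReal (by positivity) hl
  simp only [mul_add]
  refine ⟨i1.add i2, ?_⟩
  rw [integral_add i1 i2, mul_add]
  refine add_le_add ?_ ?_
  · simp_rw [e1]
    exact hC' _ (by norm_num) (by norm_num) n
  · exact (le_div_iff₀' hw).mp l2

lemma StepLaw.exists_le_gap (h : StepLaw ν χ H) : ∃ c : ℝ, 0 < c ∧
    ∀ᶠ n in atTop, c ≤ wt n * ∫ u, gap ν u.1 u.2.2 ∂(pathLaw ν n) := by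
  have hχ := h.pos
  have hH : 0 < H := zero_lt_one.trans_le h.one_le
  obtain ⟨c, hc, hc'⟩ := exists_le_wt_mul_integral_decay h.centred (α := 3 / 2) (β := 1)
    (by norm_num) (by norm_num)
  obtain ⟨K, hK, hK'⟩ := h.exists_weighted_decay_le
  set l : ℝ := 2 * (K + 1) / c with hl
  have hl0 : 0 < l := by positivity
  have hlK : 2 / l * K ≤ c := by
    rw [hl, div_mul_eq_mul_div, div_le_iff₀ (by positivity)]
    field_simp
    linarith
  refine ⟨χ / H * ((l ^ 2)⁻¹ * (2 * c)), by positivity, ?_⟩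
  filter_upwards [hc'] with n hn
  obtain ⟨i2, h2⟩ := hK' n
  have i1 : Integrable (decay (3 / 2) 1) (pathLaw ν n) :=
    integrable_decay (by norm_num) (by norm_num) n
  have hle : ∫ u, χ / H * ((l ^ 2)⁻¹ * (3 * decay (3 / 2) 1 u -
      2 / l * (decay (3 / 2) 1 u * (Real.exp u.1 + u.2.2)))) ∂(pathLaw ν n) ≤
      ∫ u, gap ν u.1 u.2.2 ∂(pathLaw ν n) := by
    refine integral_mono_ae ((((i1.const_mul _).sub (i2.const_mul _)).const_mul _).const_mul _)
      (h.integrable_gap_path n) ?_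
    filter_upwards [h.ae_lower n, ae_pathLaw_max n] with u hu hM
    refine le_trans ?_ (h.le_gap u.1 hu.1)
    have hd := decay_pos (3 / 2) 1 u
    have hde : decay (3 / 2) 1 u ≤ Real.exp u.1 :=
      Real.exp_le_exp.mpr (by linarith [hM.1])
    have hy : 0 < Real.exp u.1 + u.2.2 := add_pos_of_pos_of_nonneg (Real.exp_pos _) hu.1
    refine mul_le_mul_of_nonneg_left ?_ (by positivity)
    calc _ = decay (3 / 2) 1 u * ((l ^ 2)⁻¹ * (3 - 2 / l * (Real.exp u.1 + u.2.2))) := by ring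
      _ ≤ decay (3 / 2) 1 u * ((Real.exp u.1 + u.2.2) ^ 2)⁻¹ :=
        mul_le_mul_of_nonneg_left (inv_sq_ge hy hl0) hd.le
      _ ≤ Real.exp u.1 * ((Real.exp u.1 + u.2.2) ^ 2)⁻¹ := by gcongr
      _ = _ := (div_eq_mul_inv _ _).symm
  rw [integral_const_mul, integral_const_mul,
    integral_sub (i1.const_mul _) (i2.const_mul _), integral_const_mul, integral_const_mul] at hle
  refine le_trans ?_ (mul_le_mul_of_nonneg_left hle (wt_pos n).le)
  have h3 := (mul_le_mul_of_nonneg_left h2 (by positivity : 0 ≤ 2 / l)).trans hlK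
  calc χ / H * ((l ^ 2)⁻¹ * (2 * c)) ≤ χ / H * ((l ^ 2)⁻¹ *
        (3 * (wt n * ∫ u, decay (3 / 2) 1 u ∂(pathLaw ν n)) - 2 / l *
        (wt n * ∫ u, decay (3 / 2) 1 u * (Real.exp u.1 + u.2.2) ∂(pathLaw ν n)))) := by
        gcongr
        linarith
    _ = _ := by ring

/-- The decrements of the survival probabilities decay exactly like `n^{-3/2}`. -/
lemma StepLaw.exists_tendsto_survival_sub (h : StepLaw ν χ H) : ∃ c : ℝ, 0 < c ∧
    Tendsto (fun n : ℕ => (survival ν n - survival ν (n + 1)) / (n : ℝ) ^ (-(3 : ℝ) / 2)) atTop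
      (𝓝 c) := by
  obtain ⟨l, hl⟩ := h.exists_tendsto_gap
  obtain ⟨c, hc, hc'⟩ := h.exists_le_gap
  have hl0 : 0 < l := hc.trans_le (ge_of_tendsto hl hc')
  refine ⟨l, hl0, ?_⟩
  have h1 : Tendsto (fun n : ℕ => wt (n - 1) / wt n) atTop (𝓝 1) := by
    simpa using (tendsto_wt_ratio 1).inv₀ one_ne_zero
  rw [← one_mul l]
  refine (h1.mul hl).congr' ?_
  filter_upwards [eventually_gt_atTop 0] with n hn
  have hw := (wt_pos n).ne'
  have hn' : (0 : ℝ) < n := by exact_mod_cast hn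
  have e : wt (n - 1) = (n : ℝ) ^ ((3 : ℝ) / 2) := by
    rw [wt_eq_rpow, Nat.cast_sub hn]
    simp
  rw [h.survival_sub_succ, e, neg_div, Real.rpow_neg hn'.le, div_inv_eq_mul]
  field_simp

end StepLaw

lemma measurable_tsum_of_nonneg {α : Type*} [MeasurableSpace α] {f : ℕ → α → ℝ}
    (hf : ∀ i, Measurable (f i)) (h0 : ∀ i a, 0 ≤ f i a) : Measurable fun a => ∑' i, f i a := by
  have e : (fun a => ∑' i, f i a) = fun a => (∑' i, ENNReal.ofReal (f i a)).toReal := by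
    funext a
    rw [ENNReal.tsum_toReal_eq fun i => ENNReal.ofReal_ne_top]
    simp_rw [ENNReal.toReal_ofReal (h0 _ a)]
  rw [e]
  exact (Measurable.tsum fun i => (hf i).ennreal_ofReal).ennreal_toReal

/-- The pair `(-log m(q), f''(1) / (2 f'(1)^2))` attached to an offspring law `q`. -/
def offspringMarks (q : Measure ℕ) : ℝ × ℝ :=
  (-Real.log (∑' i : ℕ, (i : ℝ) * (q {i}).toReal),
    (∑' i : ℕ, ((i : ℝ) * ((i : ℝ) - 1)) * (q {i}).toReal) /
      (2 * (∑' i : ℕ, (i : ℝ) * (q {i}).toReal) ^ 2))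

lemma measurable_offspringMarks : Measurable offspringMarks := by
  have hq : ∀ i : ℕ, Measurable fun q : Measure ℕ => (q {i}).toReal := fun i =>
    (Measure.measurable_coe (measurableSet_singleton i)).ennreal_toReal
  have h1 : Measurable fun q : Measure ℕ => ∑' i : ℕ, (i : ℝ) * (q {i}).toReal :=
    measurable_tsum_of_nonneg (fun i => (hq i).const_mul _) fun i q => by positivity
  have h2 : Measurable fun q : Measure ℕ =>
      ∑' i : ℕ, ((i : ℝ) * ((i : ℝ) - 1)) * (q {i}).toReal := by
    refine measurable_tsum_of_nonneg (fun i => (hq i).const_mul _) fun i q => ?_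
    refine mul_nonneg ?_ ENNReal.toReal_nonneg
    rcases i with _ | i
    · simp
    · push_cast
      rw [add_sub_cancel_right]
      positivity
  exact (Real.measurable_log.comp h1).neg.prodMk (h2.div ((h1.pow_const 2).const_mul 2))

section Environment

variable {Q : ℕ → Ω → Measure ℕ}

omit [MeasurableSpace Ω] in
lemma offspringMarks_env (n : ℕ) (ω : Ω) :
    offspringMarks (Q n ω) = (-(Xenv Q n ω), etaEnv Q n ω) := rfl

omit [MeasurableSpace Ω] in
lemma Senv_succ (n : ℕ) (ω : Ω) : Senv Q (n + 1) ω = Senv Q n ω + Xenv Q (n + 1) ω := by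
  simp only [Senv, walk]
  exact Finset.sum_Icc_succ_top (by omega) _

omit [MeasurableSpace Ω] in
lemma bEnv_succ (n : ℕ) (ω : Ω) : bEnv Q (n + 1) ω =
    bEnv Q n ω + etaEnv Q (n + 1) ω * Real.exp (-(Senv Q n ω)) :=
  Finset.sum_range_succ _ _

omit [MeasurableSpace Ω] in
/-- Composition of fractional linear generating functions:
`1 / (1 - f_{0,n}(s)) = e^{-S_n} / (1 - s) + b_n`. -/
lemma inv_one_sub_pgfComp (hfrac : FracLinear Q) {ω : Ω} (hη : ∀ n, 1 ≤ n → 0 < etaEnv Q n ω)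
    (n : ℕ) {s : ℝ} (hs : 0 ≤ s) (hs1 : s < 1) :
    (1 - pgfComp Q 0 n ω s)⁻¹ = Real.exp (-(Senv Q n ω)) / (1 - s) + bEnv Q n ω := by
  induction n generalizing s with
  | zero => simp [pgfComp, Senv, walk, bEnv]
  | succ n ih =>
    have h1 := hfrac (n + 1) (by omega) ω s hs hs1
    have h2 : 0 < (1 - pgf Q (n + 1) ω s)⁻¹ := by
      rw [h1]
      exact add_pos (div_pos (Real.exp_pos _) (by linarith)) (hη _ (by omega))
    have h3 : pgf Q (n + 1) ω s < 1 := by linarith [inv_pos.mp h2]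
    have h4 : 0 ≤ pgf Q (n + 1) ω s :=
      tsum_nonneg fun i => mul_nonneg ENNReal.toReal_nonneg (pow_nonneg hs i)
    rw [pgfComp, if_neg (by omega), ih h4 h3, div_eq_mul_inv, h1, Senv_succ, bEnv_succ, neg_add,
      Real.exp_add]
    ring

variable {μ : Measure Ω} [IsProbabilityMeasure μ]

/-- Law of the pair `(-X_1, η_1)`. -/
def envLaw (μ : Measure Ω) (Q : ℕ → Ω → Measure ℕ) : Measure (ℝ × ℝ) :=
  μ.map fun ω => offspringMarks (Q 1 ω)

omit [MeasurableSpace Ω] in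
lemma measurable_pair_envFiltration {n : ℕ} :
    Measurable[envFiltration Q n] fun ω => (-(Senv Q n ω), bEnv Q n ω) := by
  have hm : ∀ i, i ∈ Finset.Icc 1 n →
      Measurable[envFiltration Q n] fun ω => offspringMarks (Q i ω) := fun i hi =>
    measurable_offspringMarks.comp ((comap_measurable (Q i)).mono
      (le_iSup₂_of_le (f := fun i _ => MeasurableSpace.comap (Q i) inferInstance) i hi le_rfl)
      le_rfl)
  let _ := envFiltration Q n
  have hS : ∀ k, k ≤ n → Measurable fun ω => -(Senv Q k ω) := fun k hk => by
    unfold Senv walk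
    simp_rw [← Finset.sum_neg_distrib]
    exact Finset.measurable_sum _ fun i hi => (hm i (by simp at hi ⊢; omega)).fst
  refine (hS n le_rfl).prodMk ?_
  unfold bEnv
  refine Finset.measurable_sum _ fun i hi => ?_
  have hi' := Finset.mem_range.mp hi
  exact (hm (i + 1) (by simp; omega)).snd.mul (Real.measurable_exp.comp (hS i hi'.le))

lemma envFiltration_le (hQ : ∀ i, Measurable (Q i)) (n : ℕ) :
    envFiltration Q n ≤ ‹MeasurableSpace Ω› :=
  iSup₂_le fun i _ => (hQ i).comap_le

omit [IsProbabilityMeasure μ] in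
lemma indepFun_pair_marks (hiid : IIDseq μ Q) (n : ℕ) :
    IndepFun (fun ω => (-(Senv Q n ω), bEnv Q n ω)) (fun ω => offspringMarks (Q (n + 1) ω)) μ := by
  obtain ⟨hQ, hind, -⟩ := hiid
  have h1 := indep_iSup_of_disjoint (fun i => (hQ i).comap_le) hind
    (S := (Finset.Icc 1 n : Set ℕ)) (T := {n + 1}) (by simp)
  refine indep_of_indep_of_le_left (indep_of_indep_of_le_right h1 ?_) ?_
  · simp only [mem_singleton_iff, iSup_iSup_eq_left]
    exact (measurable_offspringMarks.comp (comap_measurable (Q (n + 1)))).comap_le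
  · exact measurable_pair_envFiltration.comap_le

lemma map_pair_eq_map_pathLaw (hiid : IIDseq μ Q) (n : ℕ) :
    μ.map (fun ω => (-(Senv Q n ω), bEnv Q n ω)) =
      (pathLaw (envLaw μ Q) n).map fun u => (u.1, u.2.2) := by
  have hQ := hiid.1
  have hmk : ∀ i, Measurable fun ω => offspringMarks (Q i ω) := fun i =>
    measurable_offspringMarks.comp (hQ i)
  have : IsProbabilityMeasure (envLaw μ Q) := Measure.isProbabilityMeasure_map (hmk 1).aemeasurable
  have hpr : Measurable fun u : ℝ × ℝ × ℝ => (u.1, u.2.2) := by fun_prop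
  induction n with
  | zero =>
    rw [pathLaw, Measure.map_dirac' hpr]
    simp [Senv, walk, bEnv]
  | succ n ih =>
    set G : (ℝ × ℝ) × ℝ × ℝ → ℝ × ℝ :=
      fun p => (p.1.1 + p.2.1, p.1.2 + p.2.2 * Real.exp p.1.1) with hG
    have hGm : Measurable G := by fun_prop
    have hpair : Measurable fun ω => (-(Senv Q n ω), bEnv Q n ω) :=
      measurable_pair_envFiltration.mono (envFiltration_le hQ n) le_rfl
    have hj : Measurable fun p : (ℝ × ℝ × ℝ) × ℝ × ℝ => joinFun p.1 (stepFun p.2 (0, 0, 0)) :=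
      measurable_joinFun_comp measurable_fst
        (measurable_stepFun.comp (measurable_snd.prodMk measurable_const))
    have hlaw : μ.map (fun ω => offspringMarks (Q (n + 1) ω)) = envLaw μ Q :=
      ((hiid.2.2 (n + 1)).comp measurable_offspringMarks).map_eq
    calc μ.map (fun ω => (-(Senv Q (n + 1) ω), bEnv Q (n + 1) ω))
        = (μ.map fun ω => ((-(Senv Q n ω), bEnv Q n ω), offspringMarks (Q (n + 1) ω))).map G := by
          rw [Measure.map_map hGm (hpair.prodMk (hmk _))]
          congr 1
          funext ω
          simp only [hG, Function.comp, offspringMarks_env, Senv_succ, bEnv_succ, neg_add]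
      _ = (((pathLaw (envLaw μ Q) n).map fun u => (u.1, u.2.2)).prod (envLaw μ Q)).map G := by
          rw [(indepFun_iff_map_prod_eq_prod_map_map hpair.aemeasurable
            (hmk _).aemeasurable).mp (indepFun_pair_marks hiid n), ih, hlaw]
      _ = (pathLaw (envLaw μ Q) (n + 1)).map fun u => (u.1, u.2.2) := by
          have e := Measure.map_prod_map (pathLaw (envLaw μ Q) n) (envLaw μ Q) hpr measurable_id
          rw [Measure.map_id] at e
          rw [e, Measure.map_map hGm (hpr.prodMap measurable_id), pathLaw_append,
            Measure.map_map hpr hj]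
          congr 1
          funext p
          simp [hG, joinFun, stepFun, mul_comm]

omit [IsProbabilityMeasure μ] in
lemma CentredWalk.of_neg {X : Ω → ℝ} (hX : Measurable X) (h0 : ∫ ω, X ω ∂μ = 0)
    (h2 : Integrable (fun ω => X ω ^ 2) μ) (hpos : 0 < ∫ ω, X ω ^ 2 ∂μ)
    (hnl : NonLattice (μ.map X)) : CentredWalk (μ.map fun ω => -(X ω)) where
  mean := by
    rw [integral_map hX.fun_neg.aemeasurable (by fun_prop), integral_neg, h0, neg_zero]
  sq := by
    rw [integrable_map_measure (by fun_prop) hX.fun_neg.aemeasurable]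
    simpa [Function.comp_def] using h2
  var := by
    rw [integral_map hX.fun_neg.aemeasurable (by fun_prop)]
    simpa using hpos
  nonLattice := by
    rintro ⟨a, d, had⟩
    refine hnl ⟨-a, -d, ?_⟩
    have e : μ.map (fun ω => -(X ω)) = (μ.map X).map (MeasurableEquiv.neg ℝ) := by
      rw [Measure.map_map (MeasurableEquiv.neg ℝ).measurable hX]
      rfl
    rw [e, MeasurableEquiv.map_apply] at had
    rw [← had]
    congr 1
    ext x
    change (∃ k : ℤ, x = -a + k * -d) ↔ ∃ k : ℤ, -x = a + k * d
    refine exists_congr fun k => ⟨fun h => ?_, fun h => ?_⟩ <;> linarith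

omit [IsProbabilityMeasure μ] in
lemma stepLaw_envLaw (hiid : IIDseq μ Q) (hfrac : FracLinear Q) {χ : ℝ}
    (hA1 : AssumptionA1With μ Q χ) (hA2 : AssumptionA2 μ Q) :
    StepLaw (envLaw μ Q) χ χ⁻¹ := by
  obtain ⟨hχ, hχ2, hA⟩ := hA1
  obtain ⟨-, h0, h2, hpos, hnl⟩ := hA2
  have hmk : Measurable fun ω => offspringMarks (Q 1 ω) :=
    measurable_offspringMarks.comp (hiid.1 1)
  have hX : Measurable (Xenv Q 1) := by
    have h : Measurable fun ω => -(-(Xenv Q 1 ω)) := hmk.fst.fun_neg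
    simpa using h
  refine ⟨?_, hχ, by linarith, ?_⟩
  · rw [envLaw, Measure.map_map measurable_fst hmk]
    exact CentredWalk.of_neg hX h0 h2 hpos hnl
  · rw [envLaw, ae_map_iff hmk.aemeasurable (by measurability)]
    filter_upwards [hA 1 le_rfl] with ω hω
    obtain ⟨h1, h3, h4⟩ := hω
    have e := hfrac 1 le_rfl ω 0 le_rfl one_pos
    rw [sub_zero, div_one] at e
    simp only [offspringMarks_env]
    rw [← e]
    refine ⟨h4, ?_, ?_⟩
    · rw [le_inv_comm₀ (by linarith) (by linarith), inv_eq_one_div, le_div_iff₀ (by linarith)]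
      nlinarith
    · exact inv_anti₀ hχ (by linarith)

lemma integral_inv_env (hiid : IIDseq μ Q) (n : ℕ) :
    ∫ ω, (Real.exp (-(Senv Q n ω)) + bEnv Q n ω)⁻¹ ∂μ = survival (envLaw μ Q) n := by
  have hpair : Measurable fun ω => (-(Senv Q n ω), bEnv Q n ω) :=
    measurable_pair_envFiltration.mono (envFiltration_le hiid.1 n) le_rfl
  have h1 : ∫ ω, (Real.exp (-(Senv Q n ω)) + bEnv Q n ω)⁻¹ ∂μ =
      ∫ p, (Real.exp p.1 + p.2)⁻¹ ∂(μ.map fun ω => (-(Senv Q n ω), bEnv Q n ω)) :=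
    (integral_map hpair.aemeasurable (f := fun p : ℝ × ℝ => (Real.exp p.1 + p.2)⁻¹)
      (by fun_prop)).symm
  rw [h1, map_pair_eq_map_pathLaw hiid, integral_map (by fun_prop) (by fun_prop), survival]

/-- The probability of extinction by time `n`. -/
lemma real_extinct_eq {Z : ℕ → Ω → ℕ} (hiid : IIDseq μ Q) (hfrac : FracLinear Q)
    (hbranch : BranchingProperty μ Q Z) {χ : ℝ} (hA1 : AssumptionA1With μ Q χ)
    (hA2 : AssumptionA2 μ Q) (n : ℕ) :
    μ.real {ω | Z n ω = 0} = 1 - survival (envLaw μ Q) n := by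
  obtain ⟨hZ0, hZm, -, hcond⟩ := hbranch
  have hs : MeasurableSet {ω | Z n ω = 0} := hZm n (measurableSet_singleton 0)
  have hle : envSigma Q ⊔ MeasurableSpace.comap (Z 0) inferInstance ≤ ‹MeasurableSpace Ω› :=
    sup_le (iSup_le fun i => (hiid.1 (i + 1)).comap_le) (hZm 0).comap_le
  have h1 : μ.real {ω | Z n ω = 0} = ∫ ω, (0 : ℝ) ^ Z n ω ∂μ := by
    rw [← integral_indicator_one hs]
    refine integral_congr_ae (Eventually.of_forall fun ω => ?_)
    by_cases h : Z n ω = 0 <;> simp [h]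
  have hη : ∀ᵐ ω ∂μ, ∀ m, 1 ≤ m → 0 < etaEnv Q m ω := by
    rw [ae_all_iff]
    intro m
    by_cases hm : 1 ≤ m
    · filter_upwards [hA1.2.2 m hm] with ω hω _
      exact hA1.1.trans_le hω.2.2
    · exact Eventually.of_forall fun ω h => absurd h hm
  have hpair : Measurable fun ω => (-(Senv Q n ω), bEnv Q n ω) :=
    measurable_pair_envFiltration.mono (envFiltration_le hiid.1 n) le_rfl
  have : IsProbabilityMeasure (envLaw μ Q) :=
    Measure.isProbabilityMeasure_map (measurable_offspringMarks.comp (hiid.1 1)).aemeasurable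
  have h_integrable : Integrable (fun ω => (Real.exp (-(Senv Q n ω)) + bEnv Q n ω)⁻¹) μ := by
    have h2 := (stepLaw_envLaw hiid hfrac hA1 hA2).integrable_inv n
    have h3 : Integrable (fun p : ℝ × ℝ => (Real.exp p.1 + p.2)⁻¹)
        ((pathLaw (envLaw μ Q) n).map fun u => (u.1, u.2.2)) := by
      rw [integrable_map_measure (by fun_prop) (by fun_prop)]
      exact h2
    rw [← map_pair_eq_map_pathLaw hiid] at h3
    exact h3.comp_measurable hpair
  rw [h1, ← integral_condExp hle, integral_congr_ae (hcond 0 n n.zero_le 0 le_rfl zero_le_one),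
    ← integral_inv_env hiid]
  have h2 : (1 : ℝ) - ∫ ω, (Real.exp (-(Senv Q n ω)) + bEnv Q n ω)⁻¹ ∂μ =
      ∫ ω, (1 - (Real.exp (-(Senv Q n ω)) + bEnv Q n ω)⁻¹) ∂μ := by
    rw [integral_sub (integrable_const _) h_integrable]
    simp
  rw [h2]
  refine integral_congr_ae (hη.mono fun ω hω => ?_)
  have h3 := inv_one_sub_pgfComp hfrac hω n le_rfl one_pos
  rw [sub_zero, div_one] at h3
  simp only [hZ0, pow_one]
  rw [← h3, inv_inv]
  ring

omit [MeasurableSpace Ω] in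
lemma setOf_extinctTime_eq {Z : ℕ → Ω → ℕ} (hZ : ∀ n ω, Z n ω = 0 → Z (n + 1) ω = 0) (n : ℕ) :
    {ω | extinctTime Z ω = n + 1} = {ω | Z (n + 1) ω = 0} \ {ω | Z n ω = 0} := by
  have habs : ∀ ω k m, k ≤ m → Z k ω = 0 → Z m ω = 0 := fun ω k m hkm hk => by
    induction m, hkm using Nat.le_induction with
    | base => exact hk
    | succ m _ ih => exact hZ m ω ih
  ext ω
  change sInf {k | Z k ω = 0} = n + 1 ↔ Z (n + 1) ω = 0 ∧ ¬ Z n ω = 0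
  constructor
  · intro h
    have hne : {k | Z k ω = 0}.Nonempty := Nat.nonempty_of_pos_sInf (by omega)
    have h1 := Nat.sInf_mem hne
    rw [h] at h1
    exact ⟨h1, Nat.notMem_of_lt_sInf (s := {k | Z k ω = 0}) (by omega)⟩
  · rintro ⟨h1, h2⟩
    have h3 : sInf {k | Z k ω = 0} ≤ n + 1 := Nat.sInf_le h1
    have h4 : Z (sInf {k | Z k ω = 0}) ω = 0 := Nat.sInf_mem (s := {k | Z k ω = 0}) ⟨n + 1, h1⟩
    by_contra h5
    exact h2 (habs ω _ n (by omega) h4)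

end Environment

/-- **Theorem 1, first part (Böinghoff–Dyakonova–Kersting–Vatutin).**
For a critical fractional-linear branching process in i.i.d. random environment
satisfying Assumptions A1–A3, the probability of extinction exactly at moment `n+1`
satisfies `P(T = n+1) ∼ c n^{-3/2}` for some constant `c ∈ (0,∞)`. -/
theorem statement0
    {Ω : Type*} [MeasurableSpace Ω] (μ : Measure Ω) [IsProbabilityMeasure μ]
    (Q : ℕ → Ω → Measure ℕ) (Z : ℕ → Ω → ℕ)
    (hQprob : ∀ n ω, IsProbabilityMeasure (Q n ω))
    (hiid : IIDseq μ Q) (hfrac : FracLinear Q)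
    (hbranch : BranchingProperty μ Q Z)
    (hA1 : AssumptionA1 μ Q) (hA2 : AssumptionA2 μ Q) (hA3 : AssumptionA3 μ Q) :
    ∃ c : ℝ, 0 < c ∧
      Tendsto (fun n : ℕ =>
          (μ {ω | extinctTime Z ω = n + 1}).toReal / (n : ℝ) ^ (-(3 : ℝ) / 2))
        atTop (𝓝 c) := by
  obtain ⟨χ, hχ⟩ := hA1
  have : IsProbabilityMeasure (envLaw μ Q) :=
    Measure.isProbabilityMeasure_map (measurable_offspringMarks.comp (hiid.1 1)).aemeasurable
  obtain ⟨c, hc, hlim⟩ := (stepLaw_envLaw hiid hfrac hχ hA2).exists_tendsto_survival_sub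
  refine ⟨c, hc, hlim.congr fun n => ?_⟩
  congr 1
  have hsub : {ω | Z n ω = 0} ⊆ {ω | Z (n + 1) ω = 0} := fun ω h => hbranch.2.2.1 n ω h
  rw [setOf_extinctTime_eq hbranch.2.2.1, ← measureReal_def,
    measureReal_sdiff hsub (hbranch.2.1 n (measurableSet_singleton 0)),
    real_extinct_eq hiid hfrac hbranch hχ hA2, real_extinct_eq hiid hfrac hbranch hχ hA2]
  ring

end BPREpaper
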